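/- arXiv:1810.11436 — 6 statements merged into one kernel-verified Lean document; each statement's English description precedes it below -/
import Mathlib

section
/- Let S be a finite set of integers contained in an interval [N, N+M] with M > 0, let Q be a finite set of pairwise coprime integers q ≥ 2, and suppose that for each q ∈ Q the elements of S lie in at most ν(q) residue classes modulo q, where 1 ≤ ν(q) ≤ q. Define c_S := ∏_{j=1}^{S} ((j-1)^{2(j-1)} · j^j / (S+j-2)^{S+j-2})^{1/(S(S-1))} where S = #S. If ∑_{q∈Q} (log q)/ν(q) − log(c_S · M) > 0, then #S ≤ (∑_{q∈Q} log q − log(c_S · M)) / (∑_{q∈Q} (log q)/ν(q) − log(c_S · M)). -/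
/-- The constant `c_s` from the paper. -/
noncomputable def letendreC (s : ℕ) : ℝ :=
  ∏ j ∈ Finset.Icc 1 s,
    (((j - 1 : ℝ) ^ (2 * (j - 1)) * (j : ℝ) ^ j / ((s : ℝ) + j - 2) ^ (s + j - 2))
      ^ ((1 : ℝ) / (s * (s - 1))))

open Finset Polynomial

/-- **Hadamard's inequality**: the square of a determinant is at most the product of the squared
Euclidean norms of its rows. -/
theorem Matrix.det_sq_le_prod_sum_sq {n : ℕ} (A : Matrix (Fin n) (Fin n) ℝ) :
    A.det ^ 2 ≤ ∏ i, ∑ j, A i j ^ 2 := by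
  let b := EuclideanSpace.basisFun (Fin n) ℝ
  have : Fact (Module.finrank ℝ (EuclideanSpace ℝ (Fin n)) = n) := ⟨by simp⟩
  let v : Fin n → EuclideanSpace ℝ (Fin n) := fun i => WithLp.toLp 2 (A i)
  have hdet : b.toBasis.det v = A.det := by
    rw [Module.Basis.det_apply, ← Matrix.det_transpose]
    congr 1
  have h := b.toBasis.orientation.abs_volumeForm_apply_le v
  rw [Orientation.volumeForm_robust' _ b, hdet] at h
  calc A.det ^ 2 = |A.det| ^ 2 := (sq_abs _).symm
    _ ≤ (∏ i, ‖v i‖) ^ 2 := by gcongr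
    _ = ∏ i, ∑ j, A i j ^ 2 := by
      rw [← Finset.prod_pow]
      exact Finset.prod_congr rfl fun i _ => by simp [v, EuclideanSpace.real_norm_sq_eq]

/-- An affine combination of monic polynomials of the same degree is monic of that degree. -/
theorem Polynomial.Monic.affine_combination {p q : ℝ[X]} {d : ℕ} (hp : p.Monic) (hq : q.Monic)
    (hpd : p.natDegree = d) (hqd : q.natDegree = d) (u : ℝ) :
    (C u * p + C (1 - u) * q).Monic ∧ (C u * p + C (1 - u) * q).natDegree = d := by
  have hle : (C u * p + C (1 - u) * q).natDegree ≤ d :=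
    natDegree_add_le_of_degree_le ((natDegree_C_mul_le _ _).trans hpd.le)
      ((natDegree_C_mul_le _ _).trans hqd.le)
  have hc : (C u * p + C (1 - u) * q).coeff d = 1 := by
    have h1 : p.coeff d = 1 := by rw [← hpd]; exact hp
    have h2 : q.coeff d = 1 := by rw [← hqd]; exact hq
    rw [coeff_add, coeff_C_mul, coeff_C_mul, h1, h2]; ring
  exact ⟨monic_of_natDegree_le_of_coeff_eq_one d hle hc,
    natDegree_eq_of_le_of_coeff_ne_zero hle (by rw [hc]; exact one_ne_zero)⟩

/-- Pairs `(Pᵢ, Rᵢ)` of polynomials, of degrees `i + 1` and `i`, driven by mixing weights `u`.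
Formally `Pᵢ₊₁ + √(X² - X) Rᵢ₊₁` is the product of `X - 1/2 + √(X² - X)` with
`uᵢ Pᵢ + (1 - uᵢ) √(X² - X) Rᵢ`. -/
noncomputable def mixedPair (u : ℕ → ℝ) : ℕ → ℝ[X] × ℝ[X]
  | 0 => (X - C (1 / 2), 1)
  | i + 1 =>
    (C (u i) * ((X - C (1 / 2)) * (mixedPair u i).1) +
        C (1 - u i) * (X * (X - C 1) * (mixedPair u i).2),
      C (u i) * (mixedPair u i).1 + C (1 - u i) * ((X - C (1 / 2)) * (mixedPair u i).2))

theorem mixedPair_monic (u : ℕ → ℝ) (i : ℕ) :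
    ((mixedPair u i).1.Monic ∧ (mixedPair u i).1.natDegree = i + 1) ∧
      ((mixedPair u i).2.Monic ∧ (mixedPair u i).2.natDegree = i) := by
  induction i with
  | zero =>
    exact ⟨⟨monic_X_sub_C _, natDegree_X_sub_C _⟩, ⟨monic_one, natDegree_one⟩⟩
  | succ i ih =>
    obtain ⟨⟨hP, hPd⟩, hR, hRd⟩ := ih
    have hX := monic_X_sub_C (1 / 2 : ℝ)
    have hX1 : (X * (X - C 1) : ℝ[X]).Monic := monic_X.mul (monic_X_sub_C 1)
    have hX1d : (X * (X - C 1) : ℝ[X]).natDegree = 2 := by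
      rw [monic_X.natDegree_mul (monic_X_sub_C 1), natDegree_X, natDegree_X_sub_C]
    constructor
    · refine Monic.affine_combination (hX.mul hP) (hX1.mul hR) ?_ ?_ _
      · rw [hX.natDegree_mul hP, hPd, natDegree_X_sub_C]; ring
      · rw [hX1.natDegree_mul hR, hRd, hX1d]; ring
    · refine Monic.affine_combination hP (hX.mul hR) hPd ?_ _
      rw [hX.natDegree_mul hR, hRd, natDegree_X_sub_C]; ring

theorem mixedPair_succ_eval (u : ℕ → ℝ) (i : ℕ) (x : ℝ) :
    (mixedPair u (i + 1)).1.eval x ^ 2 + x * (1 - x) * (mixedPair u (i + 1)).2.eval x ^ 2 =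
      (u i ^ 2 * (mixedPair u i).1.eval x ^ 2 +
        (1 - u i) ^ 2 * (x * (1 - x) * (mixedPair u i).2.eval x ^ 2)) / 4 := by
  simp only [mixedPair, eval_add, eval_mul, eval_sub, eval_C, eval_X]
  ring

theorem mixedPair_zero_eval (u : ℕ → ℝ) (x : ℝ) :
    (mixedPair u 0).1.eval x ^ 2 + x * (1 - x) * (mixedPair u 0).2.eval x ^ 2 = 1 / 4 := by
  simp only [mixedPair, eval_sub, eval_C, eval_X, eval_one]
  ring

/-- The coefficients `g k = ∏_{1 ≤ j ≤ k} (j + 1)² / (4 (2 j + 1)²)`. -/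
noncomputable def feketeCoeff : ℕ → ℝ
  | 0 => 1
  | k + 1 => feketeCoeff k * ((k + 2 : ℝ) ^ 2 / (4 * (2 * k + 3) ^ 2))

theorem feketeCoeff_pos (k : ℕ) : 0 < feketeCoeff k := by
  induction k with
  | zero => exact one_pos
  | succ k ih => rw [feketeCoeff]; positivity

/-- The weight of the polynomial of degree `r + 1 - k` in the extremal sum of squares. -/
noncomputable def feketeWeight (k : ℕ) : ℝ :=
  feketeCoeff k * ((2 * k + 1) / (k + 1 : ℝ) ^ 2)

theorem feketeWeight_pos (k : ℕ) : 0 < feketeWeight k :=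
  mul_pos (feketeCoeff_pos k) (by positivity)

/-- The mixing weights giving the extremal sum of squares with `r + 2` terms. -/
noncomputable def feketeMix (r i : ℕ) : ℝ := ((r - i : ℕ) : ℝ) / (2 * ((r - i : ℕ) : ℝ) + 1)

theorem sum_feketeWeight_mul_sq_add (r N : ℕ) (hN : N ≤ r) (x : ℝ) :
    ∑ i ∈ range N, feketeWeight (r - i) * (mixedPair (feketeMix r) i).1.eval x ^ 2 +
      feketeCoeff (r - N) * ((mixedPair (feketeMix r) N).1.eval x ^ 2 +
        x * (1 - x) * (mixedPair (feketeMix r) N).2.eval x ^ 2) = feketeCoeff r / 4 := by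
  induction N with
  | zero => rw [mixedPair_zero_eval]; simp; ring
  | succ N ih =>
    rw [← ih (by omega), sum_range_succ, mixedPair_succ_eval]
    obtain ⟨k, rfl⟩ : ∃ k, r = N + 1 + k := ⟨r - (N + 1), by omega⟩
    have h1 : N + 1 + k - N = k + 1 := by omega
    have h2 : N + 1 + k - (N + 1) = k := by omega
    have h3 : feketeMix (N + 1 + k) N = (k + 1) / (2 * k + 3) := by
      rw [feketeMix, h1]; push_cast; ring
    rw [h1, h2, feketeWeight, feketeCoeff, h3]
    have : (2 * k + 3 : ℝ) ≠ 0 := by positivity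
    push_cast
    field_simp
    ring

theorem sum_feketeWeight_mul_sq_le (r : ℕ) {x : ℝ} (h0 : 0 ≤ x) (h1 : x ≤ 1) :
    ∑ i ∈ range (r + 1), feketeWeight (r - i) * (mixedPair (feketeMix r) i).1.eval x ^ 2 ≤
      feketeCoeff r / 4 := by
  rw [← sum_feketeWeight_mul_sq_add r r le_rfl x, sum_range_succ]
  simp only [Nat.sub_self, feketeWeight, feketeCoeff]
  have : 0 ≤ x * (1 - x) * (mixedPair (feketeMix r) r).2.eval x ^ 2 :=
    mul_nonneg (mul_nonneg h0 (by linarith)) (sq_nonneg _)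
  norm_num
  linarith

/-- The Vandermonde determinant of points of `[0, 1]` is bounded in terms of `feketeCoeff`. -/
theorem det_vandermonde_sq_mul_prod_feketeWeight_le (r : ℕ) (ξ : Fin (r + 2) → ℝ)
    (h0 : ∀ i, 0 ≤ ξ i) (h1 : ∀ i, ξ i ≤ 1) :
    (Matrix.vandermonde ξ).det ^ 2 * ∏ k ∈ range (r + 1), feketeWeight k ≤
      (r + 2) * (feketeCoeff r * ((r + 2) / (4 * (r + 1)))) ^ (r + 1) := by
  set B : ℝ := feketeCoeff r * ((r + 2) / (4 * (r + 1))) with hB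
  have hg := feketeCoeff_pos r
  have hBpos : 0 < B := by positivity
  let p : Fin (r + 2) → ℝ[X] := Fin.cons 1 fun i => (mixedPair (feketeMix r) i).1
  have hBr : 0 ≤ B / (r + 2) := by positivity
  let l : Fin (r + 2) → ℝ := Fin.cons (B / (r + 2)) fun i => feketeWeight (r - i)
  have hl : ∀ i, 0 ≤ l i := Fin.cases hBr fun i => (feketeWeight_pos _).le
  have hdet := Matrix.det_eval_matrixOfPolynomials_eq_det_vandermonde ξ p
    (Fin.cases (by simp [p]) fun i => by simpa [p] using (mixedPair_monic _ i).1.2)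
    (Fin.cases (by simp [p]) fun i => by simpa [p] using (mixedPair_monic _ i).1.1)
  have hrow : ∀ i, ∑ j, l j * (p j).eval (ξ i) ^ 2 ≤ B := fun i => by
    have := sum_feketeWeight_mul_sq_le r (h0 i) (h1 i)
    rw [← Fin.sum_univ_eq_sum_range
      fun j => feketeWeight (r - j) * (mixedPair (feketeMix r) j).1.eval (ξ i) ^ 2] at this
    rw [Fin.sum_univ_succ]
    simp only [l, p, Fin.cons_zero, Fin.cons_succ, eval_one, one_pow, mul_one]
    have hsplit : B = B / (r + 2) + feketeCoeff r / 4 := by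
      rw [hB]; field_simp; ring
    linarith
  have hH := Matrix.det_sq_le_prod_sum_sq
    (Matrix.of fun i j => Real.sqrt (l j) * (p j).eval (ξ i))
  have hscale := Matrix.det_mul_row (fun j => Real.sqrt (l j))
    (Matrix.of fun i j => (p j).eval (ξ i))
  simp only [Matrix.of_apply] at hscale
  rw [hscale, ← hdet, mul_pow, ← Finset.prod_pow] at hH
  simp only [Matrix.of_apply, mul_pow, Real.sq_sqrt (hl _)] at hH
  have hprod : ∏ i, ∑ j, l j * (p j).eval (ξ i) ^ 2 ≤ B ^ (r + 2) := by
    refine (Finset.prod_le_prod (fun i _ => Finset.sum_nonneg fun j _ =>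
      mul_nonneg (hl j) (sq_nonneg _)) fun i _ => hrow i).trans ?_
    simp
  have hlprod : ∏ j, l j = B / (r + 2) * ∏ k ∈ range (r + 1), feketeWeight k := by
    rw [Fin.prod_univ_succ, ← Finset.prod_range_reflect, ← Fin.prod_univ_eq_prod_range]
    simp [l]
  have h := hH.trans hprod
  rw [hlprod, pow_succ' B (r + 1)] at h
  have hr : (0 : ℝ) < r + 2 := by positivity
  have h' : B / (r + 2) * ((Matrix.vandermonde ξ).det ^ 2 * ∏ k ∈ range (r + 1), feketeWeight k) ≤
      B / (r + 2) * ((r + 2) * B ^ (r + 1)) := by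
    calc _ = B / (r + 2) * (∏ k ∈ range (r + 1), feketeWeight k) *
          (Matrix.vandermonde ξ).det ^ 2 := by ring
      _ ≤ _ := h
      _ = _ := by field_simp
  exact le_of_mul_le_mul_left h' (by positivity)

/-- The product defining `letendreC s`, before taking the `s (s - 1)`-th root. -/
noncomputable def feketeDiscr (s : ℕ) : ℝ :=
  ∏ j ∈ Icc 1 s,
    ((j - 1 : ℝ) ^ (2 * (j - 1)) * (j : ℝ) ^ j / ((s : ℝ) + j - 2) ^ (s + j - 2))

theorem feketeDiscr_succ_eq_div (r : ℕ) :
    feketeDiscr (r + 1) =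
      (∏ j ∈ range (r + 1), (j : ℝ) ^ (2 * j) * ((j + 1 : ℕ) : ℝ) ^ (j + 1)) /
        ∏ j ∈ range (r + 1), ((r + j : ℕ) : ℝ) ^ (r + j) := by
  rw [feketeDiscr, ← Finset.prod_div_distrib, ← Finset.Ico_add_one_right_eq_Icc,
    Finset.prod_Ico_eq_prod_range]
  refine Finset.prod_congr (by simp) fun j _ => ?_
  have h1 : 1 + j - 1 = j := by omega
  have h2 : r + 1 + (1 + j) - 2 = r + j := by omega
  rw [h1, h2]
  push_cast
  congr 1
  · congr 2
    · ring
    · ring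
    · ring
  · congr 1
    ring

theorem natCast_pow_self_pos (n : ℕ) : (0 : ℝ) < (n : ℝ) ^ n := by
  rcases n.eq_zero_or_pos with rfl | h
  · simp
  · positivity

theorem feketeDiscr_pos (r : ℕ) : 0 < feketeDiscr (r + 1) := by
  rw [feketeDiscr_succ_eq_div]
  refine div_pos (Finset.prod_pos fun j _ => mul_pos ?_ (natCast_pow_self_pos _))
    (Finset.prod_pos fun j _ => natCast_pow_self_pos _)
  rw [mul_comm, pow_mul]
  exact pow_pos (natCast_pow_self_pos j) 2

theorem feketeDiscr_succ (r : ℕ) :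
    feketeDiscr (r + 2) * (4 ^ (r + 1) * ((2 * r + 1 : ℕ) : ℝ) ^ (2 * r + 1)) =
      feketeDiscr (r + 1) * (((r + 2 : ℕ) : ℝ) ^ (r + 2) * (r : ℝ) ^ r) := by
  rw [feketeDiscr_succ_eq_div, feketeDiscr_succ_eq_div]
  have hden : (∏ j ∈ range (r + 2), ((r + 1 + j : ℕ) : ℝ) ^ (r + 1 + j)) * (r : ℝ) ^ r =
      (∏ j ∈ range (r + 1), ((r + j : ℕ) : ℝ) ^ (r + j)) *
        (((2 * r + 1 : ℕ) : ℝ) ^ (2 * r + 1) *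
          (4 ^ (r + 1) * ((r + 1 : ℕ) : ℝ) ^ (2 * (r + 1)))) := by
    have h := Finset.prod_range_succ' (fun j => ((r + j : ℕ) : ℝ) ^ (r + j)) (r + 2)
    rw [Finset.prod_range_succ, Finset.prod_range_succ] at h
    have h4 : ((r + (r + 2) : ℕ) : ℝ) ^ (r + (r + 2)) =
        4 ^ (r + 1) * ((r + 1 : ℕ) : ℝ) ^ (2 * (r + 1)) := by
      rw [show r + (r + 2) = 2 * (r + 1) by ring, pow_mul, pow_mul, ← mul_pow]
      push_cast
      ring
    rw [h4, show r + (r + 1) = 2 * r + 1 by ring, mul_assoc] at h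
    rw [h]
    simp [add_assoc, add_comm 1]
  have hp1 : (0 : ℝ) < ∏ j ∈ range (r + 1), ((r + j : ℕ) : ℝ) ^ (r + j) :=
    Finset.prod_pos fun j _ => natCast_pow_self_pos _
  have hp2 : (0 : ℝ) < ∏ j ∈ range (r + 2), ((r + 1 + j : ℕ) : ℝ) ^ (r + 1 + j) :=
    Finset.prod_pos fun j _ => natCast_pow_self_pos _
  rw [Finset.prod_range_succ _ (r + 1), div_mul_eq_mul_div, div_mul_eq_mul_div,
    div_eq_div_iff hp2.ne' hp1.ne']
  linear_combination (-(∏ j ∈ range (r + 1), (j : ℝ) ^ (2 * j) * ((j + 1 : ℕ) : ℝ) ^ (j + 1)) *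
    ((r + 2 : ℕ) : ℝ) ^ (r + 2)) * hden

theorem feketeDiscr_mul_prod_feketeWeight (r : ℕ) :
    feketeDiscr (r + 2) * ∏ k ∈ range (r + 1), feketeWeight k =
      (r + 2) * (feketeCoeff r * ((r + 2) / (4 * (r + 1)))) ^ (r + 1) := by
  induction r with
  | zero =>
    have h : Icc 1 2 = ({1, 2} : Finset ℕ) := by decide
    norm_num [feketeDiscr, feketeWeight, feketeCoeff, h]
  | succ r ih =>
    have hrec := feketeDiscr_succ (r + 1)
    have hne : (4 ^ (r + 2) * ((2 * (r + 1) + 1 : ℕ) : ℝ) ^ (2 * (r + 1) + 1)) ≠ 0 := by positivity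
    apply mul_right_cancel₀ hne
    rw [Finset.prod_range_succ]
    have hg := feketeCoeff_pos r
    calc _ = feketeDiscr (r + 1 + 2) * (4 ^ (r + 2) *
          ((2 * (r + 1) + 1 : ℕ) : ℝ) ^ (2 * (r + 1) + 1)) *
          ((∏ k ∈ range (r + 1), feketeWeight k) * feketeWeight (r + 1)) := by ring
      _ = (feketeDiscr (r + 2) * ∏ k ∈ range (r + 1), feketeWeight k) *
          (((r + 3 : ℕ) : ℝ) ^ (r + 3) * ((r + 1 : ℕ) : ℝ) ^ (r + 1) * feketeWeight (r + 1)) := by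
        rw [hrec]; ring
      _ = _ := by
        rw [ih, feketeWeight, feketeCoeff]
        have h3 : (2 * r + 3 : ℝ) ≠ 0 := by positivity
        push_cast
        rw [show (2 * ((r : ℝ) + 1) + 1) = 2 * r + 3 by ring,
          show ((r : ℝ) + 1 + 2) = r + 3 by ring, show ((r : ℝ) + 1 + 1) = r + 2 by ring]
        simp only [mul_pow, div_pow]
        field_simp
        generalize (r : ℝ) + 3 = a, (r : ℝ) + 2 = b, (r : ℝ) * 2 + 3 = c
        ring

/-- Points of `[0, 1]` have a Vandermonde determinant of square at most `feketeDiscr`. -/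
theorem det_vandermonde_sq_le_feketeDiscr (r : ℕ) (ξ : Fin (r + 2) → ℝ)
    (h0 : ∀ i, 0 ≤ ξ i) (h1 : ∀ i, ξ i ≤ 1) :
    (Matrix.vandermonde ξ).det ^ 2 ≤ feketeDiscr (r + 2) := by
  refine le_of_mul_le_mul_right ?_ (Finset.prod_pos fun k (_ : k ∈ range (r + 1)) =>
    feketeWeight_pos k)
  rw [feketeDiscr_mul_prod_feketeWeight]
  exact det_vandermonde_sq_mul_prod_feketeWeight_le r ξ h0 h1

theorem letendreC_eq_feketeDiscr_rpow (s : ℕ) (hs : 0 < s) :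
    letendreC s = feketeDiscr s ^ ((1 : ℝ) / (s * (s - 1))) := by
  rw [letendreC, feketeDiscr]
  refine Real.finsetProd_rpow _ _ (fun j hj => ?_) _
  have hj1 : (1 : ℝ) ≤ j := by exact_mod_cast (Finset.mem_Icc.1 hj).1
  have hs1 : (1 : ℝ) ≤ s := by exact_mod_cast hs
  have h1 : (0 : ℝ) ≤ j - 1 := by linarith
  have h2 : (0 : ℝ) ≤ s + j - 2 := by linarith
  positivity

theorem sum_log_abs_sub_eq_log_det_vandermonde_sq {n : ℕ} (ξ : Fin n → ℝ)
    (hξ : Function.Injective ξ) :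
    ∑ i, ∑ j ∈ {i}ᶜ, Real.log |ξ j - ξ i| = Real.log ((Matrix.vandermonde ξ).det ^ 2) := by
  have hne : ∀ i, ∀ j ∈ Ioi i, ξ j - ξ i ≠ 0 := fun i j hj =>
    sub_ne_zero.2 (hξ.ne (Finset.mem_Ioi.1 hj).ne')
  rw [← Finset.sum_sum_Ioi_add_eq_sum_sum_off_diag fun i j => Real.log |ξ i - ξ j|,
    Matrix.det_vandermonde, Real.log_pow,
    Real.log_prod fun i _ => Finset.prod_ne_zero_iff.2 (hne i), Finset.mul_sum]
  refine Finset.sum_congr rfl fun i _ => ?_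
  rw [Real.log_prod (hne i), Finset.mul_sum]
  refine Finset.sum_congr rfl fun j _ => ?_
  rw [abs_sub_comm (ξ i), Real.log_abs]
  push_cast
  ring

/-- The sum of the logarithms of the mutual distances of `r + 2` points in an interval of
length `M`. The diagonal terms vanish. -/
theorem sum_log_abs_sub_le (r : ℕ) (x : Fin (r + 2) → ℝ) (hx : Function.Injective x) {N M : ℝ}
    (hM : 0 < M) (hmem : ∀ i, N ≤ x i ∧ x i ≤ N + M) :
    ∑ i, ∑ j, Real.log |x j - x i| ≤
      (r + 2) * (r + 1) * Real.log (letendreC (r + 2) * M) := by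
  let ξ : Fin (r + 2) → ℝ := fun i => (x i - N) / M
  have hξ : Function.Injective ξ := fun i j h => hx (by
    have := (div_left_inj' hM.ne').1 h
    linarith)
  have hdet := det_vandermonde_sq_le_feketeDiscr r ξ
    (fun i => div_nonneg (by linarith [hmem i]) hM.le)
    (fun i => (div_le_one hM).2 (by linarith [hmem i]))
  have hdet0 : 0 < (Matrix.vandermonde ξ).det ^ 2 :=
    sq_pos_of_ne_zero (Matrix.det_vandermonde_ne_zero_iff.2 hξ)
  have hterm : ∀ i, ∑ j, Real.log |x j - x i| =
      (r + 1) * Real.log M + ∑ j ∈ {i}ᶜ, Real.log |ξ j - ξ i| := fun i => by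
    rw [← Finset.sum_add_sum_compl {i}, Finset.sum_singleton, sub_self, abs_zero, Real.log_zero,
      zero_add]
    have : ∀ j ∈ ({i}ᶜ : Finset (Fin (r + 2))),
        Real.log |x j - x i| = Real.log M + Real.log |ξ j - ξ i| := fun j hj => by
      have hne : ξ j - ξ i ≠ 0 := sub_ne_zero.2 (hξ.ne (by simpa using hj))
      rw [Real.log_abs, Real.log_abs, ← Real.log_mul hM.ne' hne]
      congr 1
      simp only [ξ]
      field_simp
      ring
    rw [Finset.sum_congr rfl this, Finset.sum_add_distrib, Finset.sum_const, Finset.card_compl]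
    simp
  have hD := feketeDiscr_pos (r + 1)
  have hC : Real.log (letendreC (r + 2) * M) =
      1 / ((r + 2) * (r + 1)) * Real.log (feketeDiscr (r + 2)) + Real.log M := by
    rw [letendreC_eq_feketeDiscr_rpow _ (by omega),
      Real.log_mul (Real.rpow_pos_of_pos hD _).ne' hM.ne', Real.log_rpow hD]
    push_cast
    congr 3
    ring
  rw [Finset.sum_congr rfl fun i _ => hterm i, Finset.sum_add_distrib,
    sum_log_abs_sub_eq_log_det_vandermonde_sq ξ hξ, hC]
  have hlog := Real.log_le_log hdet0 hdet
  have hr : ((r : ℝ) + 2) * (r + 1) ≠ 0 := by positivity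
  rw [mul_add, ← mul_assoc, mul_one_div_cancel hr]
  simp only [Finset.sum_const, Finset.card_univ, Fintype.card_fin, nsmul_eq_mul]
  push_cast
  linarith

/-- The number of pairs with equal image under `f` is at least `#S ^ 2` divided by the size of
the image. -/
theorem card_sq_le_card_image_mul_card_pairs {α β : Type*} [DecidableEq β] (S : Finset α)
    (f : α → β) :
    S.card ^ 2 ≤ (S.image f).card * ∑ x ∈ S, ∑ y ∈ S, if f x = f y then 1 else 0 := by
  have hpairs : ∑ x ∈ S, ∑ y ∈ S, (if f x = f y then 1 else 0) =
      ∑ c ∈ S.image f, (S.filter fun y => f y = c).card ^ 2 := by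
    rw [← Finset.sum_fiberwise_of_maps_to fun x hx => Finset.mem_image_of_mem f hx]
    refine Finset.sum_congr rfl fun c _ => ?_
    rw [sq, ← smul_eq_mul, ← Finset.sum_const]
    refine Finset.sum_congr rfl fun x hx => ?_
    rw [Finset.card_filter]
    refine Finset.sum_congr rfl fun y _ => ?_
    rw [(Finset.mem_filter.1 hx).2]
    simp only [eq_comm]
  rw [hpairs]
  conv_lhs => rw [Finset.card_eq_sum_card_image f S]
  exact sq_sum_le_card_mul_sum_sq

theorem sum_log_dvd_le_log_abs {Q : Finset ℤ} (hQ2 : ∀ q ∈ Q, 2 ≤ q)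
    (hcop : (Q : Set ℤ).Pairwise IsCoprime) {z : ℤ} (hz : z ≠ 0) :
    ∑ q ∈ Q, (if q ∣ z then Real.log q else 0) ≤ Real.log |(z : ℝ)| := by
  rw [← Finset.sum_filter, ← Real.log_prod fun q hq => by
    have := hQ2 q (Finset.mem_filter.1 hq).1
    exact_mod_cast (show q ≠ 0 by omega)]
  have hpos : 0 < ∏ q ∈ Q.filter (· ∣ z), q := Finset.prod_pos fun q hq => by
    have := hQ2 q (Finset.mem_filter.1 hq).1
    omega
  have hdvd : ∏ q ∈ Q.filter (· ∣ z), q ∣ z := by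
    refine Finset.prod_dvd_of_coprime (fun a ha b hb hab => ?_)
      fun q hq => (Finset.mem_filter.1 hq).2
    exact hcop (Finset.mem_filter.1 ha).1 (Finset.mem_filter.1 hb).1 hab
  have hle := Int.le_of_dvd (abs_pos.2 hz) ((dvd_abs _ _).2 hdvd)
  rw [← Int.cast_prod, ← Int.cast_abs]
  exact Real.log_le_log (by exact_mod_cast hpos) (by exact_mod_cast hle)

/-- The arithmetic half of the larger sieve. -/
theorem larger_sieve_sum_log_le (S Q : Finset ℤ) (ν : ℤ → ℕ) (hQ2 : ∀ q ∈ Q, 2 ≤ q)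
    (hcop : (Q : Set ℤ).Pairwise IsCoprime) (hν : ∀ q ∈ Q, 1 ≤ ν q)
    (hclass : ∀ q ∈ Q, (S.image (fun x => x % q)).card ≤ ν q) :
    (S.card : ℝ) ^ 2 * ∑ q ∈ Q, Real.log q / ν q - S.card * ∑ q ∈ Q, Real.log q ≤
      ∑ x ∈ S, ∑ y ∈ S, Real.log |((y : ℝ) - x)| := by
  have hlog : ∀ q ∈ Q, 0 ≤ Real.log q := fun q hq =>
    Real.log_nonneg (by exact_mod_cast (show 1 ≤ q by linarith [hQ2 q hq]))
  have hpair : ∀ x ∈ S, ∀ y ∈ S,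
      ∑ q ∈ Q, (if x % q = y % q then Real.log q else 0) -
        (if x = y then ∑ q ∈ Q, Real.log q else 0) ≤ Real.log |((y : ℝ) - x)| := by
    intro x _ y _
    by_cases hxy : x = y
    · simp [hxy]
    · have h := sum_log_dvd_le_log_abs hQ2 hcop (sub_ne_zero.2 (Ne.symm hxy))
      have hmod : ∀ q, x % q = y % q ↔ q ∣ y - x := fun q => Int.modEq_iff_dvd
      simpa only [hmod, if_neg hxy, sub_zero, Int.cast_sub] using h
  have hq : ∀ q ∈ Q, (S.card : ℝ) ^ 2 * (Real.log q / ν q) ≤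
      ∑ x ∈ S, ∑ y ∈ S, (if x % q = y % q then Real.log q else 0) := by
    intro q hqQ
    have hν0 : (0 : ℝ) < ν q := by exact_mod_cast hν q hqQ
    have hcard : (S.card : ℝ) ^ 2 ≤
        ν q * ∑ x ∈ S, ∑ y ∈ S, (if x % q = y % q then (1 : ℝ) else 0) := by
      exact_mod_cast (card_sq_le_card_image_mul_card_pairs S (fun x => x % q)).trans
        (Nat.mul_le_mul_right _ (hclass q hqQ))
    calc (S.card : ℝ) ^ 2 * (Real.log q / ν q) ≤
        ν q * (∑ x ∈ S, ∑ y ∈ S, (if x % q = y % q then (1 : ℝ) else 0)) *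
          (Real.log q / ν q) :=
          mul_le_mul_of_nonneg_right hcard (div_nonneg (hlog q hqQ) hν0.le)
      _ = (∑ x ∈ S, ∑ y ∈ S, (if x % q = y % q then (1 : ℝ) else 0)) * Real.log q := by
          field_simp
      _ = _ := by simp only [Finset.sum_mul, ite_mul, one_mul, zero_mul]
  have hsum := Finset.sum_le_sum fun x hx => Finset.sum_le_sum (hpair x hx)
  simp only [Finset.sum_sub_distrib] at hsum
  have hdiag : ∑ x ∈ S, ∑ y ∈ S, (if x = y then ∑ q ∈ Q, Real.log q else 0) =
      S.card * ∑ q ∈ Q, Real.log q := by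
    simp
  have hswap : ∑ x ∈ S, ∑ y ∈ S, ∑ q ∈ Q, (if x % q = y % q then Real.log q else 0) =
      ∑ q ∈ Q, ∑ x ∈ S, ∑ y ∈ S, (if x % q = y % q then Real.log q else 0) := by
    rw [Finset.sum_comm (s := Q)]
    exact Finset.sum_congr rfl fun x _ => Finset.sum_comm
  have hlow := Finset.sum_le_sum hq
  rw [← Finset.mul_sum] at hlow
  rw [hdiag, hswap] at hsum
  linarith

theorem larger_sieve_improved
    (S : Finset ℤ) (Q : Finset ℤ) (ν : ℤ → ℕ) (N M : ℝ) (hM : 0 < M)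
    (hS : ∀ x ∈ S, N ≤ (x : ℝ) ∧ (x : ℝ) ≤ N + M)
    (hQ2 : ∀ q ∈ Q, 2 ≤ q)
    (hcop : (Q : Set ℤ).Pairwise IsCoprime)
    (hν : ∀ q ∈ Q, 1 ≤ ν q ∧ (ν q : ℤ) ≤ q)
    (hclass : ∀ q ∈ Q, (S.image (fun x => x % q)).card ≤ ν q)
    (hden : 0 < ∑ q ∈ Q, Real.log q / ν q - Real.log (letendreC S.card * M)) :
    (S.card : ℝ) ≤
      (∑ q ∈ Q, Real.log q - Real.log (letendreC S.card * M)) /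
        (∑ q ∈ Q, Real.log q / ν q - Real.log (letendreC S.card * M)) := by
  rw [le_div_iff₀ hden]
  rcases le_or_gt S.card 1 with hcard | hcard
  · have hle : ∑ q ∈ Q, Real.log q / ν q ≤ ∑ q ∈ Q, Real.log q :=
      Finset.sum_le_sum fun q hq => div_le_self
        (Real.log_nonneg (by exact_mod_cast (show 1 ≤ q by linarith [hQ2 q hq])))
        (by exact_mod_cast (hν q hq).1)
    have h1 : (S.card : ℝ) ≤ 1 := by exact_mod_cast hcard
    calc _ ≤ 1 * (∑ q ∈ Q, Real.log q / ν q - Real.log (letendreC S.card * M)) :=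
          mul_le_mul_of_nonneg_right h1 hden.le
      _ ≤ _ := by linarith
  · obtain ⟨r, hr⟩ : ∃ r, S.card = r + 2 := ⟨S.card - 2, by omega⟩
    have hlow := larger_sieve_sum_log_le S Q ν hQ2 hcop (fun q hq => (hν q hq).1) hclass
    let e := (S.equivFinOfCardEq hr).symm
    have hup := sum_log_abs_sub_le r (fun i => ((e i : ℤ) : ℝ))
      (fun i j h => e.injective (Subtype.ext (Int.cast_injective h))) hM
      (fun i => hS _ (e i).2)
    have hsum : ∑ x ∈ S, ∑ y ∈ S, Real.log |((y : ℝ) - x)| =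
        ∑ i, ∑ j, Real.log |(((e j : ℤ) : ℝ) - (e i : ℤ))| := by
      rw [← Finset.sum_coe_sort S, ← e.sum_comp]
      refine Finset.sum_congr rfl fun i _ => ?_
      rw [← Finset.sum_coe_sort S, ← e.sum_comp]
    rw [hsum] at hlow
    rw [hr] at hlow ⊢
    push_cast at hlow ⊢
    have hr2 : (0 : ℝ) < r + 2 := by positivity
    refine le_of_mul_le_mul_left ?_ hr2
    linarith
end

section
/- For every integer s ≥ 2, the maximum of ∏_{1 ≤ i < j ≤ s} (ξ_j − ξ_i) over all real tuples 0 ≤ ξ_1 ≤ ξ_2 ≤ ⋯ ≤ ξ_s ≤ 1 equals c_s^{s(s-1)/2}, where c_s := ∏_{j=1}^{s} ((j-1)^{2(j-1)} · j^j / (s+j-2)^{s+j-2})^{1/(s(s-1))}. -/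
open Polynomial Finset Lagrange

/-- The monic Legendre polynomial of degree `n` for the interval `[0, 1]`. -/
noncomputable def monicLegendre : ℕ → ℝ[X]
  | 0 => 1
  | 1 => X - C (1 / 2)
  | n + 2 => C (-((n + 1) ^ 2 / (4 * (2 * n + 1) * (2 * n + 3)) : ℝ)) * monicLegendre n +
      monicLegendre (n + 1) * (X - C (1 / 2))

/-- The monic polynomial of degree `n + 2` whose roots are the Fekete points of `[0, 1]`. -/
noncomputable def feketePoly (n : ℕ) : ℝ[X] :=
  C (-((n + 1) / (4 * (2 * n + 1)) : ℝ)) * monicLegendre n +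
    monicLegendre (n + 1) * (X - C (1 / 2))

theorem monic_add_mul_X_sub_C {R : Type*} [CommRing R] [Nontrivial R] {n : ℕ} {p q : R[X]}
    (a c : R) (hp : p.Monic) (hpn : p.natDegree = n + 1) (hq : q.natDegree = n) :
    (C a * q + p * (X - C c)).Monic ∧ (C a * q + p * (X - C c)).natDegree = n + 2 := by
  have hm : (p * (X - C c)).Monic := hp.mul (monic_X_sub_C c)
  have hd : (p * (X - C c)).natDegree = n + 2 := by
    rw [hp.natDegree_mul (monic_X_sub_C c), natDegree_X_sub_C, hpn]
  have hlt : (C a * q).natDegree < (p * (X - C c)).natDegree := by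
    have := natDegree_C_mul_le a q
    omega
  exact ⟨hm.add_of_right (degree_lt_degree hlt),
    (natDegree_add_eq_right_of_natDegree_lt hlt).trans hd⟩

theorem monicLegendre_monic_natDegree (n : ℕ) :
    (monicLegendre n).Monic ∧ (monicLegendre n).natDegree = n := by
  induction n using Nat.twoStepInduction with
  | zero => simp [monicLegendre]
  | one => exact ⟨monic_X_sub_C _, natDegree_X_sub_C _⟩
  | more n ih₀ ih₁ => exact monic_add_mul_X_sub_C _ _ ih₁.1 ih₁.2 ih₀.2

theorem monicLegendre_monic (n : ℕ) : (monicLegendre n).Monic :=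
  (monicLegendre_monic_natDegree n).1

theorem natDegree_monicLegendre (n : ℕ) : (monicLegendre n).natDegree = n :=
  (monicLegendre_monic_natDegree n).2

theorem feketePoly_monic (n : ℕ) : (feketePoly n).Monic :=
  (monic_add_mul_X_sub_C _ _ (monicLegendre_monic _) (natDegree_monicLegendre _)
    (natDegree_monicLegendre n)).1

theorem natDegree_feketePoly (n : ℕ) : (feketePoly n).natDegree = n + 2 :=
  (monic_add_mul_X_sub_C _ _ (monicLegendre_monic _) (natDegree_monicLegendre _)
    (natDegree_monicLegendre n)).2

theorem eval_derivative_monicLegendre (n : ℕ) (x : ℝ) :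
    x * (x - 1) * (derivative (monicLegendre (n + 1))).eval x =
        (n + 1) * ((x - 1 / 2) * (monicLegendre (n + 1)).eval x -
          (n + 1) / (4 * (2 * n + 1)) * (monicLegendre n).eval x) ∧
      x * (x - 1) * (derivative (monicLegendre n)).eval x =
        (2 * n + 1) * (monicLegendre (n + 1)).eval x -
          (n + 1) * (x - 1 / 2) * (monicLegendre n).eval x := by
  induction n with
  | zero =>
    refine ⟨?_, by simp [monicLegendre]⟩
    simp [monicLegendre]
    ring
  | succ n ih =>
    obtain ⟨h₁, h₀⟩ := ih
    have e := congrArg (eval x) (monicLegendre.eq_3 n)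
    have e' := congrArg (fun p => eval x (derivative p)) (monicLegendre.eq_3 n)
    simp only [derivative_add, derivative_mul, derivative_C, derivative_sub, derivative_X, eval_add,
      eval_mul, eval_sub, eval_C, eval_X, zero_mul, zero_add, sub_zero, mul_one] at e e'
    simp only [Nat.succ_eq_add_one, add_assoc, Nat.reduceAdd] at e e'
    simp only [add_assoc, Nat.reduceAdd, e, e']
    push_cast
    have k₁ : (2 * n + 1 : ℝ) ≠ 0 := by positivity
    have k₂ : (2 * n + 3 : ℝ) ≠ 0 := by positivity
    have k₃ : (2 * (n + 1) + 1 : ℝ) ≠ 0 := by positivity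
    constructor
    · have : x * (x - 1) * (-((n + 1) ^ 2 / (4 * (2 * n + 1) * (2 * n + 3)) : ℝ) *
          eval x (derivative (monicLegendre n)) +
          (eval x (derivative (monicLegendre (n + 1))) * (x - 1 / 2) +
            eval x (monicLegendre (n + 1)))) =
          -((n + 1) ^ 2 / (4 * (2 * n + 1) * (2 * n + 3)) : ℝ) *
          (x * (x - 1) * eval x (derivative (monicLegendre n))) +
          (x * (x - 1) * eval x (derivative (monicLegendre (n + 1))) * (x - 1 / 2) +
            x * (x - 1) * eval x (monicLegendre (n + 1))) := by ring
      rw [this, h₁, h₀]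
      field_simp
      ring
    · rw [h₁]
      field_simp
      ring

theorem X_mul_derivative_monicLegendre (n : ℕ) :
    X * (X - 1) * derivative (monicLegendre (n + 1)) = C (n + 1 : ℝ) * feketePoly n := by
  refine Polynomial.funext fun x => ?_
  have h := (eval_derivative_monicLegendre n x).1
  simp only [feketePoly, eval_mul, eval_sub, eval_add, eval_X, eval_C, eval_one, h]
  ring

theorem derivative_feketePoly (n : ℕ) :
    derivative (feketePoly n) = C (n + 2 : ℝ) * monicLegendre (n + 1) := by
  have hX : (X * (X - 1) : ℝ[X]) ≠ 0 := mul_ne_zero X_ne_zero (X_sub_C_ne_zero 1)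
  refine mul_left_cancel₀ hX (Polynomial.funext fun x => ?_)
  obtain ⟨h₁, h₀⟩ := eval_derivative_monicLegendre n x
  have k₁ : (2 * n + 1 : ℝ) ≠ 0 := by positivity
  simp only [feketePoly, derivative_add, derivative_mul, derivative_C, derivative_sub, derivative_X,
    eval_add, eval_mul, eval_sub, eval_C, eval_X, eval_one, zero_mul, zero_add, sub_zero, mul_one]
  have : x * (x - 1) * (-((n + 1) / (4 * (2 * n + 1)) : ℝ) *
        eval x (derivative (monicLegendre n)) +
      (eval x (derivative (monicLegendre (n + 1))) * (x - 1 / 2) +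
        eval x (monicLegendre (n + 1)))) =
      -((n + 1) / (4 * (2 * n + 1)) : ℝ) *
        (x * (x - 1) * eval x (derivative (monicLegendre n))) +
      (x * (x - 1) * eval x (derivative (monicLegendre (n + 1))) * (x - 1 / 2) +
        x * (x - 1) * eval x (monicLegendre (n + 1))) := by ring
  rw [this, h₁, h₀]
  field_simp
  ring

theorem feketePoly_ode (n : ℕ) :
    X * (X - 1) * derivative (derivative (feketePoly n)) =
      C ((n + 2) * (n + 1) : ℝ) * feketePoly n := by
  rw [derivative_feketePoly, derivative_C_mul, mul_left_comm, X_mul_derivative_monicLegendre,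
    C_mul, mul_assoc]

theorem coeff_X_mul_X_sub_one_mul_derivative₂ (h : ℝ[X]) (d : ℕ) :
    (X * (X - 1) * derivative (derivative h)).coeff d =
      d * (d - 1) * h.coeff d - (d + 1) * d * h.coeff (d + 1) := by
  rw [mul_assoc, sub_mul, one_mul]
  rcases d with _ | _ | d
  · simp
  · simp [coeff_X_mul, coeff_derivative, mul_coeff_zero]
    ring
  · simp [coeff_X_mul, coeff_derivative]
    ring

theorem eq_zero_of_ode {n : ℕ} {h : ℝ[X]} (hdeg : h.natDegree < n + 2)
    (hode : X * (X - 1) * derivative (derivative h) = C ((n + 2) * (n + 1) : ℝ) * h) : h = 0 := by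
  by_contra hne
  have hlc : h.coeff h.natDegree ≠ 0 := leadingCoeff_ne_zero.mpr hne
  have hsucc : h.coeff (h.natDegree + 1) = 0 := coeff_eq_zero_of_natDegree_lt (by omega)
  have hc := congrArg (coeff · h.natDegree) hode
  simp only [coeff_X_mul_X_sub_one_mul_derivative₂, coeff_C_mul, hsucc, mul_zero, sub_zero] at hc
  have hd := mul_right_cancel₀ hlc hc
  have hlt : (h.natDegree : ℝ) + 1 ≤ n + 2 := by exact_mod_cast hdeg
  have h0 : (0 : ℝ) ≤ h.natDegree := Nat.cast_nonneg _
  have h1 : (0 : ℝ) ≤ n := Nat.cast_nonneg n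
  nlinarith

theorem abs_resultant_add_mul_monicLegendre (n : ℕ) (a c : ℝ) :
    |resultant (C a * monicLegendre n + monicLegendre (n + 1) * (X - C c)) (monicLegendre (n + 1))
        (n + 2) (n + 1)| =
      |a| ^ (n + 1) * |resultant (monicLegendre (n + 1)) (monicLegendre n) (n + 1) n| := by
  have hlc : (monicLegendre (n + 1)).coeff (n + 1) = 1 := by
    have := monicLegendre_monic (n + 1)
    rwa [Monic, leadingCoeff, natDegree_monicLegendre] at this
  rw [resultant_add_mul_left _ _ _ _ _ (by rw [natDegree_X_sub_C]; omega)
    (natDegree_monicLegendre _).le, resultant_C_mul_left,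
    resultant_add_left_deg _ _ _ _ _ (natDegree_monicLegendre n).le, hlc, resultant_comm]
  simp [abs_mul]

theorem abs_resultant_monicLegendre (n : ℕ) :
    |resultant (monicLegendre (n + 1)) (monicLegendre n) (n + 1) n| =
      ∏ k ∈ Finset.range n, ((k + 1) ^ 2 / (4 * (2 * k + 1) * (2 * k + 3)) : ℝ) ^ (k + 1) := by
  induction n with
  | zero => simp [monicLegendre]
  | succ n ih =>
    rw [Finset.prod_range_succ, ← ih, monicLegendre, abs_resultant_add_mul_monicLegendre, abs_neg,
      abs_of_nonneg (by positivity), mul_comm]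

theorem abs_resultant_feketePoly (n : ℕ) :
    |resultant (feketePoly n) (monicLegendre (n + 1)) (n + 2) (n + 1)| =
      ((n + 1) / (4 * (2 * n + 1)) : ℝ) ^ (n + 1) *
      ∏ k ∈ Finset.range n, ((k + 1) ^ 2 / (4 * (2 * k + 1) * (2 * k + 3)) : ℝ) ^ (k + 1) := by
  rw [feketePoly, abs_resultant_add_mul_monicLegendre, abs_resultant_monicLegendre, abs_neg,
    abs_of_nonneg (by positivity)]

theorem nodal_eq_feketePoly {n : ℕ} {ξ : Fin (n + 2) → ℝ} (hinj : Function.Injective ξ)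
    (hcrit : ∀ i, ξ i ≠ 0 → ξ i ≠ 1 →
      (derivative (derivative (nodal univ ξ))).eval (ξ i) = 0) :
    nodal univ ξ = feketePoly n := by
  have hdeg : (nodal univ ξ).natDegree = n + 2 := by simp [natDegree_nodal]
  have hmonic : (nodal univ ξ).Monic := nodal_monic
  have hlc : (nodal univ ξ).coeff (n + 2) = 1 := by
    rwa [Monic, leadingCoeff, hdeg] at hmonic
  have hode : X * (X - 1) * derivative (derivative (nodal univ ξ)) =
      C ((n + 2) * (n + 1) : ℝ) * nodal univ ξ := by
    refine eq_of_degree_sub_lt_of_eval_index_eq univ hinj.injOn ?_ fun i _ => ?_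
    · rw [degree_lt_iff_coeff_zero]
      intro m hm
      simp only [card_univ, Fintype.card_fin] at hm
      rw [coeff_sub, coeff_C_mul, coeff_X_mul_X_sub_one_mul_derivative₂,
        coeff_eq_zero_of_natDegree_lt (n := m + 1) (by omega)]
      rcases hm.eq_or_lt with rfl | hm
      · rw [hlc]
        push_cast
        ring
      · rw [coeff_eq_zero_of_natDegree_lt (by omega)]
        ring
    · have h0 : eval (ξ i) (nodal univ ξ) = 0 := eval_nodal_at_node (mem_univ i)
      rw [eval_mul, eval_mul (p := C _), h0, mul_zero]
      by_cases hi0 : ξ i = 0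
      · simp [hi0]
      by_cases hi1 : ξ i = 1
      · simp [hi1]
      · rw [hcrit i hi0 hi1, mul_zero]
  rw [← sub_eq_zero]
  refine eq_zero_of_ode (n := n) ?_ ?_
  · by_contra hlt
    have hd : (nodal univ ξ).degree = (feketePoly n).degree := by
      rw [degree_eq_natDegree hmonic.ne_zero, degree_eq_natDegree (feketePoly_monic n).ne_zero,
        hdeg, natDegree_feketePoly]
    have := degree_sub_lt_left hd hmonic.ne_zero
      (hmonic.leadingCoeff.trans (feketePoly_monic n).leadingCoeff.symm)
    rw [degree_eq_natDegree hmonic.ne_zero, hdeg] at this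
    by_cases h0 : nodal univ ξ - feketePoly n = 0
    · simp [h0] at hlt
    · exact hlt ((natDegree_lt_iff_degree_lt h0).mpr this)
  · rw [derivative_sub, derivative_sub, mul_sub, hode, feketePoly_ode, mul_sub]

/-- The product of the distances over all ordered pairs of distinct indices. -/
noncomputable def pairDistProd {ι : Type*} [Fintype ι] [DecidableEq ι] (ξ : ι → ℝ) : ℝ :=
  ∏ i, ∏ j ∈ univ.erase i, |ξ i - ξ j|

section pairDistProd

variable {ι : Type*} [Fintype ι] [DecidableEq ι]

theorem pairDistProd_comp_perm (ξ : ι → ℝ) (σ : Equiv.Perm ι) :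
    pairDistProd (ξ ∘ σ) = pairDistProd ξ := by
  unfold pairDistProd
  rw [← Equiv.prod_comp σ fun i => ∏ j ∈ univ.erase i, |ξ i - ξ j|]
  refine prod_congr rfl fun i _ => ?_
  refine prod_nbij' σ σ.symm ?_ ?_ ?_ ?_ ?_ <;> simp +contextual [Equiv.symm_apply_eq]

theorem pairDistProd_nonneg (ξ : ι → ℝ) : 0 ≤ pairDistProd ξ :=
  prod_nonneg fun _ _ => prod_nonneg fun _ _ => abs_nonneg _

theorem pairDistProd_pos_iff {ξ : ι → ℝ} : 0 < pairDistProd ξ ↔ Function.Injective ξ := by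
  rw [(pairDistProd_nonneg ξ).lt_iff_ne', pairDistProd]
  simp only [ne_eq, prod_eq_zero_iff, mem_univ, true_and, mem_erase, and_true, abs_eq_zero,
    sub_eq_zero, not_exists, not_and]
  exact ⟨fun h i j hij => by_contra fun hne => h i j (Ne.symm hne) hij,
    fun h i j hne hij => hne (h hij).symm⟩

theorem pairDistProd_eq_mul (ξ : ι → ℝ) (i : ι) :
    pairDistProd ξ = ((nodal (univ.erase i) ξ).eval (ξ i)) ^ 2 *
      ∏ a ∈ univ.erase i, ∏ b ∈ (univ.erase a).erase i, |ξ a - ξ b| := by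
  have hcol : ∀ a ∈ univ.erase i, ∏ b ∈ univ.erase a, |ξ a - ξ b| =
      |ξ i - ξ a| * ∏ b ∈ (univ.erase a).erase i, |ξ a - ξ b| := fun a ha => by
    rw [← mul_prod_erase _ _ (mem_erase.mpr ⟨(ne_of_mem_erase ha).symm, mem_univ i⟩), abs_sub_comm]
  rw [pairDistProd, ← mul_prod_erase _ _ (mem_univ i), prod_congr rfl hcol, prod_mul_distrib,
    ← mul_assoc, ← sq, ← abs_prod, ← eval_nodal, sq_abs]

theorem pairDistProd_eq_prod_derivative (ξ : ι → ℝ) :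
    pairDistProd ξ = ∏ i, |(derivative (nodal univ ξ)).eval (ξ i)| := by
  refine prod_congr rfl fun i hi => ?_
  rw [eval_nodal_derivative_eval_node_eq hi, eval_nodal, abs_prod]

theorem pairDistProd_eq_sq [LinearOrder ι] (ξ : ι → ℝ) :
    pairDistProd ξ = (∏ p ∈ univ.filter (fun p : ι × ι => p.1 < p.2), (ξ p.2 - ξ p.1)) ^ 2 := by
  have hsum : pairDistProd ξ = ∏ p ∈ univ.filter (fun p : ι × ι => p.1 ≠ p.2), |ξ p.1 - ξ p.2| := by
    rw [prod_filter, ← univ_product_univ, prod_product]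
    refine prod_congr rfl fun i _ => ?_
    rw [← prod_filter]
    refine prod_congr ?_ fun _ _ => rfl
    ext j
    simp [eq_comm]
  have hsplit : univ.filter (fun p : ι × ι => p.1 ≠ p.2) =
      univ.filter (fun p : ι × ι => p.1 < p.2) ∪ univ.filter (fun p : ι × ι => p.2 < p.1) := by
    ext p
    simp [lt_or_lt_iff_ne]
  have hdisj : Disjoint (univ.filter (fun p : ι × ι => p.1 < p.2))
      (univ.filter (fun p : ι × ι => p.2 < p.1)) := by
    rw [disjoint_filter]
    exact fun p _ h => h.not_gt
  have hswap : ∏ p ∈ univ.filter (fun p : ι × ι => p.2 < p.1), |ξ p.1 - ξ p.2| =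
      ∏ p ∈ univ.filter (fun p : ι × ι => p.1 < p.2), |ξ p.2 - ξ p.1| := by
    refine prod_nbij' Prod.swap Prod.swap ?_ ?_ ?_ ?_ ?_ <;> simp
  rw [hsum, hsplit, prod_union hdisj, hswap, ← sq_abs (∏ p ∈ univ.filter (fun p : ι × ι => p.1 < p.2),
    (ξ p.2 - ξ p.1)), abs_prod, sq]
  simp only [abs_sub_comm]

theorem continuous_pairDistProd : Continuous (pairDistProd : (ι → ℝ) → ℝ) := by
  unfold pairDistProd
  fun_prop

theorem derivative_nodal_erase_eq_zero {ξ : ι → ℝ} {i : ι} (hinj : Function.Injective ξ)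
    (hmax : IsLocalMax (fun t => pairDistProd (Function.update ξ i t)) (ξ i)) :
    (derivative (nodal (univ.erase i) ξ)).eval (ξ i) = 0 := by
  set g := nodal (univ.erase i) ξ with hg
  set c := ∏ a ∈ univ.erase i, ∏ b ∈ (univ.erase a).erase i, |ξ a - ξ b| with hc
  have hval : ∀ t, pairDistProd (Function.update ξ i t) = g.eval t ^ 2 * c := fun t => by
    rw [pairDistProd_eq_mul _ i, hg, eval_nodal, eval_nodal, Function.update_self, hc]
    congr 1
    · exact congrArg (· ^ 2) <| prod_congr rfl fun j hj => by
        rw [Function.update_of_ne (ne_of_mem_erase hj)]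
    · refine prod_congr rfl fun a ha => prod_congr rfl fun b hb => ?_
      rw [Function.update_of_ne (ne_of_mem_erase ha), Function.update_of_ne (ne_of_mem_erase hb)]
  have hpos : 0 < g.eval (ξ i) ^ 2 * c := by
    rw [← hval, Function.update_eq_self]
    exact pairDistProd_pos_iff.mpr hinj
  simp only [hval] at hmax
  have h := hmax.hasDerivAt_eq_zero (((g.hasDerivAt (ξ i)).pow 2).mul_const c)
  have hc0 : c ≠ 0 := right_ne_zero_of_mul hpos.ne'
  have hg0 : g.eval (ξ i) ≠ 0 := fun h => by simp [h] at hpos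
  simpa [hc0, hg0] using h

theorem eval_derivative₂_nodal (ξ : ι → ℝ) (i : ι) :
    (derivative (derivative (nodal univ ξ))).eval (ξ i) =
      2 * (derivative (nodal (univ.erase i) ξ)).eval (ξ i) := by
  rw [nodal_eq_mul_nodal_erase (mem_univ i)]
  simp
  ring

theorem exists_isMaxOn_pairDistProd [Nonempty ι] :
    ∃ ξ : ι → ℝ, ξ ∈ Set.Icc 0 1 ∧ Function.Injective ξ ∧
      IsMaxOn pairDistProd (Set.Icc (0 : ι → ℝ) 1) ξ := by
  obtain ⟨ξ, hξ, hmax⟩ := (isCompact_Icc (a := (0 : ι → ℝ)) (b := 1)).exists_isMaxOn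
    (Set.nonempty_Icc.mpr zero_le_one) continuous_pairDistProd.continuousOn
  refine ⟨ξ, hξ, ?_, hmax⟩
  let e := Fintype.equivFin ι
  have hcard : (0 : ℝ) < Fintype.card ι := by exact_mod_cast Fintype.card_pos
  let ζ : ι → ℝ := fun i => (e i : ℕ) / (Fintype.card ι : ℝ)
  have hζinj : Function.Injective ζ := fun i j hij => by
    have := (div_left_inj' hcard.ne').mp hij
    exact e.injective (Fin.ext (by exact_mod_cast this))
  have hζ : ζ ∈ Set.Icc (0 : ι → ℝ) 1 :=
    ⟨fun i => by simp only [ζ, Pi.zero_apply]; positivity, fun i => by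
      simp only [ζ, Pi.one_apply]
      rw [div_le_one hcard]
      exact_mod_cast (e i).isLt.le⟩
  exact pairDistProd_pos_iff.mp ((pairDistProd_pos_iff.mpr hζinj).trans_le (hmax hζ))

theorem isLocalMax_update {ξ : ι → ℝ} (hξ : ξ ∈ Set.Icc 0 1)
    (hmax : IsMaxOn pairDistProd (Set.Icc (0 : ι → ℝ) 1) ξ) {i : ι} (h0 : ξ i ≠ 0) (h1 : ξ i ≠ 1) :
    IsLocalMax (fun t => pairDistProd (Function.update ξ i t)) (ξ i) := by
  have hi : ξ i ∈ Set.Ioo (0 : ℝ) 1 := ⟨(hξ.1 i).lt_of_ne' h0, (hξ.2 i).lt_of_ne h1⟩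
  filter_upwards [Ioo_mem_nhds hi.1 hi.2] with t ht
  rw [Function.update_eq_self]
  refine hmax ⟨?_, ?_⟩
  · exact le_update_iff.mpr ⟨ht.1.le, fun j _ => hξ.1 j⟩
  · exact update_le_iff.mpr ⟨ht.2.le, fun j _ => hξ.2 j⟩

end pairDistProd

theorem pairDistProd_of_nodal_eq_feketePoly {n : ℕ} {ξ : Fin (n + 2) → ℝ}
    (h : nodal univ ξ = feketePoly n) :
    pairDistProd ξ = (n + 2) ^ (n + 2) * ((n + 1) / (4 * (2 * n + 1)) : ℝ) ^ (n + 1) *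
      ∏ k ∈ range n, ((k + 1) ^ 2 / (4 * (2 * k + 1) * (2 * k + 3)) : ℝ) ^ (k + 1) := by
  have hres := resultant_prod_left univ (fun i => X - C (ξ i)) (monicLegendre (n + 1)) (n + 1)
    (by simp) (natDegree_monicLegendre _).le
  have hlin : ∀ i, resultant (X - C (ξ i)) (monicLegendre (n + 1)) (X - C (ξ i)).natDegree (n + 1) =
      (monicLegendre (n + 1)).eval (ξ i) := fun i => by
    rw [natDegree_X_sub_C, resultant_X_sub_C_left _ _ _ (natDegree_monicLegendre _).le]
  simp only [hlin] at hres
  rw [← nodal_eq, h, natDegree_feketePoly] at hres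
  rw [mul_assoc, ← abs_resultant_feketePoly, hres, pairDistProd_eq_prod_derivative, h,
    derivative_feketePoly]
  simp only [eval_mul, eval_C, abs_mul, prod_mul_distrib, abs_prod, prod_const, card_univ,
    Fintype.card_fin]
  rw [abs_of_pos (by positivity : (0 : ℝ) < n + 2)]

theorem prod_range_fekete_eq (n : ℕ) :
    ((n + 2) ^ (n + 2) * ((n + 1) / (4 * (2 * n + 1)) : ℝ) ^ (n + 1) *
        ∏ k ∈ range n, ((k + 1) ^ 2 / (4 * (2 * k + 1) * (2 * k + 3)) : ℝ) ^ (k + 1)) *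
        ∏ i ∈ range (n + 2), (n + 1 + i : ℝ) ^ (n + 1 + i) =
      ∏ i ∈ range (n + 2), ((i : ℝ) ^ (2 * i) * (i + 1 : ℝ) ^ (i + 1)) := by
  induction n with
  | zero => norm_num [prod_range_succ]
  | succ n ih =>
    have hshift : (∏ i ∈ range (n + 3), ((n + 1 : ℕ) + 1 + i : ℝ) ^ (n + 1 + 1 + i)) *
        (n + 1 : ℝ) ^ (n + 1) = (∏ i ∈ range (n + 2), (n + 1 + i : ℝ) ^ (n + 1 + i)) *
        (2 * n + 3 : ℝ) ^ (2 * n + 3) * (4 ^ (n + 2) * (n + 2 : ℝ) ^ (2 * n + 4)) := by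
      have h := prod_range_succ' (fun i : ℕ => (n + 1 + i : ℝ) ^ (n + 1 + i)) (n + 3)
      rw [prod_range_succ, prod_range_succ _ (n + 2)] at h
      have h4 : (n + 1 + (n + 3 : ℕ) : ℝ) ^ (n + 1 + (n + 3)) =
          4 ^ (n + 2) * (n + 2 : ℝ) ^ (2 * n + 4) := by
        rw [show n + 1 + (n + 3) = 2 * (n + 2) by ring, show 2 * n + 4 = 2 * (n + 2) by ring,
          pow_mul, pow_mul, ← mul_pow]
        push_cast
        ring
      have h3 : (n + 1 + (n + 2 : ℕ) : ℝ) ^ (n + 1 + (n + 2)) = (2 * n + 3 : ℝ) ^ (2 * n + 3) := by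
        rw [show n + 1 + (n + 2) = 2 * n + 3 by ring]
        push_cast
        ring
      rw [h4, h3] at h
      rw [h]
      simp only [Nat.cast_zero, add_zero]
      congr 1
      refine prod_congr rfl fun i _ => ?_
      rw [show n + 1 + 1 + i = n + 1 + (i + 1) by ring]
      push_cast
      ring
    have hn : (n + 1 : ℝ) ^ (n + 1) ≠ 0 := by positivity
    refine mul_right_cancel₀ hn ?_
    rw [mul_assoc, hshift, prod_range_succ _ (n + 2), ← ih, prod_range_succ _ n]
    generalize ∏ i ∈ range (n + 2), (n + 1 + i : ℝ) ^ (n + 1 + i) = D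
    generalize ∏ k ∈ range n, ((k + 1) ^ 2 / (4 * (2 * k + 1) * (2 * k + 3)) : ℝ) ^ (k + 1) = P
    push_cast
    rw [show (2 * (n + 1) + 1 : ℝ) = 2 * n + 3 by ring, show (n + 1 + 1 : ℝ) = n + 2 by ring,
      show (n + 1 + 2 : ℝ) = n + 3 by ring, show (n + 2 + 1 : ℝ) = n + 3 by ring]
    have k₁ : (2 * n + 1 : ℝ) ≠ 0 := by positivity
    have k₂ : (2 * n + 3 : ℝ) ≠ 0 := by positivity
    generalize (2 * n + 1 : ℝ) = u at *
    generalize (2 * n + 3 : ℝ) = v at *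
    generalize (n + 1 : ℝ) = a at *
    generalize (n + 2 : ℝ) = b at *
    generalize (n + 3 : ℝ) = c at *
    simp only [div_pow, mul_pow]
    field_simp
    ring

theorem letendreC_pow (n : ℕ) :
    letendreC (n + 2) ^ ((n + 2) * (n + 2 - 1) / 2) =
      √((n + 2) ^ (n + 2) * ((n + 1) / (4 * (2 * n + 1)) : ℝ) ^ (n + 1) *
        ∏ k ∈ range n, ((k + 1) ^ 2 / (4 * (2 * k + 1) * (2 * k + 3)) : ℝ) ^ (k + 1)) := by
  have hD : 0 < ∏ i ∈ range (n + 2), (n + 1 + i : ℝ) ^ (n + 1 + i) :=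
    prod_pos fun i _ => by positivity
  have hIcc : Icc 1 (n + 2) = Ico 1 (n + 2 + 1) := rfl
  have hterm : ∀ i : ℕ, (((1 + i : ℕ) : ℝ) - 1) ^ (2 * (1 + i - 1)) * ((1 + i : ℕ) : ℝ) ^ (1 + i) /
      (((n + 2 : ℕ) : ℝ) + (1 + i : ℕ) - 2) ^ (n + 2 + (1 + i) - 2) =
      ((i : ℝ) ^ (2 * i) * (i + 1 : ℝ) ^ (i + 1)) / (n + 1 + i : ℝ) ^ (n + 1 + i) := fun i => by
    rw [show n + 2 + (1 + i) - 2 = n + 1 + i by omega, show 1 + i - 1 = i by omega, add_comm 1 i]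
    push_cast
    congr 2 <;> ring
  rw [eq_div_of_mul_eq hD.ne' (prod_range_fekete_eq n), ← prod_div_distrib, letendreC, hIcc,
    prod_Ico_eq_prod_range, show n + 2 + 1 - 1 = n + 2 by omega]
  simp only [hterm]
  rw [Real.finsetProd_rpow _ _ fun i _ => by positivity, ← Real.rpow_natCast, ← Real.rpow_mul
    (prod_nonneg fun i _ => by positivity), Real.sqrt_eq_rpow]
  congr 1
  rw [Nat.cast_div (Nat.even_mul_pred_self (n + 2)).two_dvd two_ne_zero]
  push_cast [Nat.add_sub_cancel, show n + 2 - 1 = n + 1 by omega]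
  have k : (n + 2 - 1 : ℝ) ≠ 0 := by
    rw [show (n + 2 - 1 : ℝ) = n + 1 by ring]
    positivity
  field_simp
  ring

theorem max_vandermonde_product (s : ℕ) (hs : 2 ≤ s) :
    IsGreatest
      {y : ℝ | ∃ ξ : Fin s → ℝ, Monotone ξ ∧ (∀ i, 0 ≤ ξ i ∧ ξ i ≤ 1) ∧
        y = ∏ p ∈ Finset.univ.filter (fun p : Fin s × Fin s => p.1 < p.2),
              (ξ p.2 - ξ p.1)}
      (letendreC s ^ (s * (s - 1) / 2)) := by
  obtain ⟨n, rfl⟩ := Nat.exists_eq_add_of_le' hs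
  obtain ⟨ξ, hξ, hinj, hmax⟩ := exists_isMaxOn_pairDistProd (ι := Fin (n + 2))
  have hval := pairDistProd_of_nodal_eq_feketePoly (nodal_eq_feketePoly hinj fun i h0 h1 => by
    rw [eval_derivative₂_nodal,
      derivative_nodal_erase_eq_zero hinj (isLocalMax_update hξ hmax h0 h1), mul_zero])
  have hsqrt : ∀ ζ : Fin (n + 2) → ℝ, Monotone ζ →
      ∏ p ∈ univ.filter (fun p : Fin (n + 2) × Fin (n + 2) => p.1 < p.2), (ζ p.2 - ζ p.1) =
        √(pairDistProd ζ) := fun ζ hζ => by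
    rw [pairDistProd_eq_sq, Real.sqrt_sq]
    exact prod_nonneg fun p hp => sub_nonneg.mpr (hζ (mem_filter.mp hp).2.le)
  rw [letendreC_pow, ← hval]
  refine ⟨⟨ξ ∘ Tuple.sort ξ, Tuple.monotone_sort ξ, fun i => ⟨hξ.1 _, hξ.2 _⟩, ?_⟩, ?_⟩
  · rw [hsqrt _ (Tuple.monotone_sort ξ), pairDistProd_comp_perm]
  · rintro y ⟨ζ, hmono, hζ, rfl⟩
    rw [hsqrt ζ hmono]
    exact Real.sqrt_le_sqrt (hmax ⟨fun i => (hζ i).1, fun i => (hζ i).2⟩)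
end

section
/- Let P(x) = a_n x^n + ⋯ + a_0 ∈ ℤ[x] have degree n ≥ 2, let q ≥ 2 with gcd(a_n,…,a_0,q) = 1, and let I be an interval of real length at most q^{1/n}. Then the number of integers x ∈ I with P(x) ≡ 0 (mod q) is at most 2(n−1)²·ω(q), where ω(q) is the number of distinct prime divisors of q. -/
open Finset

/-- Every `(s + 1)`-element subset of `X` contains a point whose total weight to the subset
is at least `K`. -/
def HasHeavyStar {α : Type*} (w : α → α → ℝ) (s : ℕ) (K : ℝ) (X : Finset α) : Prop :=
  ∀ Z ⊆ X, #Z = s + 1 → ∃ x ∈ Z, K ≤ ∑ z ∈ Z, w x z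

theorem HasHeavyStar.mono {α : Type*} {w : α → α → ℝ} {s : ℕ} {K : ℝ} {X Y : Finset α}
    (h : HasHeavyStar w s K X) (hY : Y ⊆ X) : HasHeavyStar w s K Y :=
  fun Z hZ hc => h Z (hZ.trans hY) hc

section Weights

variable {α : Type*} [DecidableEq α] {w : α → α → ℝ}

theorem sum_sum_insert (hsymm : ∀ x y, w x y = w y x) (hdiag : ∀ x, w x x = 0)
    {E : Finset α} {x : α} (hx : x ∉ E) :
    ∑ a ∈ insert x E, ∑ b ∈ insert x E, w a b =
      ∑ a ∈ E, ∑ b ∈ E, w a b + 2 * ∑ b ∈ E, w x b := by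
  have h : ∑ a ∈ E, w a x = ∑ b ∈ E, w x b := sum_congr rfl fun a _ => hsymm a x
  simp only [sum_insert hx, sum_add_distrib, hdiag, h]
  ring

/-- A subset of given size of minimal total weight: any outside point is the heaviest star centre
once it is added to the subset. -/
theorem exists_minimal_subset (hsymm : ∀ x y, w x y = w y x) (hdiag : ∀ x, w x x = 0)
    {X : Finset α} {s : ℕ} (hs : s ≤ #X) :
    ∃ Y ⊆ X, #Y = s ∧ ∀ x ∈ X \ Y, ∀ y ∈ insert x Y,
      ∑ z ∈ insert x Y, w y z ≤ ∑ z ∈ Y, w x z := by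
  obtain ⟨Y, hY, hmin⟩ := exists_min_image (powersetCard s X)
    (fun Y => ∑ a ∈ Y, ∑ b ∈ Y, w a b) (powersetCard_nonempty.2 hs)
  rw [mem_powersetCard] at hY
  refine ⟨Y, hY.1, hY.2, fun x hx y hy => ?_⟩
  rw [mem_sdiff] at hx
  rw [sum_insert hx.2]
  rcases mem_insert.1 hy with rfl | hy
  · simp [hdiag]
  have hxE : x ∉ Y.erase y := fun h => hx.2 (mem_of_mem_erase h)
  have hcard : #(insert x (Y.erase y)) = s := by
    rw [card_insert_of_notMem hxE, card_erase_add_one hy, hY.2]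
  have h := hmin (insert x (Y.erase y)) (mem_powersetCard.2
    ⟨insert_subset hx.1 ((erase_subset _ _).trans hY.1), hcard⟩)
  have hYy := sum_sum_insert hsymm hdiag (notMem_erase y Y)
  rw [insert_erase hy] at hYy
  rw [hYy, sum_sum_insert hsymm hdiag hxE] at h
  rw [← add_sum_erase Y _ hy, ← add_sum_erase Y _ hy, hdiag, hsymm y x]
  linarith

theorem HasHeavyStar.le_sum_sum (hsymm : ∀ x y, w x y = w y x) (hdiag : ∀ x, w x x = 0)
    (hnonneg : ∀ x y, 0 ≤ w x y) {s : ℕ} (hs : 1 ≤ s) {K : ℝ} (hK : 0 ≤ K) {X : Finset α}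
    (h : HasHeavyStar w s K X) :
    K * #X * (#X - s) ≤ s * ∑ x ∈ X, ∑ y ∈ X, w x y := by
  induction X using Finset.strongInduction with
  | H X ih =>
  rcases le_or_gt (#X) s with hX | hX
  · have h1 : (#X : ℝ) - s ≤ 0 := sub_nonpos.2 (by exact_mod_cast hX)
    have h2 : 0 ≤ ∑ x ∈ X, ∑ y ∈ X, w x y := sum_nonneg fun x _ => sum_nonneg fun y _ => hnonneg x y
    have h3 : K * #X * (#X - s) ≤ 0 := mul_nonpos_of_nonneg_of_nonpos (by positivity) h1
    exact h3.trans (by positivity)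
  obtain ⟨Y, hYX, hYc, hY⟩ := exists_minimal_subset hsymm hdiag hX.le
  have hstar : ∀ x ∈ X \ Y, K ≤ ∑ y ∈ Y, w x y := fun x hx => by
    have hx' := mem_sdiff.1 hx
    obtain ⟨y, hy, hKy⟩ := h (insert x Y) (insert_subset hx'.1 hYX)
      (by rw [card_insert_of_notMem hx'.2, hYc])
    exact hKy.trans (hY x hx y hy)
  have hYne : Y.Nonempty := card_pos.1 (by omega)
  have hrec := ih (X \ Y) (sdiff_ssubset hYX hYne) (h.mono sdiff_subset)
  have hcard : (#(X \ Y) : ℝ) = #X - s := by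
    rw [card_sdiff_of_subset hYX, hYc, Nat.cast_sub hX.le]
  have hcross : (#X - s) * K ≤ ∑ x ∈ X \ Y, ∑ y ∈ Y, w x y := by
    rw [← hcard, ← nsmul_eq_mul]
    exact card_nsmul_le_sum _ _ _ hstar
  have hcomm : ∑ x ∈ Y, ∑ y ∈ X \ Y, w x y = ∑ x ∈ X \ Y, ∑ y ∈ Y, w x y := by
    rw [sum_comm]
    exact sum_congr rfl fun x _ => sum_congr rfl fun y _ => hsymm y x
  have hYY : 0 ≤ ∑ x ∈ Y, ∑ y ∈ Y, w x y := sum_nonneg fun x _ => sum_nonneg fun y _ => hnonneg x y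
  have hsplit : ∑ x ∈ X, ∑ y ∈ X, w x y = ∑ x ∈ X \ Y, ∑ y ∈ X \ Y, w x y +
      2 * ∑ x ∈ X \ Y, ∑ y ∈ Y, w x y + ∑ x ∈ Y, ∑ y ∈ Y, w x y := by
    simp only [← sum_sdiff hYX, sum_add_distrib, hcomm]
    ring
  rw [hcard] at hrec
  rw [hsplit]
  have hs0 : (0 : ℝ) ≤ s := by positivity
  nlinarith [mul_le_mul_of_nonneg_left hcross hs0, mul_nonneg hs0 hYY]

/-- If `X` splits into two parts with zero weight across, then one part, large in proportion,
has heavy stars of smaller size. -/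
theorem HasHeavyStar.exists_subset_of_split (hdiag : ∀ x, w x x = 0)
    (hnonneg : ∀ x y, 0 ≤ w x y) {n : ℕ} {K : ℝ} (hK : 0 < K) {C D : Finset α}
    (hC : C.Nonempty) (hD : D.Nonempty) (hCD : Disjoint C D)
    (hcross : ∀ x ∈ C, ∀ y ∈ D, w x y = 0 ∧ w y x = 0)
    (h : HasHeavyStar w n K (C ∪ D)) :
    ∃ s, 1 ≤ s ∧ s + 1 ≤ n ∧ ∃ E ⊆ C ∪ D, HasHeavyStar w s K E ∧ s * #(C ∪ D) ≤ n * #E := by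
  classical
  have key : ∀ A : Finset α, A.Nonempty → HasHeavyStar w n K A →
      ∃ s, 1 ≤ s ∧ HasHeavyStar w s K A ∧ ∃ Z ⊆ A, #Z = s ∧ ∀ x ∈ Z, ∑ z ∈ Z, w x z < K := by
    intro A hA hAn
    obtain ⟨s, hs, hmin⟩ : ∃ s, HasHeavyStar w s K A ∧ ∀ t < s, ¬ HasHeavyStar w t K A := by
      have hex : ∃ s, HasHeavyStar w s K A := ⟨n, hAn⟩
      exact ⟨Nat.find hex, Nat.find_spec hex, fun t ht => Nat.find_min hex ht⟩
    have hpos : 1 ≤ s := by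
      rw [Nat.one_le_iff_ne_zero]
      rintro rfl
      obtain ⟨a, ha⟩ := hA
      obtain ⟨x, hx, hKx⟩ := hs {a} (by simpa using ha) (by simp)
      rw [mem_singleton] at hx
      subst hx
      simp only [sum_singleton, hdiag] at hKx
      linarith
    have hnot := hmin (s - 1) (by omega)
    simp only [HasHeavyStar, not_forall, not_exists, not_and, not_le] at hnot
    obtain ⟨Z, hZ, hZc, hZK⟩ := hnot
    exact ⟨s, hpos, hs, Z, hZ, by omega, hZK⟩
  obtain ⟨s, hs, hsC, Z, hZ, hZc, hZK⟩ := key C hC (h.mono subset_union_left)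
  obtain ⟨t, ht, htD, W, hW, hWc, hWK⟩ := key D hD (h.mono subset_union_right)
  have hst : s + t ≤ n := by
    by_contra! hlt
    have hc : #(Z ∪ W) = s + t := by
      rw [card_union_of_disjoint (disjoint_of_subset_left hZ (disjoint_of_subset_right hW hCD)),
        hZc, hWc]
    obtain ⟨V, hV, hVc⟩ := exists_subset_card_eq (s := Z ∪ W) (n := n + 1) (by omega)
    obtain ⟨x, hx, hKx⟩ := h V (hV.trans (union_subset_union hZ hW)) hVc
    have hle : ∑ z ∈ V, w x z ≤ ∑ z ∈ Z, w x z + ∑ z ∈ W, w x z := by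
      rw [← sum_union (disjoint_of_subset_left hZ (disjoint_of_subset_right hW hCD))]
      exact sum_le_sum_of_subset_of_nonneg hV fun z _ _ => hnonneg x z
    rcases mem_union.1 (hV hx) with hxZ | hxW
    · have h0 : ∑ z ∈ W, w x z = 0 := sum_eq_zero fun z hz => (hcross x (hZ hxZ) z (hW hz)).1
      linarith [hZK x hxZ]
    · have h0 : ∑ z ∈ Z, w x z = 0 := sum_eq_zero fun z hz => (hcross z (hZ hz) x (hW hxW)).2
      linarith [hWK x hxW]
  have hcard : #(C ∪ D) = #C + #D := card_union_of_disjoint hCD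
  have hmul : (s + t) * #(C ∪ D) ≤ n * (#C + #D) := by
    rw [hcard]; exact Nat.mul_le_mul_right _ hst
  rcases le_or_gt (s * #(C ∪ D)) (n * #C) with h1 | h1
  · exact ⟨s, hs, by omega, C, subset_union_left, hsC, h1⟩
  · exact ⟨t, ht, by omega, D, subset_union_right, htD, by nlinarith⟩

/-- Given finitely many weights, each having heavy stars and splitting `X`, a large `X` contains
a pair whose total weight is more than `(∑ p ∈ S, K p) / n`. -/
theorem exists_pair_of_hasHeavyStar {ι : Type*} [DecidableEq ι] {S : Finset ι}
    {w : ι → α → α → ℝ} {K : ι → ℝ} {n : ℕ} {X : Finset α}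
    (hsymm : ∀ p x y, w p x y = w p y x) (hdiag : ∀ p x, w p x x = 0)
    (hnonneg : ∀ p x y, 0 ≤ w p x y)
    (hstar : ∀ p ∈ S, HasHeavyStar (w p) n (K p) X)
    (hsplit : ∀ p ∈ S, ∃ C D, C.Nonempty ∧ D.Nonempty ∧ Disjoint C D ∧ C ∪ D = X ∧
      ∀ x ∈ C, ∀ y ∈ D, w p x y = 0)
    (hpos : ∃ p ∈ S, 0 < K p) (hN : n * (n - 1) * #S < (#X : ℝ)) :
    ∃ x ∈ X, ∃ y ∈ X, x ≠ y ∧ ∑ p ∈ S, K p < n * ∑ p ∈ S, w p x y := by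
  obtain ⟨p₀, hp₀, hK₀⟩ := hpos
  obtain ⟨p, hp, hmax⟩ := exists_max_image S K ⟨p₀, hp₀⟩
  have hK : 0 < K p := hK₀.trans_le (hmax p₀ hp₀)
  obtain ⟨C, D, hC, hD, hCD, rfl, hcross⟩ := hsplit p hp
  obtain ⟨s, hs, hsn, E, hE, hEs, hEc⟩ := (hstar p hp).exists_subset_of_split (hdiag p)
    (hnonneg p) hK hC hD hCD fun x hx y hy => ⟨hcross x hx y hy, hsymm p y x ▸ hcross x hx y hy⟩
  set N : ℝ := (#(C ∪ D) : ℝ) with hNdef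
  set m : ℝ := (#E : ℝ) with hm
  have hs1 : (1 : ℝ) ≤ s := by exact_mod_cast hs
  have hsn1 : (s : ℝ) + 1 ≤ n := by exact_mod_cast hsn
  have hmN : s * N ≤ n * m := by rw [hNdef, hm]; exact_mod_cast hEc
  have hω : (1 : ℝ) ≤ #S := by exact_mod_cast card_pos.2 ⟨p, hp⟩
  have hNpos : 0 < N := lt_of_le_of_lt
    (mul_nonneg (mul_nonneg (by linarith) (by linarith)) (by linarith)) hN
  have hmpos : 0 < m := by
    have : 0 < n * m := lt_of_lt_of_le (by positivity) hmN
    exact pos_of_mul_pos_right this (by positivity)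
  have hm1 : 1 ≤ m := by
    rw [hm] at hmpos ⊢
    exact_mod_cast hmpos
  set T : ι → ℝ := fun i => ∑ x ∈ E, ∑ y ∈ E, w i x y with hT
  have hTnonneg : ∀ i, 0 ≤ T i := fun i => sum_nonneg fun x _ => sum_nonneg fun y _ =>
    hnonneg i x y
  have hall : ∀ i ∈ S, K i * (m * (m - 1)) - K p * (m * (n - 1)) ≤ n * T i := by
    intro i hi
    rcases le_or_gt (K i) 0 with hi0 | hi0
    · have h1 : K i * (m * (m - 1)) ≤ 0 :=
        mul_nonpos_of_nonpos_of_nonneg hi0 (mul_nonneg hmpos.le (by linarith))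
      have h2 : 0 ≤ K p * (m * (n - 1)) :=
        mul_nonneg hK.le (mul_nonneg hmpos.le (by linarith))
      have h3 : 0 ≤ n * T i := mul_nonneg (by linarith) (hTnonneg i)
      linarith
    · have h1 := ((hstar i hi).mono hE).le_sum_sum (hsymm i) (hdiag i) (hnonneg i)
        (by omega : 1 ≤ n) hi0.le
      have h2 : K i * (m * (n - 1)) ≤ K p * (m * (n - 1)) :=
        mul_le_mul_of_nonneg_right (hmax i hi) (mul_nonneg hmpos.le (by linarith))
      calc _ ≤ K i * m * (m - n) := by linarith
        _ ≤ _ := h1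
  have hbig : K p * (m * (m - 1)) + K p * m * ((n - 1) * (#S - 1)) < n * T p := by
    have h1 := hEs.le_sum_sum (hsymm p) (hdiag p) (hnonneg p) hs hK.le
    have h2 : s * ((n - 1) * #S) < m := by
      have : n * (s * ((n - 1) * #S)) < n * m := by nlinarith
      exact lt_of_mul_lt_mul_left this (by positivity)
    have h3 : s * (m - 1 + (n - 1) * (#S - 1)) < n * (m - s) := by nlinarith
    have h4 : 0 < K p * m := by positivity
    have h5 : s * (K p * (m * (m - 1)) + K p * m * ((n - 1) * (#S - 1))) < s * (n * T p) := by
      calc _ = K p * m * (s * (m - 1 + (n - 1) * (#S - 1))) := by ring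
        _ < K p * m * (n * (m - s)) := mul_lt_mul_of_pos_left h3 h4
        _ = n * (K p * m * (m - s)) := by ring
        _ ≤ n * (s * T p) := mul_le_mul_of_nonneg_left h1 (by positivity)
        _ = _ := by ring
    exact lt_of_mul_lt_mul_left h5 (by positivity)
  have hsum : m * (m - 1) * ∑ i ∈ S, K i < n * ∑ i ∈ S, T i := by
    have h1 := sum_le_sum fun i (hi : i ∈ S.erase p) => hall i (mem_of_mem_erase hi)
    rw [sum_sub_distrib, sum_const, card_erase_of_mem hp, nsmul_eq_mul,
      Nat.cast_sub (card_pos.2 ⟨p, hp⟩), ← sum_mul, ← mul_sum] at h1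
    rw [← add_sum_erase S K hp, ← add_sum_erase S T hp]
    push_cast at h1
    nlinarith
  by_contra! hcon
  have hle : n * ∑ i ∈ S, T i ≤ m * (m - 1) * ∑ i ∈ S, K i := by
    have hswap : n * ∑ i ∈ S, T i = ∑ x ∈ E, ∑ y ∈ E.erase x, n * ∑ i ∈ S, w i x y := by
      simp only [hT, ← mul_sum]
      rw [sum_comm]
      congr 1
      refine sum_congr rfl fun x hx => ?_
      rw [sum_comm, ← add_sum_erase E _ hx]
      simp [hdiag]
    have hrow : ∀ x ∈ E, ∑ y ∈ E.erase x, n * ∑ i ∈ S, w i x y ≤ (m - 1) * ∑ i ∈ S, K i := by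
      intro x hx
      have hc : ((#(E.erase x) : ℕ) : ℝ) = m - 1 := by
        rw [card_erase_of_mem hx, Nat.cast_sub (card_pos.2 ⟨x, hx⟩), Nat.cast_one]
      rw [← hc, ← nsmul_eq_mul]
      refine sum_le_card_nsmul _ _ _ fun y hy => ?_
      exact hcon x (hE hx) y (hE (mem_of_mem_erase hy)) (ne_of_mem_erase hy).symm
    rw [hswap, mul_assoc, hm, ← nsmul_eq_mul]
    exact sum_le_card_nsmul _ _ _ hrow
  exact absurd hsum (not_lt.2 hle)

end Weights

theorem degree_C_mul_le {R : Type*} [Semiring R] (a : R) (P : Polynomial R) :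
    (Polynomial.C a * P).degree ≤ P.degree := by
  rw [← Polynomial.smul_eq_C_mul]
  exact Polynomial.degree_smul_le a P

/-- Among `n + 1` roots modulo `p ^ k` of a degree-`n` polynomial not divisible by `p`, some root
has its product of differences to the others divisible by `p ^ k`. -/
theorem exists_pow_dvd_prod_sub {P : Polynomial ℤ} {p k : ℕ} (hp : p.Prime)
    (hP : ¬ (p : ℤ) ∣ P.content) {Z : Finset ℤ} (hZ : #Z = P.natDegree + 1)
    (hroot : ∀ x ∈ Z, (p : ℤ) ^ k ∣ P.eval x) :
    ∃ x ∈ Z, (p : ℤ) ^ k ∣ ∏ z ∈ Z.erase x, (x - z) := by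
  by_contra! hcon
  have hpZ : Prime (p : ℤ) := Nat.prime_iff_prime_int.1 hp
  have hfac : ∀ x ∈ Z, ∃ u c : ℤ, ¬ (p : ℤ) ∣ u ∧
      u * P.eval x = p * c * ∏ z ∈ Z.erase x, (x - z) := by
    intro x hx
    have hne : ∏ z ∈ Z.erase x, (x - z) ≠ 0 :=
      prod_ne_zero_iff.2 fun z hz => sub_ne_zero.2 (ne_of_mem_erase hz).symm
    have hfin : FiniteMultiplicity (p : ℤ) (∏ z ∈ Z.erase x, (x - z)) :=
      Int.finiteMultiplicity_iff.2 ⟨by simpa using hp.ne_one, hne⟩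
    obtain ⟨u, hu, hpu⟩ := hfin.exists_eq_pow_mul_and_not_dvd
    set e := multiplicity (p : ℤ) (∏ z ∈ Z.erase x, (x - z))
    have hek : e + 1 ≤ k := by
      by_contra! hlt
      exact hcon x hx (hu ▸ (pow_dvd_pow (p : ℤ) (by omega)).mul_right u)
    obtain ⟨c, hc⟩ := (pow_dvd_pow (p : ℤ) hek).trans (hroot x hx)
    exact ⟨u, c, hpu, by rw [hu, hc]; ring⟩
  choose! u c hu huc using hfac
  set Q : Polynomial ℤ := ∑ x ∈ Z, Polynomial.C ((∏ y ∈ Z.erase x, u y) * c x) *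
    ∏ z ∈ Z.erase x, (Polynomial.X - Polynomial.C z) with hQ
  have hQdeg : Q.degree < #Z := by
    refine (Polynomial.degree_sum_le _ _).trans_lt ((Finset.sup_lt_iff (WithBot.bot_lt_coe _)).2 ?_)
    intro x hx
    refine (degree_C_mul_le _ _).trans_lt ?_
    rw [Polynomial.degree_prod]
    simp only [Polynomial.degree_X_sub_C, sum_const, card_erase_of_mem hx, nsmul_eq_mul, mul_one]
    exact_mod_cast Nat.sub_lt (card_pos.2 ⟨x, hx⟩) one_pos
  have heq : Polynomial.C (∏ x ∈ Z, u x) * P = Polynomial.C (p : ℤ) * Q := by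
    refine Polynomial.eq_of_degrees_lt_of_eval_finset_eq Z ?_ ?_ ?_
    · refine (degree_C_mul_le _ _).trans_lt (Polynomial.degree_le_natDegree.trans_lt ?_)
      rw [hZ]
      exact_mod_cast Nat.lt_succ_self _
    · exact (degree_C_mul_le _ _).trans_lt hQdeg
    · intro x hx
      have hQx : Q.eval x = (∏ y ∈ Z.erase x, u y) * c x * ∏ z ∈ Z.erase x, (x - z) := by
        rw [hQ, Polynomial.eval_finsetSum, sum_eq_single_of_mem x hx]
        · simp [Polynomial.eval_prod]
        · intro y _ hyx
          rw [Polynomial.eval_mul, Polynomial.eval_prod]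
          exact mul_eq_zero_of_right _ (prod_eq_zero (mem_erase.2 ⟨hyx.symm, hx⟩) (by simp))
      rw [Polynomial.eval_mul, Polynomial.eval_mul, Polynomial.eval_C, Polynomial.eval_C, hQx,
        ← mul_prod_erase Z u hx]
      linear_combination (∏ y ∈ Z.erase x, u y) * huc x hx
  have hdvd : Polynomial.C (p : ℤ) ∣ Polynomial.C (∏ x ∈ Z, u x) * P := heq ▸ dvd_mul_right _ _
  rcases (Polynomial.prime_C_iff.2 hpZ).dvd_or_dvd hdvd with h | h
  · rw [Polynomial.C_dvd_iff_dvd_coeff] at h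
    have h0 := h 0
    rw [Polynomial.coeff_C_zero] at h0
    obtain ⟨x, hx, hpx⟩ := (hpZ.dvd_finsetProd_iff u).1 h0
    exact hu x hx hpx
  · exact hP (Polynomial.dvd_content_iff_C_dvd.2 h)

/-- The sum of the `p`-parts of `log m` over a finite set of `p` is at most `log m`. -/
theorem sum_factorization_mul_log_le (S : Finset ℕ) {m : ℕ} :
    ∑ p ∈ S, (m.factorization p : ℝ) * Real.log p ≤ Real.log m := by
  have hnn : ∀ p : ℕ, 0 ≤ (m.factorization p : ℝ) * Real.log p := fun p =>
    mul_nonneg (Nat.cast_nonneg _) (Real.log_natCast_nonneg p)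
  rw [Real.log_nat_eq_sum_factorization, Finsupp.sum,
    sum_subset (subset_union_right : m.factorization.support ⊆ S ∪ m.factorization.support)]
  · exact sum_le_sum_of_subset_of_nonneg subset_union_left fun p _ _ => hnn p
  · intro p _ hp
    simp [Finsupp.notMem_support_iff.1 hp]

/-- The smallest `p`-adic valuation of a difference of elements of `X` is the valuation of every
difference between the two parts of some partition of `X`. -/
theorem exists_factorization_split {p : ℕ} (hp : p.Prime) {X : Finset ℤ} (hX : 1 < #X) :
    ∃ d : ℕ, (∀ x ∈ X, ∀ y ∈ X, x ≠ y → d ≤ (x - y).natAbs.factorization p) ∧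
      ∃ C D : Finset ℤ, C.Nonempty ∧ D.Nonempty ∧ Disjoint C D ∧ C ∪ D = X ∧
        ∀ x ∈ C, ∀ y ∈ D, (x - y).natAbs.factorization p = d := by
  obtain ⟨a, ha, b, hb, hab⟩ := one_lt_card.1 hX
  obtain ⟨⟨x₀, y₀⟩, h₀, hmin⟩ := exists_min_image X.offDiag
    (fun z => (z.1 - z.2).natAbs.factorization p) ⟨(a, b), mem_offDiag.2 ⟨ha, hb, hab⟩⟩
  obtain ⟨hx₀, hy₀, hne₀⟩ := mem_offDiag.1 h₀
  set d := (x₀ - y₀).natAbs.factorization p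
  have hlow : ∀ x ∈ X, ∀ y ∈ X, x ≠ y → d ≤ (x - y).natAbs.factorization p :=
    fun x hx y hy hxy => hmin (x, y) (mem_offDiag.2 ⟨hx, hy, hxy⟩)
  have hdvd : ∀ z : ℤ, z ≠ 0 → ((p : ℤ) ^ (d + 1) ∣ z ↔ d + 1 ≤ z.natAbs.factorization p) := by
    intro z hz
    rw [← hp.pow_dvd_iff_le_factorization (Int.natAbs_ne_zero.2 hz), ← Int.natCast_dvd]
    push_cast
    rfl
  refine ⟨d, hlow, X.filter (fun x => (p : ℤ) ^ (d + 1) ∣ x₀ - x),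
    X.filter (fun x => ¬ (p : ℤ) ^ (d + 1) ∣ x₀ - x), ⟨x₀, by simp [hx₀]⟩, ⟨y₀, ?_⟩,
    disjoint_filter_filter_not _ _ _, filter_union_filter_not_eq _ _, ?_⟩
  · rw [mem_filter, hdvd _ (sub_ne_zero.2 hne₀)]
    exact ⟨hy₀, by simp [d]⟩
  · intro x hx y hy
    rw [mem_filter] at hx hy
    have hxy : x ≠ y := fun h => hy.2 (h ▸ hx.2)
    refine le_antisymm ?_ (hlow x hx.1 y hy.1 hxy)
    by_contra! hlt
    have h1 := (hdvd _ (sub_ne_zero.2 hxy)).2 hlt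
    exact hy.2 (by simpa using dvd_add hx.2 h1)

/-- A set of roots modulo `q` that is too large contains two elements at distance more than
`q ^ (1 / n)`, unless all its elements are at mutual distance at least `q ^ (1 / n)`. -/
theorem exists_lt_pow_or_forall_le_pow {P : Polynomial ℤ} {n q : ℕ} (hdeg : P.natDegree = n)
    (hq : q ≠ 0) (hcont : Int.gcd P.content q = 1) {X : Finset ℤ} (hX : 1 < #X)
    (hroot : ∀ x ∈ X, (q : ℤ) ∣ P.eval x)
    (hN : n * (n - 1) * #q.primeFactors < (#X : ℝ)) :
    (∃ x ∈ X, ∃ y ∈ X, q < (x - y).natAbs ^ n) ∨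
      ∀ x ∈ X, ∀ y ∈ X, x ≠ y → q ≤ (x - y).natAbs ^ n := by
  have hd : ∀ p : ℕ, ∃ d : ℕ, p.Prime →
      (∀ x ∈ X, ∀ y ∈ X, x ≠ y → d ≤ (x - y).natAbs.factorization p) ∧
      ∃ C D : Finset ℤ, C.Nonempty ∧ D.Nonempty ∧ Disjoint C D ∧ C ∪ D = X ∧
        ∀ x ∈ C, ∀ y ∈ D, (x - y).natAbs.factorization p = d := fun p => by
    by_cases hp : p.Prime
    · obtain ⟨d, h⟩ := exists_factorization_split hp hX
      exact ⟨d, fun _ => h⟩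
    · exact ⟨0, fun h => absurd h hp⟩
  choose d hd using hd
  set κ : ℕ → ℝ := fun p => q.factorization p * Real.log p
  set v : ℕ → ℤ → ℤ → ℝ := fun p x y => (x - y).natAbs.factorization p * Real.log p
  set K : ℕ → ℝ := fun p => (q.factorization p - n * d p) * Real.log p with hK
  set w : ℕ → ℤ → ℤ → ℝ := fun p x y =>
    if x = y then 0 else (((x - y).natAbs.factorization p - d p : ℕ) : ℝ) * Real.log p with hw
  have hlog : ∀ p : ℕ, 0 ≤ Real.log p := Real.log_natCast_nonneg
  have hκ : ∑ p ∈ q.primeFactors, κ p = Real.log q := by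
    rw [Real.log_nat_eq_sum_factorization, Finsupp.sum, Nat.support_factorization]
  have hv : ∀ x y, ∑ p ∈ q.primeFactors, v p x y ≤ Real.log (x - y).natAbs := fun x y =>
    sum_factorization_mul_log_le _
  have hwv : ∀ p, p.Prime → ∀ x ∈ X, ∀ y ∈ X, x ≠ y → w p x y = v p x y - d p * Real.log p := by
    intro p hp x hx y hy hxy
    simp only [hw, if_neg hxy, v]
    rw [Nat.cast_sub ((hd p hp).1 x hx y hy hxy)]
    ring
  by_cases hpos : ∃ p ∈ q.primeFactors, 0 < K p
  · left
    have hstar : ∀ p ∈ q.primeFactors, HasHeavyStar (w p) n (K p) X := by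
      intro p hp Z hZ hZc
      have hpp := Nat.prime_of_mem_primeFactors hp
      have hpc : ¬ (p : ℤ) ∣ P.content := fun h => by
        have h1 := Int.dvd_coe_gcd h (Int.natCast_dvd_natCast.2 (Nat.dvd_of_mem_primeFactors hp))
        rw [hcont] at h1
        exact hpp.ne_one (by exact_mod_cast Int.eq_one_of_dvd_one (by positivity) h1)
      obtain ⟨x, hx, hdvd⟩ := exists_pow_dvd_prod_sub (k := q.factorization p) hpp hpc
        (hdeg ▸ hZc) (fun x hx => (by exact_mod_cast Nat.ordProj_dvd q p :
          (p : ℤ) ^ q.factorization p ∣ q).trans (hroot x (hZ hx)))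
      refine ⟨x, hx, ?_⟩
      have hne : ∀ z ∈ Z.erase x, (x - z).natAbs ≠ 0 := fun z hz =>
        Int.natAbs_ne_zero.2 (sub_ne_zero.2 (ne_of_mem_erase hz).symm)
      have hle : q.factorization p ≤ ∑ z ∈ Z.erase x, (x - z).natAbs.factorization p := by
        rw [← Finsupp.finsetSum_apply, ← Nat.factorization_prod hne,
          ← hpp.pow_dvd_iff_le_factorization (prod_ne_zero_iff.2 hne)]
        have h1 := Int.natAbs_dvd_natAbs.2 hdvd
        rw [Int.natAbs_pow, Int.natAbs_natCast] at h1
        exact h1.trans (map_prod Int.natAbsHom _ _).dvd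
      have hcard : #(Z.erase x) = n := by rw [card_erase_of_mem hx, hZc]; rfl
      have hsum : ∑ z ∈ Z.erase x, w p x z =
          ∑ z ∈ Z.erase x, (v p x z - d p * Real.log p) := sum_congr rfl fun z hz =>
        hwv p hpp x (hZ hx) z (hZ (mem_of_mem_erase hz)) (ne_of_mem_erase hz).symm
      rw [← add_sum_erase Z _ hx, hsum, sum_sub_distrib, sum_const, hcard, nsmul_eq_mul,
        ← sum_mul]
      have hle' : (q.factorization p : ℝ) ≤
          ∑ z ∈ Z.erase x, ((x - z).natAbs.factorization p : ℝ) := by exact_mod_cast hle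
      have h2 := mul_le_mul_of_nonneg_right hle' (hlog p)
      simp only [hw, hK, if_true]
      linarith
    obtain ⟨x, hx, y, hy, hxy, hlt⟩ := exists_pair_of_hasHeavyStar (w := w) (K := K) (n := n)
      (fun p x y => by
        simp only [hw, eq_comm (a := x), ← Int.natAbs_neg (x - y), neg_sub]) (fun p x => by simp [hw])
      (fun p x y => by
        simp only [hw]
        split_ifs
        · exact le_rfl
        · exact mul_nonneg (Nat.cast_nonneg _) (hlog p))
      hstar
      (fun p hp => by
        obtain ⟨C, D, hC, hD, hCD, hU, h⟩ := (hd p (Nat.prime_of_mem_primeFactors hp)).2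
        exact ⟨C, D, hC, hD, hCD, hU, fun x hx y hy => by simp [hw, h x hx y hy]⟩)
      hpos hN
    refine ⟨x, hx, y, hy, ?_⟩
    have hsum : ∑ p ∈ q.primeFactors, w p x y =
        ∑ p ∈ q.primeFactors, v p x y - ∑ p ∈ q.primeFactors, d p * Real.log p := by
      rw [← sum_sub_distrib]
      exact sum_congr rfl fun p hp => hwv p (Nat.prime_of_mem_primeFactors hp) x hx y hy hxy
    have hKsum : ∑ p ∈ q.primeFactors, K p =
        Real.log q - n * ∑ p ∈ q.primeFactors, d p * Real.log p := by
      rw [← hκ, mul_sum, ← sum_sub_distrib]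
      exact sum_congr rfl fun p _ => by simp only [hK, κ]; ring
    have hz : 0 < (x - y).natAbs := Int.natAbs_pos.2 (sub_ne_zero.2 hxy)
    have h1 : Real.log q < n * Real.log (x - y).natAbs := by
      have := mul_le_mul_of_nonneg_left (hv x y) (Nat.cast_nonneg (α := ℝ) n)
      rw [hsum, hKsum] at hlt
      linarith
    rw [← Real.log_pow] at h1
    exact_mod_cast (Real.log_lt_log_iff (by positivity) (by positivity)).1 h1
  · right
    push Not at hpos
    intro x hx y hy hxy
    have hz : 0 < (x - y).natAbs := Int.natAbs_pos.2 (sub_ne_zero.2 hxy)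
    have h1 : Real.log q ≤ n * Real.log (x - y).natAbs := by
      rw [← hκ]
      refine le_trans ?_ (mul_le_mul_of_nonneg_left (hv x y) (Nat.cast_nonneg (α := ℝ) n))
      rw [mul_sum]
      refine sum_le_sum fun p hp => ?_
      have h2 := hpos p hp
      have h3 : (d p : ℝ) ≤ (x - y).natAbs.factorization p := by
        exact_mod_cast (hd p (Nat.prime_of_mem_primeFactors hp)).1 x hx y hy hxy
      have h4 := mul_le_mul_of_nonneg_left (mul_le_mul_of_nonneg_right h3 (hlog p))
        (Nat.cast_nonneg (α := ℝ) n)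
      simp only [hK, κ, v] at *
      linarith
    rw [← Real.log_pow] at h1
    exact_mod_cast (Real.log_le_log_iff (by positivity) (by positivity)).1 h1

theorem roots_in_short_interval (P : Polynomial ℤ) (n : ℕ) (hn : 2 ≤ n)
    (hdeg : P.natDegree = n) (q : ℕ) (hq : 2 ≤ q)
    (hcont : Int.gcd P.content q = 1)
    (a b : ℝ) (hI : b - a ≤ (q : ℝ) ^ ((1 : ℝ) / n)) :
    ((Finset.Icc ⌈a⌉ ⌊b⌋).filter (fun x => (q : ℤ) ∣ P.eval x)).card ≤
      2 * (n - 1) ^ 2 * q.primeFactors.card := by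
  by_contra! hlt
  set X := (Finset.Icc ⌈a⌉ ⌊b⌋).filter (fun x => (q : ℤ) ∣ P.eval x) with hX
  have hω : 1 ≤ #q.primeFactors := card_pos.2 (Nat.nonempty_primeFactors.2 (by omega))
  obtain ⟨r, rfl⟩ : ∃ r, n = r + 2 := ⟨n - 2, by omega⟩
  have hcard : 2 < #X := by
    refine lt_of_le_of_lt ?_ hlt
    have : 1 ≤ (r + 2 - 1) ^ 2 := Nat.one_le_pow _ _ (by omega)
    nlinarith
  have hN : ((r + 2 : ℕ) : ℝ) * ((r + 2 : ℕ) - 1) * #q.primeFactors < (#X : ℝ) := by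
    have h1 : (r + 2) * (r + 1) * #q.primeFactors < #X := by
      refine lt_of_le_of_lt (Nat.mul_le_mul_right _ ?_) hlt
      simp only [Nat.add_succ_sub_one]
      nlinarith
    have h2 : ((r + 2) * (r + 1) * #q.primeFactors : ℝ) < #X := by exact_mod_cast h1
    push_cast
    linarith
  have hpow : ∀ x ∈ X, ∀ y ∈ X, (x - y).natAbs ^ (r + 2) ≤ q := by
    intro x hx y hy
    simp only [hX, mem_filter, mem_Icc, Int.ceil_le, Int.le_floor] at hx hy
    have h1 : ((x - y).natAbs : ℝ) ≤ (q : ℝ) ^ ((1 : ℝ) / (r + 2 : ℕ)) := by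
      rw [Nat.cast_natAbs, Int.cast_abs, Int.cast_sub]
      exact (abs_le.2 ⟨by linarith, by linarith⟩).trans hI
    have h2 := pow_le_pow_left₀ (Nat.cast_nonneg _) h1 (r + 2)
    rw [one_div, Real.rpow_inv_natCast_pow (Nat.cast_nonneg _) (by omega)] at h2
    exact_mod_cast h2
  rcases exists_lt_pow_or_forall_le_pow hdeg (by omega) hcont (one_lt_two.trans hcard)
    (fun x hx => (mem_filter.1 hx).2) hN with ⟨x, hx, y, hy, h⟩ | h
  · exact absurd h (not_lt.2 (hpow x hx y hy))
  · obtain ⟨x, y, z, hx, hy, hz, hxy, hxz, hyz⟩ := two_lt_card_iff.1 hcard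
    have heq : ∀ s ∈ X, ∀ t ∈ X, s ≠ t → (s - t).natAbs ^ (r + 2) = q := fun s hs t ht hst =>
      le_antisymm (hpow s hs t ht) (h s hs t ht hst)
    have h1 := Nat.pow_left_injective (by omega : r + 2 ≠ 0)
      ((heq x hx y hy hxy).trans (heq x hx z hz hxz).symm)
    have h2 := Nat.pow_left_injective (by omega : r + 2 ≠ 0)
      ((heq x hx y hy hxy).trans (heq y hy z hz hyz).symm)
    omega
end

section
/- Let P(x) = a_n x^n + ⋯ + a_0 ∈ ℤ[x] have degree n ≥ 2, let q ≥ 2 with gcd(a_n,…,a_0,q) = 1, and let I be an interval of length L > 0. Then the number of integers x ∈ I with P(x) ≡ 0 (mod q) is at most 2(n−1)²·ω(q)·(L/q^{1/n} + 1). -/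
/-- The length, capped at `m`, of the longest common prefix of the sequences
`c j x, c (j + 1) x, …` and `c j y, c (j + 1) y, …`. -/
def prefixAgreement {α β : Type*} [DecidableEq β] (c : ℕ → α → β) : ℕ → ℕ → α → α → ℕ
  | _, 0, _, _ => 0
  | j, m + 1, x, y => if c j x = c j y then prefixAgreement c (j + 1) m x y + 1 else 0

/-- Every point of `T` has total affinity less than `t` to the other points of `T`. -/
def IsSparse {α : Type*} [DecidableEq α] (D : α → α → ℕ) (t : ℝ) (T : Finset α) : Prop :=
  ∀ x ∈ T, ∑ y ∈ T.erase x, (D x y : ℝ) < t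

theorem IsSparse.mono {α : Type*} [DecidableEq α] {D : α → α → ℕ} {t : ℝ} {T T' : Finset α}
    (h : IsSparse D t T) (hT : T' ⊆ T) : IsSparse D t T' := fun x hx =>
  lt_of_le_of_lt (Finset.sum_le_sum_of_subset_of_nonneg (Finset.erase_subset_erase x hT)
    fun _ _ _ => Nat.cast_nonneg _) (h x (hT hx))

theorem exists_maximal_isSparse {α : Type*} [DecidableEq α] (D : α → α → ℕ) {t : ℝ} (ht : 0 < t)
    {S : Finset α} (hS : S.Nonempty) :
    ∃ T ⊆ S, 1 ≤ T.card ∧ IsSparse D t T ∧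
      ∀ T' ⊆ S, IsSparse D t T' → T'.card ≤ T.card := by
  classical
  obtain ⟨x, hx⟩ := hS
  have hsing : {x} ∈ S.powerset.filter (IsSparse D t) := by
    simp [IsSparse, hx, ht]
  obtain ⟨T, hT, hmax⟩ := Finset.exists_max_image _ Finset.card ⟨_, hsing⟩
  simp only [Finset.mem_filter, Finset.mem_powerset] at hT hmax
  exact ⟨T, hT.1, by simpa using hmax {x} (by simpa using hsing), hT.2,
    fun T' h h' => hmax T' ⟨h, h'⟩⟩

/-- If sparse subsets of `S` have at most `n` elements, then at most `n` linear conditions on a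
weight `f` force the mutual energy of its positive and negative parts to be large. -/
theorem exists_conditions_energy_ge {α β : Type*} [DecidableEq α] [DecidableEq β]
    (c : ℕ → α → β) (m : ℕ) : ∀ (j n : ℕ) (t : ℝ) (S : Finset α), 1 ≤ n →
    (∀ T ⊆ S, IsSparse (prefixAgreement c j m) t T → T.card ≤ n) →
    ∃ F : Finset (Finset α), F.card ≤ n ∧ ∀ f : α → ℝ, (∀ A ∈ F, ∑ x ∈ A, f x = 0) →
      ∑ x ∈ S, f x = 0 ∧
      t / n * (∑ x ∈ S, (f x)⁺) ^ 2 ≤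
        ∑ x ∈ S, ∑ y ∈ S, (f x)⁺ * (f y)⁻ * prefixAgreement c j m x y := by
  have hpos : ∀ (f : α → ℝ) (S : Finset α) (D : α → α → ℕ),
      0 ≤ ∑ x ∈ S, ∑ y ∈ S, (f x)⁺ * (f y)⁻ * D x y := fun f S D =>
    Finset.sum_nonneg fun x _ => Finset.sum_nonneg fun y _ =>
      mul_nonneg (mul_nonneg (posPart_nonneg _) (negPart_nonneg _)) (Nat.cast_nonneg _)
  have htriv : ∀ (j m n : ℕ) (t : ℝ) (S : Finset α), 1 ≤ n → t ≤ 0 →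
      ∃ F : Finset (Finset α), F.card ≤ n ∧ ∀ f : α → ℝ, (∀ A ∈ F, ∑ x ∈ A, f x = 0) →
      ∑ x ∈ S, f x = 0 ∧
      t / n * (∑ x ∈ S, (f x)⁺) ^ 2 ≤
        ∑ x ∈ S, ∑ y ∈ S, (f x)⁺ * (f y)⁻ * prefixAgreement c j m x y := by
    intro j m n t S hn ht
    refine ⟨{S}, by simpa using hn, fun f hf => ⟨hf S (by simp), (?_ : _ ≤ (0 : ℝ)).trans
      (hpos f S _)⟩⟩
    exact mul_nonpos_of_nonpos_of_nonneg
      (div_nonpos_of_nonpos_of_nonneg ht (Nat.cast_nonneg _)) (sq_nonneg _)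
  induction m with
  | zero =>
    intro j n t S hn hS
    rcases le_or_gt t 0 with ht | ht
    · exact htriv j 0 n t S hn ht
    refine ⟨S.image singleton, Finset.card_image_le.trans (hS S le_rfl ?_), fun f hf => ?_⟩
    · intro x _
      simpa [prefixAgreement] using ht
    have hf0 : ∀ x ∈ S, f x = 0 := fun x hx => by
      simpa using hf {x} (Finset.mem_image_of_mem _ hx)
    refine ⟨Finset.sum_eq_zero hf0, ?_⟩
    rw [Finset.sum_eq_zero fun x hx => by simp [hf0 x hx]]
    simpa using hpos f S _
  | succ m ih =>
    intro j n t S hn hS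
    rcases le_or_gt t 0 with ht | ht
    · exact htriv j (m + 1) n t S hn ht
    set D := prefixAgreement c j (m + 1) with hD
    set D' := prefixAgreement c (j + 1) m with hD'
    have hDeq : ∀ x y, c j x = c j y → D x y = D' x y + 1 := fun x y h => by
      simp [hD, hD', prefixAgreement, h]
    have hDne : ∀ x y, c j x ≠ c j y → D x y = 0 := fun x y h => by
      simp [hD, prefixAgreement, h]
    set B := S.image (c j) with hB
    set piece : β → Finset α := fun s => S.filter fun x => c j x = s with hpiece
    have hmaps : ∀ x ∈ S, c j x ∈ B := fun x hx => Finset.mem_image_of_mem _ hx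
    have hne : ∀ s ∈ B, (piece s).Nonempty := fun s hs => by
      obtain ⟨x, hx, rfl⟩ := Finset.mem_image.1 hs
      exact ⟨x, by simp [hpiece, hx]⟩
    choose! T hTS hTcard hTsp hTmax using fun s hs => exists_maximal_isSparse D ht (hne s hs)
    have hTc : ∀ s ∈ B, ∀ x ∈ T s, c j x = s := fun s hs x hx =>
      (Finset.mem_filter.1 (hTS s hs hx)).2
    have hcard : ∑ s ∈ B, (T s).card ≤ n := by
      rw [← Finset.card_biUnion]
      · refine hS _ (Finset.biUnion_subset.2 fun s hs =>
          (hTS s hs).trans (Finset.filter_subset _ _)) fun x hx => ?_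
        obtain ⟨s, hs, hxs⟩ := Finset.mem_biUnion.1 hx
        refine lt_of_eq_of_lt (Eq.symm ?_) (hTsp s hs x hxs)
        refine Finset.sum_subset (Finset.erase_subset_erase _
          (Finset.subset_biUnion_of_mem T hs)) fun y hy hy' => ?_
        simp only [Finset.mem_erase, Finset.mem_biUnion] at hy hy'
        obtain ⟨hyx, s', hs', hys'⟩ := hy
        rw [hDne, Nat.cast_zero]
        intro h
        rw [hTc s hs x hxs, hTc s' hs' y hys'] at h
        exact hy' ⟨hyx, h ▸ hys'⟩
      · intro s hs s' hs' hss
        refine Finset.disjoint_left.2 fun x hx hx' => hss ?_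
        rw [← hTc s hs x hx, hTc s' hs' x hx']
    have hrec : ∀ s ∈ B, ∀ U ⊆ piece s, IsSparse D' (t - (T s).card) U →
        U.card ≤ (T s).card := by
      intro s hs U hU hsp
      by_contra! hlt
      obtain ⟨V, hVU, hV⟩ := Finset.exists_subset_card_eq (Nat.succ_le_of_lt hlt)
      have := hTmax s hs V (hVU.trans hU) fun x hx => by
        have h1 := hsp.mono hVU x hx
        have h2 : ∑ y ∈ V.erase x, (D x y : ℝ) = ∑ y ∈ V.erase x, ((D' x y : ℝ) + 1) := by
          refine Finset.sum_congr rfl fun y hy => ?_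
          rw [hDeq x y, Nat.cast_add, Nat.cast_one]
          rw [(Finset.mem_filter.1 (hU (hVU hx))).2,
            (Finset.mem_filter.1 (hU (hVU (Finset.mem_of_mem_erase hy)))).2]
        rw [h2, Finset.sum_add_distrib, Finset.sum_const, Finset.card_erase_of_mem hx, hV]
        simp only [Nat.succ_eq_add_one, Nat.add_sub_cancel, nsmul_eq_mul, mul_one]
        linarith
      omega
    choose! F hFcard hF using fun s hs =>
      ih (j + 1) (T s).card (t - (T s).card) (piece s) (hTcard s hs) (hrec s hs)
    refine ⟨B.biUnion F, Finset.card_biUnion_le.trans ((Finset.sum_le_sum hFcard).trans hcard),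
      fun f hf => ?_⟩
    have hF' := fun s hs => hF s hs f fun A hA => hf A (Finset.mem_biUnion.2 ⟨s, hs, hA⟩)
    have hsplit : ∀ g : α → ℝ, ∑ s ∈ B, ∑ x ∈ piece s, g x = ∑ x ∈ S, g x := fun g =>
      Finset.sum_fiberwise_of_maps_to hmaps g
    refine ⟨by rw [← hsplit]; exact Finset.sum_eq_zero fun s hs => (hF' s hs).1, ?_⟩
    have hpieces : ∀ s ∈ B, t * ((∑ x ∈ piece s, (f x)⁺) ^ 2 / (T s).card) ≤
        ∑ x ∈ piece s, ∑ y ∈ S, (f x)⁺ * (f y)⁻ * D x y := by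
      intro s hs
      obtain ⟨h0, h1⟩ := hF' s hs
      have hneg : ∑ x ∈ piece s, (f x)⁻ = ∑ x ∈ piece s, (f x)⁺ := by
        rw [eq_comm, ← sub_eq_zero, ← Finset.sum_sub_distrib]
        simpa only [posPart_sub_negPart] using h0
      have hT0 : ((T s).card : ℝ) ≠ 0 := by
        have := hTcard s hs
        positivity
      calc t * ((∑ x ∈ piece s, (f x)⁺) ^ 2 / (T s).card)
          = (t - (T s).card) / (T s).card * (∑ x ∈ piece s, (f x)⁺) ^ 2 +
            (∑ x ∈ piece s, (f x)⁺) * ∑ y ∈ piece s, (f y)⁻ := by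
            rw [hneg]; field_simp; ring
        _ ≤ (∑ x ∈ piece s, ∑ y ∈ piece s, (f x)⁺ * (f y)⁻ * D' x y) +
            (∑ x ∈ piece s, (f x)⁺) * ∑ y ∈ piece s, (f y)⁻ := by gcongr
        _ = ∑ x ∈ piece s, ∑ y ∈ piece s, (f x)⁺ * (f y)⁻ * D x y := by
            rw [Finset.sum_mul_sum, ← Finset.sum_add_distrib]
            refine Finset.sum_congr rfl fun x hx => ?_
            rw [← Finset.sum_add_distrib]
            refine Finset.sum_congr rfl fun y hy => ?_
            rw [hDeq x y ((Finset.mem_filter.1 hx).2.trans (Finset.mem_filter.1 hy).2.symm)]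
            push_cast
            ring
        _ ≤ _ := Finset.sum_le_sum fun x _ => Finset.sum_le_sum_of_subset_of_nonneg
            (Finset.filter_subset _ _) fun y _ _ =>
              mul_nonneg (mul_nonneg (posPart_nonneg _) (negPart_nonneg _)) (Nat.cast_nonneg _)
    rw [← hsplit (fun x => ∑ y ∈ S, (f x)⁺ * (f y)⁻ * D x y)]
    refine le_trans ?_ (Finset.sum_le_sum hpieces)
    rw [← Finset.mul_sum, div_mul_eq_mul_div, mul_div_assoc, ← hsplit (fun x => (f x)⁺)]
    refine mul_le_mul_of_nonneg_left ?_ ht.le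
    refine le_trans ?_ (Finset.sq_sum_div_le_sum_sq_div B _ fun s hs =>
      Nat.cast_pos.2 (hTcard s hs))
    rcases B.eq_empty_or_nonempty with hB0 | ⟨s, hs⟩
    · simp [hB0]
    · refine div_le_div_of_nonneg_left (sq_nonneg _) ?_ (mod_cast hcard)
      exact Finset.sum_pos (fun s hs => Nat.cast_pos.2 (hTcard s hs)) ⟨s, hs⟩

theorem pow_prefixAgreement_dvd (p m : ℕ) : ∀ (j : ℕ) (x y : ℤ), (p : ℤ) ^ j ∣ x - y →
    (p : ℤ) ^ (j + prefixAgreement (fun i (z : ℤ) => z % (p : ℤ) ^ (i + 1)) j m x y) ∣ x - y := by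
  induction m with
  | zero => intro j x y h; simpa [prefixAgreement] using h
  | succ m ih =>
    intro j x y h
    rw [prefixAgreement]
    split_ifs with hc
    · rw [← add_assoc, add_right_comm]
      exact ih (j + 1) x y (Int.ModEq.dvd (Eq.symm hc))
    · simpa using h

theorem not_pow_succ_prefixAgreement_dvd (p m : ℕ) : ∀ (j : ℕ) (x y : ℤ),
    prefixAgreement (fun i (z : ℤ) => z % (p : ℤ) ^ (i + 1)) j m x y < m →
    ¬ (p : ℤ) ^ (j + prefixAgreement (fun i (z : ℤ) => z % (p : ℤ) ^ (i + 1)) j m x y + 1) ∣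
      x - y := by
  induction m with
  | zero => intro j x y h; simp at h
  | succ m ih =>
    intro j x y h
    rw [prefixAgreement] at h ⊢
    split_ifs at h ⊢ with hc
    · rw [← add_assoc, add_right_comm j]
      exact ih (j + 1) x y (by omega)
    · exact fun hd => hc (Int.modEq_iff_dvd.2 hd).symm

/-- Lagrange interpolation at roots modulo `p ^ k` that are `p`-adically far apart. -/
theorem dvd_content_of_dvd_eval (P : Polynomial ℤ) (p k : ℕ) [Fact p.Prime] (T : Finset ℤ)
    (hT : P.natDegree < T.card) (hroot : ∀ x ∈ T, (p : ℤ) ^ k ∣ P.eval x)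
    (hfar : ∀ x ∈ T, ¬ (p : ℤ) ^ k ∣ ∏ y ∈ T.erase x, (x - y)) : (p : ℤ) ∣ P.content := by
  rw [Polynomial.dvd_content_iff_C_dvd, Polynomial.C_dvd_iff_dvd_coeff]
  intro i
  set Q : Polynomial ℚ_[p] := P.map (Int.castRingHom ℚ_[p]) with hQ
  have hinj : Set.InjOn (fun x : ℤ => (x : ℚ_[p])) T := Int.cast_injective.injOn
  have hQdeg : Q.degree < T.card :=
    lt_of_le_of_lt (Polynomial.degree_map_le.trans Polynomial.degree_le_natDegree)
      (by exact_mod_cast hT)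
  have hbasis : ∀ x ∈ T, Lagrange.basis T (fun x : ℤ => (x : ℚ_[p])) x =
      Polynomial.C ((∏ y ∈ T.erase x, (x - y) : ℤ) : ℚ_[p])⁻¹ *
        (∏ y ∈ T.erase x, (Polynomial.X - Polynomial.C y)).map (Int.castRingHom ℚ_[p]) := by
    intro x _
    simp only [Lagrange.basis, Lagrange.basisDivisor, Finset.prod_mul_distrib,
      Polynomial.map_prod, ← map_prod, Finset.prod_inv_distrib]
    simp
  have hcoeff : ((P.coeff i : ℤ) : ℚ_[p]) = ∑ x ∈ T, ((P.eval x : ℤ) : ℚ_[p]) *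
      (((∏ y ∈ T.erase x, (x - y) : ℤ) : ℚ_[p])⁻¹ *
        ((∏ y ∈ T.erase x, (Polynomial.X - Polynomial.C y)).coeff i : ℤ)) := by
    have h := congrArg (fun R => Polynomial.coeff R i) (Lagrange.eq_interpolate hinj hQdeg)
    simp only [Lagrange.interpolate_apply, Polynomial.finsetSum_coeff, Polynomial.coeff_C_mul]
      at h
    rw [hQ, Polynomial.coeff_map, eq_intCast] at h
    rw [h]
    refine Finset.sum_congr rfl fun x hx => ?_
    rw [hbasis x hx, Polynomial.coeff_C_mul, Polynomial.coeff_map, eq_intCast,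
      Polynomial.eval_intCast_map, eq_intCast, Int.cast_id]
  have hlt : ‖((P.coeff i : ℤ) : ℚ_[p])‖ < 1 := by
    rw [hcoeff]
    obtain ⟨x, hx, hle⟩ := IsUltrametricDist.exists_norm_finsetSum_le T
      fun x : ℤ => ((P.eval x : ℤ) : ℚ_[p]) * (((∏ y ∈ T.erase x, (x - y) : ℤ) : ℚ_[p])⁻¹ *
        ((∏ y ∈ T.erase x, (Polynomial.X - Polynomial.C y)).coeff i : ℤ))
    have hxT : x ∈ T := hx (Finset.card_pos.1 (by omega))
    refine hle.trans_lt ?_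
    have h1 := (Padic.norm_int_le_pow_iff_dvd _ _).2 (hroot x hxT)
    have h2 := mt (Padic.norm_int_le_pow_iff_dvd _ _).1 (hfar x hxT)
    rw [not_le] at h2
    have hW := lt_of_le_of_lt (norm_nonneg _) (h1.trans_lt h2)
    rw [← mul_assoc, norm_mul, norm_mul, norm_inv]
    refine lt_of_le_of_lt (mul_le_of_le_one_right (by positivity) (Padic.norm_int_le_one _)) ?_
    rw [← div_eq_mul_inv, div_lt_one hW]
    exact h1.trans_lt h2
  exact Padic.norm_intCast_lt_one_iff.1 hlt

/-- A finite set of roots modulo `p ^ k` that is sparse has at most `deg P` elements. -/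
theorem card_le_of_isSparse_of_dvd_eval (P : Polynomial ℤ) (p k : ℕ) (hp : p.Prime)
    (hcont : ¬ (p : ℤ) ∣ P.content) (T : Finset ℤ) (hroot : ∀ x ∈ T, (p : ℤ) ^ k ∣ P.eval x)
    (hT : IsSparse (prefixAgreement (fun i (z : ℤ) => z % (p : ℤ) ^ (i + 1)) 0 k) k T) :
    T.card ≤ P.natDegree := by
  have : Fact p.Prime := ⟨hp⟩
  by_contra! hlt
  refine hcont (dvd_content_of_dvd_eval P p k T hlt hroot fun x hx hdvd => ?_)
  set D := prefixAgreement (fun i (z : ℤ) => z % (p : ℤ) ^ (i + 1)) 0 k with hD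
  have hsum : ∑ y ∈ T.erase x, D x y < k := by exact_mod_cast hT x hx
  have hnd : ∀ y ∈ T.erase x, ¬ (p : ℤ) ^ (D x y + 1) ∣ x - y := fun y hy => by
    have hlt := (Finset.single_le_sum (fun _ _ => Nat.zero_le _) hy).trans_lt hsum
    simpa using not_pow_succ_prefixAgreement_dvd p k 0 x y hlt
  have hfin : ∀ y ∈ T.erase x, emultiplicity (p : ℤ) (x - y) ≤ D x y := fun y hy =>
    Order.le_of_lt_add_one (by exact_mod_cast emultiplicity_lt_iff_not_dvd.2 (hnd y hy))
  have h1 := le_emultiplicity_of_pow_dvd hdvd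
  rw [Finset.emultiplicity_prod (Nat.prime_iff_prime_int.1 hp)] at h1
  have h2 := h1.trans (Finset.sum_le_sum hfin)
  rw [← Nat.cast_sum, Nat.cast_le] at h2
  omega

theorem exists_ne_zero_sum_eq_zero {α : Type*} [DecidableEq α] (S : Finset α)
    (F : Finset (Finset α)) (h : F.card < S.card) :
    ∃ f : α → ℝ, (∃ x ∈ S, f x ≠ 0) ∧ ∀ A ∈ F, ∑ x ∈ A, f x = 0 := by
  let ext : (S → ℝ) → α → ℝ := fun g x => if hx : x ∈ S then g ⟨x, hx⟩ else 0
  let φ : (S → ℝ) →ₗ[ℝ] (F → ℝ) :=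
    { toFun := fun g A => ∑ x ∈ A.1, ext g x
      map_add' := fun g g' => by
        ext A
        simp only [ext, Pi.add_apply, ← Finset.sum_add_distrib]
        refine Finset.sum_congr rfl fun x _ => ?_
        split_ifs <;> simp
      map_smul' := fun r g => by
        ext A
        simp only [ext, Pi.smul_apply, smul_eq_mul, RingHom.id_apply, Finset.mul_sum]
        refine Finset.sum_congr rfl fun x _ => ?_
        split_ifs <;> simp }
  have hker : φ.ker ≠ ⊥ := LinearMap.ker_ne_bot_of_finrank_lt (by simpa using h)
  obtain ⟨g, hg, hg0⟩ := (Submodule.ne_bot_iff _).1 hker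
  obtain ⟨x, hx⟩ := Function.ne_iff.1 hg0
  exact ⟨ext g, ⟨x, x.2, by simpa [ext] using hx⟩,
    fun A hA => congrFun (LinearMap.mem_ker.1 hg) ⟨A, hA⟩⟩

theorem sum_mul_log_le_log_abs {s : Finset ℕ} (hs : ∀ p ∈ s, p.Prime) (e : ℕ → ℕ) {z : ℤ}
    (hz : z ≠ 0) (hdvd : ∀ p ∈ s, (p : ℤ) ^ e p ∣ z) :
    ∑ p ∈ s, (e p : ℝ) * Real.log p ≤ Real.log |(z : ℝ)| := by
  have hprod : ∏ p ∈ s, (p : ℤ) ^ e p ∣ z := Finset.prod_dvd_of_coprime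
    (fun p hp r hr hpr => (Nat.isCoprime_iff_coprime.2
      ((Nat.coprime_primes (hs p hp) (hs r hr)).2 hpr)).pow) hdvd
  have hle : ((∏ p ∈ s, (p : ℤ) ^ e p : ℤ) : ℝ) ≤ |(z : ℝ)| := by
    exact_mod_cast Int.le_of_dvd (abs_pos.2 hz) ((dvd_abs _ _).2 hprod)
  have hne : ∀ p ∈ s, (p : ℝ) ^ e p ≠ 0 := fun p hp =>
    pow_ne_zero _ (Nat.cast_ne_zero.2 (hs p hp).ne_zero)
  push_cast at hle
  calc ∑ p ∈ s, (e p : ℝ) * Real.log p = Real.log (∏ p ∈ s, (p : ℝ) ^ e p) := by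
        rw [Real.log_prod hne]
        simp
    _ ≤ _ := Real.log_le_log (Finset.prod_pos fun p hp =>
        pow_pos (Nat.cast_pos.2 (hs p hp).pos) _) hle

/-- Roots modulo `q` at mutual distances less than `q ^ (1 / n)` number at most `n * ω(q)`. -/
theorem card_roots_le_of_close (P : Polynomial ℤ) (hn : 1 ≤ P.natDegree) (q : ℕ) (hq : 2 ≤ q)
    (hcont : Int.gcd P.content q = 1) (S : Finset ℤ) (hroot : ∀ x ∈ S, (q : ℤ) ∣ P.eval x)
    (hclose : ∀ x ∈ S, ∀ y ∈ S, x ≠ y →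
      Real.log |((x - y : ℤ) : ℝ)| < Real.log q / P.natDegree) :
    S.card ≤ P.natDegree * q.primeFactors.card := by
  set n := P.natDegree with hndef
  by_contra! hlt
  let D : ℕ → ℤ → ℤ → ℕ := fun p =>
    prefixAgreement (fun i (z : ℤ) => z % (p : ℤ) ^ (i + 1)) 0 (q.factorization p)
  have hprime : ∀ p ∈ q.primeFactors, p.Prime := fun p => Nat.prime_of_mem_primeFactors
  have hfam : ∀ p ∈ q.primeFactors, ∃ F : Finset (Finset ℤ), F.card ≤ n ∧ ∀ f : ℤ → ℝ,
      (∀ A ∈ F, ∑ x ∈ A, f x = 0) → ∑ x ∈ S, f x = 0 ∧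
      (q.factorization p : ℝ) / n * (∑ x ∈ S, (f x)⁺) ^ 2 ≤
        ∑ x ∈ S, ∑ y ∈ S, (f x)⁺ * (f y)⁻ * D p x y := by
    intro p hp
    refine exists_conditions_energy_ge _ _ 0 n _ S hn fun T hTS hT =>
      card_le_of_isSparse_of_dvd_eval P p _ (hprime p hp) (fun hpc => ?_) T
        (fun x hx => dvd_trans ?_ (hroot x (hTS hx))) hT
    · have := Int.dvd_coe_gcd hpc (Int.natCast_dvd_natCast.2 (Nat.dvd_of_mem_primeFactors hp))
      rw [hcont] at this
      exact (hprime p hp).one_lt.ne' (by exact_mod_cast Int.eq_one_of_dvd_one (by positivity) this)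
    · exact_mod_cast Nat.ordProj_dvd q p
  choose! F hFcard hF using hfam
  have hcard : (q.primeFactors.biUnion F).card < S.card := by
    refine lt_of_le_of_lt (Finset.card_biUnion_le.trans (Finset.sum_le_sum hFcard)) ?_
    simpa [mul_comm] using hlt
  obtain ⟨f, ⟨x₀, hx₀, hfx₀⟩, hf⟩ := exists_ne_zero_sum_eq_zero S _ hcard
  have hF' := fun p hp => hF p hp f fun A hA => hf A (Finset.mem_biUnion.2 ⟨p, hp, hA⟩)
  obtain ⟨p₀, hp₀⟩ := Nat.nonempty_primeFactors.2 (show 1 < q by omega)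
  have hneg : ∑ x ∈ S, (f x)⁻ = ∑ x ∈ S, (f x)⁺ := by
    rw [eq_comm, ← sub_eq_zero, ← Finset.sum_sub_distrib]
    simpa only [posPart_sub_negPart] using (hF' p₀ hp₀).1
  set M := ∑ x ∈ S, (f x)⁺ with hM
  have hdisj : ∀ x, (f x)⁺ * (f x)⁻ = 0 := fun x => by
    rcases le_total 0 (f x) with h | h <;> simp [h]
  have hgap : ∀ x ∈ S, ∀ y ∈ S, x ≠ y →
      0 < Real.log q / n - ∑ p ∈ q.primeFactors, (D p x y : ℝ) * Real.log p := by
    intro x hx y hy hxy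
    have h := sum_mul_log_le_log_abs hprime (fun p => D p x y) (sub_ne_zero.2 hxy) fun p _ => by
      simpa using pow_prefixAgreement_dvd p (q.factorization p) 0 x y (by simp)
    linarith [hclose x hx y hy hxy]
  have hterm : ∀ x ∈ S, ∀ y ∈ S, 0 ≤ (f x)⁺ * (f y)⁻ *
      (Real.log q / n - ∑ p ∈ q.primeFactors, (D p x y : ℝ) * Real.log p) := by
    intro x hx y hy
    rcases eq_or_ne x y with rfl | hxy
    · simp [hdisj]
    · exact mul_nonneg (mul_nonneg (posPart_nonneg _) (negPart_nonneg _)) (hgap x hx y hy hxy).le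
  have hmass : ∑ x ∈ S, ∑ y ∈ S, (f x)⁺ * (f y)⁻ = M ^ 2 := by
    rw [← Finset.sum_mul_sum, hneg, sq]
  have hlogq : Real.log q / n * M ^ 2 =
      ∑ p ∈ q.primeFactors, (q.factorization p : ℝ) / n * M ^ 2 * Real.log p := by
    rw [Real.log_nat_eq_sum_factorization, Finsupp.sum, Nat.support_factorization,
      Finset.sum_div, Finset.sum_mul]
    exact Finset.sum_congr rfl fun p _ => by ring
  have henergy : ∑ x ∈ S, ∑ y ∈ S, (f x)⁺ * (f y)⁻ *
      (Real.log q / n - ∑ p ∈ q.primeFactors, (D p x y : ℝ) * Real.log p) ≤ 0 := by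
    calc _ = Real.log q / n * M ^ 2 - ∑ p ∈ q.primeFactors,
          (∑ x ∈ S, ∑ y ∈ S, (f x)⁺ * (f y)⁻ * D p x y) * Real.log p := by
          simp only [← hmass, mul_sub, Finset.sum_sub_distrib, Finset.mul_sum, Finset.sum_mul]
          congr 1
          · exact Finset.sum_congr rfl fun x _ => Finset.sum_congr rfl fun y _ => mul_comm _ _
          · rw [Finset.sum_comm (s := q.primeFactors)]
            refine Finset.sum_congr rfl fun x _ => ?_
            rw [Finset.sum_comm (s := q.primeFactors)]
            simp only [mul_assoc]
      _ ≤ 0 := by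
          rw [hlogq, sub_nonpos]
          exact Finset.sum_le_sum fun p hp => mul_le_mul_of_nonneg_right (hF' p hp).2
            (Real.log_natCast_nonneg p)
  have hzero : ∀ x ∈ S, ∀ y ∈ S, (f x)⁺ * (f y)⁻ = 0 := by
    have h0 := le_antisymm henergy
      (Finset.sum_nonneg fun x hx => Finset.sum_nonneg fun y hy => hterm x hx y hy)
    rw [Finset.sum_eq_zero_iff_of_nonneg
      fun x hx => Finset.sum_nonneg fun y hy => hterm x hx y hy] at h0
    intro x hx y hy
    rcases eq_or_ne x y with rfl | hxy
    · exact hdisj x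
    · exact (mul_eq_zero.1 ((Finset.sum_eq_zero_iff_of_nonneg fun y hy => hterm x hx y hy).1
        (h0 x hx) y hy)).resolve_right (hgap x hx y hy hxy).ne'
  have hM0 : M = 0 := by
    rw [← sq_eq_zero_iff, ← hmass]
    exact Finset.sum_eq_zero fun x hx => Finset.sum_eq_zero fun y hy => hzero x hx y hy
  have hpos0 := (Finset.sum_eq_zero_iff_of_nonneg fun x _ => posPart_nonneg (f x)).1
    (hM.symm.trans hM0) x₀ hx₀
  have hneg0 := (Finset.sum_eq_zero_iff_of_nonneg fun x _ => negPart_nonneg (f x)).1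
    (hneg.trans hM0) x₀ hx₀
  exact hfx₀ (by rw [← posPart_sub_negPart (f x₀), hpos0, hneg0, sub_zero])

theorem roots_in_interval (P : Polynomial ℤ) (n : ℕ) (hn : 2 ≤ n)
    (hdeg : P.natDegree = n) (q : ℕ) (hq : 2 ≤ q)
    (hcont : Int.gcd P.content q = 1)
    (a b L : ℝ) (hL : 0 < L) (hI : b - a = L) :
    (((Finset.Icc ⌈a⌉ ⌊b⌋).filter (fun x => (q : ℤ) ∣ P.eval x)).card : ℝ) ≤
      2 * (n - 1) ^ 2 * q.primeFactors.card * (L / (q : ℝ) ^ ((1 : ℝ) / n) + 1) := by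
  set S := (Finset.Icc ⌈a⌉ ⌊b⌋).filter (fun x => (q : ℤ) ∣ P.eval x) with hS
  set ℓ : ℝ := (q : ℝ) ^ ((1 : ℝ) / n) with hℓ
  have hq0 : (0 : ℝ) < q := by positivity
  have hℓ0 : 0 < ℓ := Real.rpow_pos_of_pos hq0 _
  have hmaps : ∀ x ∈ S, ⌊((x : ℝ) - a) / ℓ⌋₊ ∈ Finset.range (⌊L / ℓ⌋₊ + 1) := by
    intro x hx
    have hxb : (x : ℝ) ≤ b := Int.le_floor.1 (Finset.mem_Icc.1 (Finset.mem_filter.1 hx).1).2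
    rw [Finset.mem_range, Nat.lt_succ_iff]
    gcongr
    linarith
  have hfiber : ∀ i ∈ Finset.range (⌊L / ℓ⌋₊ + 1),
      (S.filter fun x : ℤ => ⌊((x : ℝ) - a) / ℓ⌋₊ = i).card ≤ n * q.primeFactors.card := by
    intro i _
    rw [← hdeg]
    refine card_roots_le_of_close P (by omega) q hq hcont _
      (fun x hx => (Finset.mem_filter.1 (Finset.mem_filter.1 hx).1).2) fun x hx y hy hxy => ?_
    have hcell : ∀ z ∈ S.filter fun x : ℤ => ⌊((x : ℝ) - a) / ℓ⌋₊ = i,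
        i * ℓ ≤ (z : ℝ) - a ∧ (z : ℝ) - a < (i + 1) * ℓ := by
      intro z hz
      obtain ⟨hzS, hzi⟩ := Finset.mem_filter.1 hz
      have hza : a ≤ z := Int.ceil_le.1 (Finset.mem_Icc.1 (Finset.mem_filter.1 hzS).1).1
      rwa [Nat.floor_eq_iff (div_nonneg (sub_nonneg.2 hza) hℓ0.le), le_div_iff₀ hℓ0,
        div_lt_iff₀ hℓ0] at hzi
    obtain ⟨hx1, hx2⟩ := hcell x hx
    obtain ⟨hy1, hy2⟩ := hcell y hy
    have hlog : Real.log q / P.natDegree = Real.log ℓ := by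
      rw [hℓ, Real.log_rpow hq0, hdeg]
      ring
    rw [hlog]
    refine Real.log_lt_log (abs_pos.2 (Int.cast_ne_zero.2 (sub_ne_zero.2 hxy))) ?_
    rw [Int.cast_sub, abs_lt]
    constructor <;> linarith
  have hcard := Finset.card_le_mul_card_image_of_maps_to hmaps _ hfiber
  rw [Finset.card_range] at hcard
  have hn' : (2 : ℝ) ≤ n := mod_cast hn
  calc (S.card : ℝ) ≤ (n * q.primeFactors.card : ℝ) * (⌊L / ℓ⌋₊ + 1) := mod_cast hcard
    _ ≤ _ := by
      gcongr
      · nlinarith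
      · exact Nat.floor_le (by positivity)
end

section
/- Let n ≥ 2, d ∈ ℤ, q ≥ 2, and let I be an interval of real length at most q^{1/n}. Then the number of integers x ∈ I with x^n + d ≡ 0 (mod q) is at most n·ω(q), where ω(q) is the number of distinct prime divisors of q. -/
/-- For an odd prime `p` and a unit `x₀`, the solutions of `x ^ n ≡ x₀ ^ n` modulo `p ^ α` lie in
at most `n` residue classes modulo `p ^ α`. -/
lemma exists_classes_odd {p : ℕ} (hp : p.Prime) (hp2 : p ≠ 2) (n : ℕ) (hn : 2 ≤ n) (α : ℕ)
    (x₀ : ℤ) (hx₀ : ¬ (p : ℤ) ∣ x₀) :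
    ∃ c : ℤ → Fin n, ∀ x y : ℤ, (p : ℤ) ^ α ∣ x ^ n - x₀ ^ n → (p : ℤ) ^ α ∣ y ^ n - x₀ ^ n →
      c x = c y → (p : ℤ) ^ α ∣ x - y := by
  classical
  have : NeZero (p ^ α) := ⟨pow_ne_zero _ hp.ne_zero⟩
  have hcyc : IsCyclic (ZMod (p ^ α))ˣ := ZMod.isCyclic_units_of_prime_pow p hp hp2 α
  set T : Finset (ZMod (p ^ α))ˣ := Finset.univ.filter (fun u => u ^ n = 1) with hT
  have hcard : T.card ≤ n := IsCyclic.card_pow_eq_one_le (by omega)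
  have hu : IsUnit ((x₀ : ℤ) : ZMod (p ^ α)) := by
    rw [ZMod.coe_int_isUnit_iff_isCoprime]
    push_cast
    exact ((Nat.prime_iff_prime_int.mp hp).coprime_iff_not_dvd.mpr hx₀).pow_left
  obtain ⟨u, hu⟩ := hu
  have key : ∀ x : ℤ, (p : ℤ) ^ α ∣ x ^ n - x₀ ^ n → ∃ t ∈ T, (x : ZMod (p ^ α)) = u * t := by
    intro x hx
    have h : ((x : ZMod (p ^ α))) ^ n = (u : ZMod (p ^ α)) ^ n := by
      have := (ZMod.intCast_zmod_eq_zero_iff_dvd (x ^ n - x₀ ^ n) (p ^ α)).mpr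
        (by exact_mod_cast hx)
      push_cast at this
      rw [hu]
      exact sub_eq_zero.mp this
    have hxu : IsUnit (x : ZMod (p ^ α)) := by
      rw [← isUnit_pow_iff (n := n) (by omega), h]
      exact u.isUnit.pow n
    obtain ⟨v, hv⟩ := hxu
    refine ⟨u⁻¹ * v, ?_, by simp [hv]⟩
    have : v ^ n = u ^ n := by
      ext
      push_cast
      rw [hv, h]
    simp [hT, mul_pow, this]
  refine ⟨fun x => if h : ∃ t ∈ T, (x : ZMod (p ^ α)) = u * t then
    Fin.castLE hcard (T.equivFin ⟨h.choose, h.choose_spec.1⟩) else ⟨0, by omega⟩, ?_⟩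
  intro x y hx hy hxy
  have h1 := key x hx
  have h2 := key y hy
  beta_reduce at hxy
  rw [dif_pos h1, dif_pos h2] at hxy
  have h3 : h1.choose = h2.choose := by
    simpa using hxy
  have h4 : (x : ZMod (p ^ α)) = y := by
    rw [h1.choose_spec.2, h2.choose_spec.2, h3]
  have := (ZMod.intCast_eq_intCast_iff_dvd_sub y x (p ^ α)).mp h4.symm
  exact_mod_cast this

/-- Odd integers congruent modulo four whose `n`-th powers are 2-adically close are themselves
2-adically close. -/
lemma two_pow_dvd_sub_of_four_dvd {n α : ℕ} (hn : n ≠ 0) {x y : ℤ} (hx : ¬ (2 : ℤ) ∣ x)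
    (h4 : (4 : ℤ) ∣ x - y) (h : (2 : ℤ) ^ α ∣ x ^ n - y ^ n) :
    (2 : ℤ) ^ (α - n.factorization 2) ∣ x - y := by
  have hlte := Int.two_pow_sub_pow' n h4 hx
  rw [pow_dvd_iff_le_emultiplicity] at h ⊢
  rw [hlte] at h
  have hn' : emultiplicity (2 : ℤ) (n : ℤ) = n.factorization 2 := by
    rw [show (2 : ℤ) = ((2 : ℕ) : ℤ) by rfl, Int.natCast_emultiplicity]
    rw [(Nat.finiteMultiplicity_iff.mpr
        ⟨by norm_num, Nat.pos_of_ne_zero hn⟩).emultiplicity_eq_multiplicity,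
      Nat.multiplicity_eq_factorization Nat.prime_two hn]
  rw [hn'] at h
  push_cast
  exact tsub_le_iff_right.mpr h

/-- The case `p = 2` of `exists_classes` for odd `x₀`; the classes are those modulo four. -/
lemma exists_classes_two (n : ℕ) (hn : 2 ≤ n) (α : ℕ) (hα : α ≠ 0)
    (x₀ : ℤ) (hx₀ : ¬ (2 : ℤ) ∣ x₀) :
    ∃ A B : ℕ, B ≤ A ∧ α ≤ A + (n - 1) * B ∧ ∃ c : ℤ → Fin n, ∀ x y : ℤ,
      (2 : ℤ) ^ α ∣ x ^ n - x₀ ^ n → (2 : ℤ) ^ α ∣ y ^ n - x₀ ^ n →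
      (2 : ℤ) ^ B ∣ x - y ∧ (c x = c y → (2 : ℤ) ^ A ∣ x - y) := by
  have hs : n.factorization 2 < n := Nat.factorization_lt 2 (by omega)
  refine ⟨max (α - n.factorization 2) 1, 1, le_max_right _ _, by omega,
    fun x => if x % 4 = 1 then ⟨0, by omega⟩ else ⟨1, by omega⟩, ?_⟩
  have hodd : ∀ x : ℤ, (2 : ℤ) ^ α ∣ x ^ n - x₀ ^ n → ¬ (2 : ℤ) ∣ x := by
    intro x hx h2
    have h3 : (2 : ℤ) ∣ x ^ n - x₀ ^ n := (dvd_pow_self 2 hα).trans hx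
    have h4 : (2 : ℤ) ∣ x₀ ^ n := (dvd_sub_right (dvd_pow h2 (by omega))).mp h3
    exact hx₀ (Int.prime_two.dvd_of_dvd_pow h4)
  intro x y hx hy
  have hxo := hodd x hx
  have hyo := hodd y hy
  have hpar : (2 : ℤ) ∣ x - y := by omega
  refine ⟨by simpa using hpar, fun hc => ?_⟩
  have h4 : (4 : ℤ) ∣ x - y := by
    by_cases h1 : x % 4 = 1 <;> by_cases h2 : y % 4 = 1 <;> simp [h1, h2] at hc <;> omega
  rcases max_cases (α - n.factorization 2) 1 with ⟨h, -⟩ | ⟨h, -⟩ <;> rw [h]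
  · refine two_pow_dvd_sub_of_four_dvd (by omega) hxo h4 ?_
    have := dvd_sub hx hy
    rwa [sub_sub_sub_cancel_right] at this
  · simpa using hpar

/-- The solutions of `x ^ n ≡ x₀ ^ n` modulo `p ^ α` split into `n` classes such that differences
are divisible by `p ^ A` within a class and by `p ^ B` in general, where `A + (n - 1) * B ≥ α`. -/
lemma exists_classes {p : ℕ} (hp : p.Prime) (n : ℕ) (hn : 2 ≤ n) (α : ℕ) (x₀ : ℤ) :
    ∃ A B : ℕ, B ≤ A ∧ α ≤ A + (n - 1) * B ∧ ∃ c : ℤ → Fin n, ∀ x y : ℤ,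
      (p : ℤ) ^ α ∣ x ^ n - x₀ ^ n → (p : ℤ) ^ α ∣ y ^ n - x₀ ^ n →
      (p : ℤ) ^ B ∣ x - y ∧ (c x = c y → (p : ℤ) ^ A ∣ x - y) := by
  induction α using Nat.strong_induction_on generalizing x₀ with
  | _ α ih =>
  have hpZ : Prime (p : ℤ) := Nat.prime_iff_prime_int.mp hp
  rcases Nat.eq_zero_or_pos α with rfl | hα
  · exact ⟨0, 0, le_rfl, by simp, fun _ => ⟨0, by omega⟩, by simp⟩
  by_cases hx₀ : (p : ℤ) ∣ x₀
  · have hdvd : ∀ x : ℤ, (p : ℤ) ^ α ∣ x ^ n - x₀ ^ n → (p : ℤ) ∣ x := by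
      intro x hx
      have h3 : (p : ℤ) ∣ x ^ n - x₀ ^ n := (dvd_pow_self _ hα.ne').trans hx
      exact hpZ.dvd_of_dvd_pow ((dvd_sub_left (dvd_pow hx₀ (by omega))).mp h3)
    rcases le_or_gt α n with hαn | hαn
    · refine ⟨1, 1, le_rfl, by omega, fun _ => ⟨0, by omega⟩, fun x y hx hy => ?_⟩
      have := dvd_sub (hdvd x hx) (hdvd y hy)
      simpa using this
    · obtain ⟨z₀, rfl⟩ := hx₀
      obtain ⟨A, B, hAB, hle, c, hc⟩ := ih (α - n) (by omega) z₀
      have hred : ∀ z : ℤ, (p : ℤ) ^ α ∣ (p * z) ^ n - (p * z₀) ^ n →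
          (p : ℤ) ^ (α - n) ∣ z ^ n - z₀ ^ n := by
        intro z hz
        rw [mul_pow, mul_pow, ← mul_sub, ← Nat.add_sub_cancel' hαn.le, pow_add] at hz
        exact (mul_dvd_mul_iff_left (pow_ne_zero n hpZ.ne_zero)).mp (by simpa using hz)
      refine ⟨A + 1, B + 1, by omega, by rw [mul_add]; omega, fun x => c (x / p), ?_⟩
      intro x y hx hy
      obtain ⟨z, rfl⟩ := hdvd x hx
      obtain ⟨w, rfl⟩ := hdvd y hy
      have := hc z w (hred z hx) (hred w hy)
      simp only [Int.mul_ediv_cancel_left _ hpZ.ne_zero]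
      rw [pow_succ', pow_succ', ← mul_sub]
      exact ⟨mul_dvd_mul_left _ this.1, fun h => mul_dvd_mul_left _ (this.2 h)⟩
  · rcases eq_or_ne p 2 with rfl | hp2
    · exact exists_classes_two n hn α hα.ne' x₀ hx₀
    · obtain ⟨c, hc⟩ := exists_classes_odd hp hp2 n hn α x₀ hx₀
      exact ⟨α, 0, Nat.zero_le _, by simp, c, fun x y hx hy => ⟨by simp, hc x y hx hy⟩⟩

/-- More than `n * #P` indicator vectors indexed by `P × Fin n` are linearly dependent. -/
lemma exists_class_sum_relation {ι κ : Type*} [DecidableEq ι] {n : ℕ} (P : Finset κ)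
    (S : Finset ι) (c : κ → ι → Fin n) (hcard : n * P.card < S.card) :
    ∃ f : ι → ℝ, (∃ x ∈ S, f x ≠ 0) ∧
      ∀ p ∈ P, ∀ i, ∑ x ∈ S, f x * (if c p x = i then 1 else 0) = 0 := by
  let w : S → (P × Fin n → ℝ) := fun x k => if c k.1 x = k.2 then 1 else 0
  have hdep : ¬ LinearIndependent ℝ w := by
    intro h
    have := h.fintype_card_le_finrank
    simp only [Fintype.card_coe, Module.finrank_fintype_fun_eq_card, Fintype.card_prod,
      Fintype.card_fin] at this
    rw [mul_comm] at this
    omega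
  obtain ⟨g, hg, x, hx⟩ := Fintype.not_linearIndependent_iff.mp hdep
  refine ⟨fun y => if h : y ∈ S then g ⟨y, h⟩ else 0, ⟨x, x.2, by simpa using hx⟩, ?_⟩
  intro p hp i
  have := congrFun hg (⟨p, hp⟩, i)
  simp only [Finset.sum_apply, Pi.smul_apply, smul_eq_mul, Pi.zero_apply, w] at this
  refine Eq.trans ?_ this
  rw [← Finset.sum_coe_sort S]
  simp

/-- Positive semidefiniteness of the centred class kernel. -/
lemma class_kernel_nonneg {ι : Type*} {n : ℕ} (S : Finset ι) (c : ι → Fin n)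
    (a b : ι → ℝ)
    (hab : ∀ i, ∑ x ∈ S, a x * (if c x = i then 1 else 0) =
      ∑ x ∈ S, b x * (if c x = i then 1 else 0)) :
    0 ≤ ∑ x ∈ S, ∑ y ∈ S, a x * b y * ((if c x = c y then 1 else 0) - 1 / (n : ℝ)) := by
  set u : Fin n → ℝ := fun i => ∑ x ∈ S, a x * (if c x = i then 1 else 0) with hu
  have hv : ∀ i, u i = ∑ x ∈ S, b x * (if c x = i then 1 else 0) := hab
  have hsa : ∑ i, u i = ∑ x ∈ S, a x := by
    simp only [hu]
    rw [Finset.sum_comm]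
    simp
  have hsb : ∑ i, u i = ∑ x ∈ S, b x := by
    simp only [hv]
    rw [Finset.sum_comm]
    simp
  have hsq : ∑ i, u i ^ 2 = ∑ x ∈ S, ∑ y ∈ S, a x * b y * (if c x = c y then 1 else 0) := by
    have h1 : ∀ i, u i ^ 2 = ∑ x ∈ S, ∑ y ∈ S,
        a x * b y * ((if c x = i then 1 else 0) * (if c y = i then 1 else 0)) := by
      intro i
      rw [sq]
      nth_rewrite 2 [hv i]
      simp only [hu]
      rw [Finset.sum_mul_sum]
      exact Finset.sum_congr rfl fun x _ => Finset.sum_congr rfl fun y _ => by ring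
    simp_rw [h1]
    rw [Finset.sum_comm]
    refine Finset.sum_congr rfl fun x _ => ?_
    rw [Finset.sum_comm]
    refine Finset.sum_congr rfl fun y _ => ?_
    rw [← Finset.mul_sum]
    congr 1
    simp [eq_comm]
  have hmain : ∑ x ∈ S, ∑ y ∈ S, a x * b y * ((if c x = c y then 1 else 0) - 1 / (n : ℝ)) =
      ∑ i, u i ^ 2 - 1 / (n : ℝ) * (∑ i, u i) ^ 2 := by
    rw [sq (∑ i, u i)]
    nth_rewrite 1 [hsa]
    rw [hsb, hsq, Finset.sum_mul_sum, Finset.mul_sum, ← Finset.sum_sub_distrib]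
    refine Finset.sum_congr rfl fun x _ => ?_
    rw [Finset.mul_sum, ← Finset.sum_sub_distrib]
    exact Finset.sum_congr rfl fun y _ => by ring
  rw [hmain]
  have hcs := sq_sum_le_card_mul_sum_sq (s := Finset.univ) (f := u)
  simp only [Finset.card_univ, Fintype.card_fin] at hcs
  rcases Nat.eq_zero_or_pos n with rfl | hn
  · simp
  · have hn' : (0 : ℝ) < n := by exact_mod_cast hn
    rw [sub_nonneg, one_div, inv_mul_le_iff₀ hn']
    exact hcs

/-- A set whose weighted centred class kernel is nonpositive off the diagonal, with isolated
zeros, has at most `n * #P` elements. -/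
lemma card_le_of_class_kernel_nonpos {ι κ : Type*} [DecidableEq ι] {n : ℕ} (hn : 2 ≤ n)
    (P : Finset κ) (hP : P.Nonempty) (S : Finset ι) (c : κ → ι → Fin n) (l : κ → ℝ)
    (hl : ∀ p ∈ P, 0 ≤ l p) (Q : ι → ι → ℝ)
    (hQdef : ∀ x y, Q x y = ∑ p ∈ P, l p * ((if c p x = c p y then 1 else 0) - 1 / (n : ℝ)))
    (hQ : ∀ x ∈ S, ∀ y ∈ S, x ≠ y → Q x y ≤ 0)
    (hiso : ∀ x ∈ S, ∀ y ∈ S, ∀ z ∈ S, x ≠ y → z ≠ x → z ≠ y → Q x y = 0 → Q x z ≠ 0) :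
    S.card ≤ n * P.card := by
  by_contra! hcard
  have hQsymm : ∀ x y, Q x y = Q y x := by
    intro x y
    rw [hQdef, hQdef]
    simp only [eq_comm]
  obtain ⟨f, ⟨x₁, hx₁, hfx₁⟩, hf⟩ := exists_class_sum_relation P S c hcard
  have hsum : ∑ x ∈ S, f x = 0 := by
    obtain ⟨p, hp⟩ := hP
    have h := Finset.sum_eq_zero (s := Finset.univ) fun i _ => hf p hp i
    rw [Finset.sum_comm] at h
    simpa using h
  have hpos : ∃ x ∈ S, 0 < f x := by
    by_contra! h
    exact hfx₁ ((Finset.sum_eq_zero_iff_of_nonpos h).mp hsum x₁ hx₁)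
  have hneg : ∃ x ∈ S, f x < 0 := by
    by_contra! h
    exact hfx₁ ((Finset.sum_eq_zero_iff_of_nonneg h).mp hsum x₁ hx₁)
  have hsplit : ∀ x, f x = (f x)⁺ - (f x)⁻ := fun x => (posPart_sub_negPart (f x)).symm
  have htotal : 0 ≤ ∑ x ∈ S, ∑ y ∈ S, (f x)⁺ * (f y)⁻ * Q x y := by
    have : ∑ x ∈ S, ∑ y ∈ S, (f x)⁺ * (f y)⁻ * Q x y = ∑ p ∈ P, l p * ∑ x ∈ S, ∑ y ∈ S,
        (f x)⁺ * (f y)⁻ * ((if c p x = c p y then 1 else 0) - 1 / (n : ℝ)) := by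
      simp_rw [hQdef, Finset.mul_sum]
      rw [Finset.sum_comm' (s := P) (t := fun _ => S) (t' := S) (s' := fun _ => P) (by tauto)]
      refine Finset.sum_congr rfl fun x _ => ?_
      rw [Finset.sum_comm]
      exact Finset.sum_congr rfl fun p _ => Finset.sum_congr rfl fun y _ => by ring
    rw [this]
    refine Finset.sum_nonneg fun p hp => mul_nonneg (hl p hp) ?_
    refine class_kernel_nonneg S (c p) _ _ fun i => ?_
    rw [← sub_eq_zero, ← Finset.sum_sub_distrib]
    refine Eq.trans ?_ (hf p hp i)
    refine Finset.sum_congr rfl fun x _ => ?_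
    rw [← sub_mul, ← hsplit]
  have hterm : ∀ x ∈ S, ∀ y ∈ S, (f x)⁺ * (f y)⁻ * Q x y ≤ 0 := by
    intro x hx y hy
    rcases eq_or_ne x y with rfl | hxy
    · rcases le_total 0 (f x) with h | h
      · simp [negPart_eq_zero.mpr h]
      · simp [posPart_eq_zero.mpr h]
    · exact mul_nonpos_of_nonneg_of_nonpos
        (mul_nonneg (posPart_nonneg _) (negPart_nonneg _)) (hQ x hx y hy hxy)
  have hzero : ∀ x ∈ S, ∀ y ∈ S, 0 < f x → f y < 0 → Q x y = 0 := by
    intro x hx y hy hfx hfy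
    have h1 : ∑ x ∈ S, ∑ y ∈ S, (f x)⁺ * (f y)⁻ * Q x y = 0 :=
      le_antisymm (Finset.sum_nonpos fun x hx => Finset.sum_nonpos (hterm x hx)) htotal
    have h2 := (Finset.sum_eq_zero_iff_of_nonpos
      fun x hx => Finset.sum_nonpos (hterm x hx)).mp h1 x hx
    have h3 := (Finset.sum_eq_zero_iff_of_nonpos (hterm x hx)).mp h2 y hy
    have h4 : (f x)⁺ * (f y)⁻ ≠ 0 :=
      mul_ne_zero (posPart_pos hfx).ne' (negPart_pos hfy).ne'
    exact (mul_eq_zero.mp h3).resolve_left h4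
  obtain ⟨x, hx, hfx⟩ := hpos
  obtain ⟨y, hy, hfy⟩ := hneg
  have hxy : x ≠ y := by
    rintro rfl
    linarith
  have hQxy := hzero x hx y hy hfx hfy
  have hsupp : ∀ z ∈ S, z ≠ x → z ≠ y → f z = 0 := by
    intro z hz hzx hzy
    rcases lt_trichotomy (f z) 0 with h | h | h
    · exact absurd (hzero x hx z hz hfx h) (hiso x hx y hy z hz hxy hzx hzy hQxy)
    · exact h
    · exact absurd ((hQsymm y z).trans (hzero z hz y hy h hfy))
        (hiso y hy x hx z hz hxy.symm hzy hzx ((hQsymm y x).trans hQxy))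
  have hclass : ∀ p ∈ P, c p x = c p y := by
    intro p hp
    by_contra hne
    have h := hf p hp (c p x)
    rw [Finset.sum_eq_single_of_mem x hx] at h
    · simp only [if_true, mul_one] at h
      exact hfx.ne' h
    · intro z hz hzx
      rcases eq_or_ne z y with rfl | hzy
      · simp [Ne.symm hne]
      · simp [hsupp z hz hzx hzy]
  have hn' : (0 : ℝ) < 1 - 1 / (n : ℝ) := by
    have : (2 : ℝ) ≤ n := by exact_mod_cast hn
    rw [sub_pos, div_lt_one (by linarith)]
    linarith
  have hl0 : ∀ p ∈ P, l p = 0 := by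
    have h1 : ∑ p ∈ P, l p * (1 - 1 / (n : ℝ)) = 0 := by
      rw [← hQxy, hQdef]
      exact Finset.sum_congr rfl fun p hp => by rw [if_pos (hclass p hp)]
    intro p hp
    have h2 := (Finset.sum_eq_zero_iff_of_nonneg
      fun p hp => mul_nonneg (hl p hp) hn'.le).mp h1 p hp
    exact (mul_eq_zero.mp h2).resolve_right hn'.ne'
  have hthree : 2 < S.card := lt_of_le_of_lt
    (hn.trans (Nat.le_mul_of_pos_right n hP.card_pos)) hcard
  obtain ⟨z, hz, hzxy⟩ := Finset.exists_mem_notMem_of_card_lt_card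
    (lt_of_le_of_lt (Finset.card_le_two (a := x) (b := y)) hthree)
  simp only [Finset.mem_insert, Finset.mem_singleton, not_or] at hzxy
  refine hiso x hx y hy z hz hxy hzxy.1 hzxy.2 hQxy ?_
  rw [hQdef]
  exact Finset.sum_eq_zero fun p hp => by rw [hl0 p hp, zero_mul]

/-- Combining the local lower bounds on the valuations of `y - x`. -/
lemma class_kernel_le_log_sub {n q : ℕ} (hn : 2 ≤ n) (hq : q ≠ 0) (A B : ℕ → ℕ)
    (hAB : ∀ p ∈ q.primeFactors, q.factorization p ≤ A p + (n - 1) * B p)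
    (c : ℕ → ℤ → Fin n) {x y : ℤ} (hxy : x < y)
    (hB : ∀ p ∈ q.primeFactors, (p : ℤ) ^ B p ∣ y - x)
    (hA : ∀ p ∈ q.primeFactors, c p x = c p y → (p : ℤ) ^ A p ∣ y - x) :
    ∑ p ∈ q.primeFactors, (((A p : ℝ) - B p) * Real.log p) *
        ((if c p x = c p y then 1 else 0) - 1 / (n : ℝ)) ≤
      Real.log ((y : ℝ) - x) - 1 / (n : ℝ) * Real.log q := by
  set k : ℕ → ℕ := fun p => if c p x = c p y then A p else B p with hk
  have hn0 : (0 : ℝ) < n := by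
    have : 0 < n := by omega
    exact_mod_cast this
  have hdvd : ∏ p ∈ q.primeFactors, (p : ℤ) ^ k p ∣ y - x := by
    refine Finset.prod_dvd_of_coprime ?_ ?_
    · intro p hp r hr hpr
      have := (Nat.coprime_primes (Nat.prime_of_mem_primeFactors hp)
        (Nat.prime_of_mem_primeFactors hr)).mpr hpr
      exact (Nat.isCoprime_iff_coprime.mpr this).pow
    · intro p hp
      by_cases h : c p x = c p y
      · simpa [hk, h] using hA p hp h
      · simpa [hk, h] using hB p hp
  have hle : ∏ p ∈ q.primeFactors, (p : ℝ) ^ k p ≤ (y : ℝ) - x := by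
    exact_mod_cast Int.le_of_dvd (by omega) hdvd
  have hppos : ∀ p ∈ q.primeFactors, (0 : ℝ) < p := fun p hp => by
    exact_mod_cast (Nat.prime_of_mem_primeFactors hp).pos
  have hlogk : ∑ p ∈ q.primeFactors, (k p : ℝ) * Real.log p ≤ Real.log ((y : ℝ) - x) := by
    have h1 := Real.log_le_log (Finset.prod_pos fun p hp => pow_pos (hppos p hp) _) hle
    rw [Real.log_prod fun p hp => (pow_pos (hppos p hp) _).ne'] at h1
    simpa [Real.log_pow] using h1
  have hlogq : Real.log q = ∑ p ∈ q.primeFactors, (q.factorization p : ℝ) * Real.log p := by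
    conv_lhs => rw [← Nat.prod_factorization_pow_eq_self hq]
    rw [Finsupp.prod, Nat.support_factorization]
    push_cast
    rw [Real.log_prod fun p hp => (pow_pos (hppos p hp) _).ne']
    simp [Real.log_pow]
  refine le_trans ?_ (sub_le_sub_right hlogk _)
  rw [hlogq, Finset.mul_sum, ← Finset.sum_sub_distrib]
  refine Finset.sum_le_sum fun p hp => ?_
  have hlog : 0 ≤ Real.log p := Real.log_natCast_nonneg p
  have hAB' : (q.factorization p : ℝ) ≤ A p + ((n : ℝ) - 1) * B p := by
    have h := hAB p hp
    have h1 : ((n - 1 : ℕ) : ℝ) = (n : ℝ) - 1 := by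
      rw [Nat.cast_sub (by omega), Nat.cast_one]
    rw [← h1]
    exact_mod_cast h
  have hmul := mul_le_mul_of_nonneg_right hAB' hlog
  have hmul' := mul_le_mul_of_nonneg_left hmul (one_div_pos.mpr hn0).le
  have hcancel : 1 / (n : ℝ) * n = 1 := by field_simp
  by_cases h : c p x = c p y
  · simp only [hk, h, if_true]
    linear_combination hmul' + (B p * Real.log p) * hcancel
  · simp only [hk, h, if_false]
    linear_combination hmul' + (B p * Real.log p) * hcancel

theorem binomial_roots_in_short_interval (n : ℕ) (hn : 2 ≤ n) (d : ℤ)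
    (q : ℕ) (hq : 2 ≤ q)
    (a b : ℝ) (hI : b - a ≤ (q : ℝ) ^ ((1 : ℝ) / n)) :
    ((Finset.Icc ⌈a⌉ ⌊b⌋).filter (fun x => (q : ℤ) ∣ x ^ n + d)).card ≤
      n * q.primeFactors.card := by
  set S := (Finset.Icc ⌈a⌉ ⌊b⌋).filter (fun x => (q : ℤ) ∣ x ^ n + d) with hS
  rcases S.eq_empty_or_nonempty with hemp | ⟨x₀, hx₀⟩
  · simp [hemp]
  have hroot : ∀ x ∈ S, (q : ℤ) ∣ x ^ n - x₀ ^ n := by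
    intro x hx
    have := dvd_sub (Finset.mem_filter.mp hx).2 (Finset.mem_filter.mp hx₀).2
    rwa [add_sub_add_right_eq_sub] at this
  have hmem : ∀ x ∈ S, a ≤ x ∧ (x : ℝ) ≤ b := by
    intro x hx
    have := Finset.mem_Icc.mp (Finset.mem_filter.mp hx).1
    exact ⟨Int.ceil_le.mp this.1, Int.le_floor.mp this.2⟩
  have hlocal : ∀ p : ℕ, ∃ (A B : ℕ) (c : ℤ → Fin n), p ∈ q.primeFactors →
      B ≤ A ∧ q.factorization p ≤ A + (n - 1) * B ∧ ∀ x ∈ S, ∀ y ∈ S,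
        (p : ℤ) ^ B ∣ y - x ∧ (c x = c y → (p : ℤ) ^ A ∣ y - x) := by
    intro p
    by_cases hp : p ∈ q.primeFactors
    · obtain ⟨A, B, hBA, hle, c, hc⟩ :=
        exists_classes (Nat.prime_of_mem_primeFactors hp) n hn (q.factorization p) x₀
      have hpq : (p : ℤ) ^ q.factorization p ∣ q := by
        exact_mod_cast Nat.ordProj_dvd q p
      refine ⟨A, B, c, fun _ => ⟨hBA, hle, fun x hx y hy => ?_⟩⟩
      have := hc y x (hpq.trans (hroot y hy)) (hpq.trans (hroot x hx))
      exact ⟨this.1, fun h => this.2 h.symm⟩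
    · exact ⟨0, 0, fun _ => ⟨0, by omega⟩, fun h => absurd h hp⟩
  choose A B c hABc using hlocal
  set Q : ℤ → ℤ → ℝ := fun x y => ∑ p ∈ q.primeFactors, (((A p : ℝ) - B p) * Real.log p) *
        ((if c p x = c p y then 1 else 0) - 1 / (n : ℝ)) with hQ
  have hQsymm : ∀ x y, Q x y = Q y x := by
    intro x y
    simp only [hQ, eq_comm]
  have hq0 : (0 : ℝ) < q := by
    have : 0 < q := by omega
    exact_mod_cast this
  have hlogq : 1 / (n : ℝ) * Real.log q = Real.log ((q : ℝ) ^ ((1 : ℝ) / n)) :=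
    (Real.log_rpow hq0 _).symm
  have hQle : ∀ x ∈ S, ∀ y ∈ S, x < y →
      Q x y ≤ Real.log ((y : ℝ) - x) - Real.log ((q : ℝ) ^ ((1 : ℝ) / n)) := by
    intro x hx y hy hxy
    rw [← hlogq]
    exact class_kernel_le_log_sub hn (by omega) A B (fun p hp => (hABc p hp).2.1) c hxy
      (fun p hp => ((hABc p hp).2.2 x hx y hy).1) (fun p hp => ((hABc p hp).2.2 x hx y hy).2)
  have hsub : ∀ x ∈ S, ∀ y ∈ S, x < y →
      0 < (y : ℝ) - x ∧ (y : ℝ) - x ≤ (q : ℝ) ^ ((1 : ℝ) / n) := by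
    intro x hx y hy hxy
    have : (x : ℝ) < y := by exact_mod_cast hxy
    exact ⟨by linarith, by linarith [(hmem x hx).1, (hmem y hy).2]⟩
  have hnonpos : ∀ x ∈ S, ∀ y ∈ S, x < y → Q x y ≤ 0 := by
    intro x hx y hy hxy
    have h := hsub x hx y hy hxy
    linarith [hQle x hx y hy hxy, Real.log_le_log h.1 h.2]
  have hextreme : ∀ x ∈ S, ∀ y ∈ S, x < y → Q x y = 0 → (x : ℝ) = a ∧ (y : ℝ) = b := by
    intro x hx y hy hxy h0
    have h := hsub x hx y hy hxy
    have h1 : (q : ℝ) ^ ((1 : ℝ) / n) ≤ (y : ℝ) - x :=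
      (Real.log_le_log_iff (Real.rpow_pos_of_pos hq0 _) h.1).mp
        (by linarith [hQle x hx y hy hxy])
    constructor <;> linarith [(hmem x hx).1, (hmem y hy).2]
  have hends : ∀ x ∈ S, ∀ y ∈ S, x ≠ y → Q x y = 0 →
      ((x : ℝ) = a ∧ (y : ℝ) = b) ∨ ((x : ℝ) = b ∧ (y : ℝ) = a) := by
    intro x hx y hy hxy h0
    rcases lt_or_gt_of_ne hxy with h | h
    · exact Or.inl (hextreme x hx y hy h h0)
    · exact Or.inr (hextreme y hy x hx h ((hQsymm y x).trans h0)).symm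
  refine card_le_of_class_kernel_nonpos hn q.primeFactors
    (Nat.nonempty_primeFactors.mpr (by omega)) S c
    (fun p => ((A p : ℝ) - B p) * Real.log p) ?_ Q (fun _ _ => rfl) ?_ ?_
  · intro p hp
    have : (B p : ℝ) ≤ A p := by exact_mod_cast (hABc p hp).1
    exact mul_nonneg (by linarith) (Real.log_natCast_nonneg p)
  · intro x hx y hy hxy
    rcases lt_or_gt_of_ne hxy with h | h
    · exact hnonpos x hx y hy h
    · exact (hQsymm x y).trans_le (hnonpos y hy x hx h)
  · intro x hx y hy z hz hxy hzx hzy hxy0 hxz0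
    have hxy' : (x : ℝ) ≠ y := by exact_mod_cast hxy
    have hzx' : (z : ℝ) ≠ x := by exact_mod_cast hzx
    have hzy' : (z : ℝ) ≠ y := by exact_mod_cast hzy
    rcases hends x hx y hy hxy hxy0 with h1 | h1 <;>
      rcases hends x hx z hz hzx.symm hxz0 with h2 | h2
    · exact hzy' (h2.2.trans h1.2.symm)
    · exact hzx' (h2.2.trans h1.1.symm)
    · exact hzx' (h2.2.trans h1.1.symm)
    · exact hzy' (h2.2.trans h1.2.symm)
end

section
/- Let P(x) = a_n x^n + ⋯ + a_0 ∈ ℤ[x] have degree n ≥ 2, let q ≥ 2 with gcd(a_n,…,a_0,q) = 1, and let I be an interval of length at most q^{1/n}. Then the number W of integers x ∈ I satisfying P(x) ≡ 0 (mod q) satisfies W < (1 − 1/n)·(log q)/(log 4) + (log log q)/(log 4) + 3. -/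
/-- **Hadamard's inequality** for a real matrix with entries bounded by `M`. -/
theorem Matrix.sq_det_le_of_abs_le {m : ℕ} (A : Matrix (Fin m) (Fin m) ℝ) (M : ℝ)
    (hA : ∀ i j, |A i j| ≤ M) : A.det ^ 2 ≤ (M ^ 2 * m) ^ m := by
  let b := EuclideanSpace.basisFun (Fin m) ℝ
  have : Fact (Module.finrank ℝ (EuclideanSpace ℝ (Fin m)) = m) := ⟨by simp⟩
  let v : Fin m → EuclideanSpace ℝ (Fin m) := fun i => WithLp.toLp 2 (A i)
  have hdet : b.toBasis.det v = A.det := by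
    rw [Module.Basis.det_apply, ← Matrix.det_transpose]
    congr 1
  have hle : |A.det| ≤ ∏ i, ‖v i‖ := by
    have h := b.toBasis.orientation.abs_volumeForm_apply_le v
    rwa [b.toBasis.orientation.volumeForm_robust' b, hdet] at h
  have hnorm : ∀ i, ‖v i‖ ^ 2 ≤ M ^ 2 * m := fun i => by
    rw [EuclideanSpace.norm_sq_eq]
    calc ∑ j, ‖v i j‖ ^ 2 ≤ ∑ _j : Fin m, M ^ 2 :=
          Finset.sum_le_sum fun j _ => pow_le_pow_left₀ (norm_nonneg _) (hA i j) 2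
      _ = M ^ 2 * m := by simp [mul_comm]
  calc A.det ^ 2 = |A.det| ^ 2 := (sq_abs _).symm
    _ ≤ (∏ i, ‖v i‖) ^ 2 := pow_le_pow_left₀ (abs_nonneg _) hle 2
    _ = ∏ i, ‖v i‖ ^ 2 := (Finset.prod_pow _ _ _).symm
    _ ≤ ∏ _i : Fin m, (M ^ 2 * m : ℝ) :=
        Finset.prod_le_prod (fun _ _ => by positivity) fun i _ => hnorm i
    _ = (M ^ 2 * m) ^ m := by simp

theorem Polynomial.Chebyshev.abs_eval_C_le_two (k : ℤ) {x : ℝ} (hx : |x| ≤ 2) :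
    |(C ℝ k).eval x| ≤ 2 := by
  obtain ⟨h1, h2⟩ := abs_le.mp hx
  have h : x = 2 * Real.cos (Real.arccos (x / 2)) := by
    rw [Real.cos_arccos (by linarith) (by linarith)]
    ring
  rw [h, C_two_mul_real_cos, abs_mul, abs_two]
  linarith [Real.abs_cos_le_one (k * Real.arccos (x / 2))]

theorem Polynomial.Chebyshev.isMonicOfDegree_C (k : ℕ) :
    IsMonicOfDegree (C ℝ (k + 1 : ℕ)) (k + 1) := by
  induction k using Nat.twoStepInduction with
  | zero => simpa using isMonicOfDegree_X ℝ
  | one =>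
    simp only [Nat.reduceAdd, Nat.cast_ofNat, C_two]
    exact (isMonicOfDegree_X_pow ℝ 2).sub (by simp)
  | more k h1 h2 =>
    have h : C ℝ (k + 2 + 1 : ℕ) = X * C ℝ (k + 1 + 1 : ℕ) - C ℝ (k + 1 : ℕ) := by
      rw [show ((k + 2 + 1 : ℕ) : ℤ) = (k + 1 : ℕ) + 2 by push_cast; ring, C_add_two]
      push_cast
      rfl
    rw [h, show k + 2 + 1 = 1 + (k + 1 + 1) by ring]
    refine ((isMonicOfDegree_X ℝ).mul h2).sub ?_
    rw [h1.natDegree_eq]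
    omega

open Polynomial in
/-- There is a monic real polynomial of each degree that is bounded by `2` on `[-2, 2]`. -/
theorem Polynomial.exists_isMonicOfDegree_abs_eval_le_two (k : ℕ) :
    ∃ p : ℝ[X], IsMonicOfDegree p k ∧ ∀ x : ℝ, |x| ≤ 2 → |p.eval x| ≤ 2 := by
  cases k with
  | zero => exact ⟨1, by simp, fun x _ => by norm_num⟩
  | succ k => exact ⟨_, Chebyshev.isMonicOfDegree_C k, fun x => Chebyshev.abs_eval_C_le_two _⟩

theorem Matrix.sq_det_vandermonde_le {m : ℕ} (v : Fin m → ℝ) (hv : ∀ i, |v i| ≤ 2) :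
    (Matrix.vandermonde v).det ^ 2 ≤ (4 * m) ^ m := by
  choose p hp hp2 using Polynomial.exists_isMonicOfDegree_abs_eval_le_two
  rw [Matrix.det_eval_matrixOfPolynomials_eq_det_vandermonde v (fun i => p i)
    (fun i => (hp i).natDegree_eq) (fun i => (hp i).monic)]
  calc _ ≤ ((2 : ℝ) ^ 2 * m) ^ m := Matrix.sq_det_le_of_abs_le _ 2 fun i j => hp2 j _ (hv i)
    _ = (4 * m) ^ m := by norm_num

theorem Matrix.sq_det_vandermonde_mul_add {R : Type*} [CommRing R] {m : ℕ} (v : Fin m → R)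
    (c d : R) : (Matrix.vandermonde fun i => c * v i + d).det ^ 2 =
      c ^ (m * (m - 1)) * (Matrix.vandermonde v).det ^ 2 := by
  have h : (Matrix.vandermonde fun i => c * v i) =
      Matrix.vandermonde v * Matrix.diagonal fun j : Fin m => c ^ (j : ℕ) := by
    ext i j
    simp [Matrix.vandermonde_apply, mul_pow, mul_comm]
  rw [Matrix.det_vandermonde_add (fun i => c * v i), h, Matrix.det_mul, Matrix.det_diagonal,
    Fin.prod_univ_eq_prod_range (fun j => c ^ j), Finset.prod_pow_eq_pow_sum, mul_pow, ← pow_mul,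
    Finset.sum_range_id_mul_two, mul_comm]

/-- The product of `a - b` over all ordered pairs of distinct elements of `s`. -/
def Finset.diffProd {R : Type*} [CommRing R] [DecidableEq R] (s : Finset R) : R :=
  ∏ a ∈ s, ∏ b ∈ s.erase a, (a - b)

theorem Finset.abs_diffProd_eq_sq_det_vandermonde (s : Finset ℤ) (v : Fin s.card → ℤ)
    (hv : Function.Injective v) (hvs : Finset.univ.image v = s) :
    |s.diffProd| = (Matrix.vandermonde v).det ^ 2 := by
  classical
  have h : s.diffProd = ∏ i, ∏ j ∈ ({i}ᶜ : Finset (Fin s.card)), (v i - v j) := by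
    unfold diffProd
    conv_lhs => rw [← hvs]
    rw [Finset.prod_image fun _ _ _ _ h => hv h]
    refine Finset.prod_congr rfl fun i _ => ?_
    rw [← Finset.image_erase hv, Finset.prod_image fun _ _ _ _ h => hv h]
    congr 1
    ext; simp
  rw [h, ← Finset.prod_prod_Ioi_mul_eq_prod_prod_off_diag (fun j i => v i - v j),
    Matrix.det_vandermonde, Finset.abs_prod, ← Finset.prod_pow]
  refine Finset.prod_congr rfl fun i _ => ?_
  rw [Finset.abs_prod, ← Finset.prod_pow]
  refine Finset.prod_congr rfl fun j _ => ?_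
  rw [abs_mul, abs_sub_comm, ← sq, sq_abs]

/-- Integer points of an interval of length at most `L` have small product of differences. -/
theorem Finset.abs_diffProd_le (s : Finset ℤ) (a L : ℝ) (hL : 0 < L)
    (hs : ∀ x ∈ s, a ≤ x ∧ (x : ℝ) ≤ a + L) :
    |(s.diffProd : ℝ)| ≤ (L / 4) ^ (s.card * (s.card - 1)) * (4 * s.card) ^ s.card := by
  let v : Fin s.card → ℤ := s.orderEmbOfFin rfl
  have hvs : Finset.univ.image v = s := by simp [v]
  have hD := s.abs_diffProd_eq_sq_det_vandermonde v (s.orderEmbOfFin rfl).injective hvs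
  let y : Fin s.card → ℝ := fun i => (4 / L) * (v i) + (-(4 / L) * a - 2)
  have hy : ∀ i, |y i| ≤ 2 := fun i => by
    obtain ⟨h1, h2⟩ := hs _ (s.orderEmbOfFin_mem rfl i)
    have e : y i = 4 / L * (v i - a) - 2 := by simp only [y]; ring
    have h3 : 0 ≤ 4 / L * (v i - a) := mul_nonneg (by positivity) (sub_nonneg.2 h1)
    have h4 : 4 / L * (v i - a) ≤ 4 := by
      calc 4 / L * (v i - a) ≤ 4 / L * L := by
            gcongr
            linarith [show (v i : ℝ) ≤ a + L from h2]
        _ = 4 := by field_simp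
    rw [e, abs_le]
    constructor <;> linarith
  have hV : (Matrix.vandermonde fun i => (v i : ℝ)).det ^ 2 =
      (L / 4) ^ (s.card * (s.card - 1)) * (Matrix.vandermonde y).det ^ 2 := by
    rw [← Matrix.sq_det_vandermonde_mul_add y (L / 4) (a + L / 2)]
    congr! with i
    simp only [y]
    field_simp
    ring
  have hcast : |(s.diffProd : ℝ)| = (Matrix.vandermonde fun i => (v i : ℝ)).det ^ 2 := by
    rw [← Int.cast_abs, hD]
    simp [Matrix.det_vandermonde]
  rw [hcast, hV]
  gcongr
  exact Matrix.sq_det_vandermonde_le y hy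

theorem Finset.diffProd_eq_mul_diffProd_erase {R : Type*} [CommRing R] [DecidableEq R]
    {s : Finset R} {a : R} (ha : a ∈ s) :
    s.diffProd = (∏ b ∈ s.erase a, (a - b)) * (∏ b ∈ s.erase a, (b - a)) *
      (s.erase a).diffProd := by
  rw [diffProd, ← Finset.mul_prod_erase s (fun a => ∏ b ∈ s.erase a, (a - b)) ha, mul_assoc]
  congr 1
  rw [diffProd, ← Finset.prod_mul_distrib]
  refine Finset.prod_congr rfl fun b hb => ?_
  rw [← Finset.mul_prod_erase (s.erase b) (fun c => b - c)
    (Finset.mem_erase.2 ⟨(Finset.ne_of_mem_erase hb).symm, ha⟩), Finset.erase_right_comm]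

theorem PadicInt.mul_dvd_pow_of_not_pow_dvd {p : ℕ} [Fact p.Prime] {e : ℕ} {d : ℤ}
    (h : ¬ (p : ℤ) ^ e ∣ d) : (p : ℤ_[p]) * d ∣ (p : ℤ_[p]) ^ e := by
  have hd : (d : ℤ_[p]) ≠ 0 := by
    rintro h0
    exact h (by simp [Int.cast_eq_zero.1 h0])
  have hs := PadicInt.unitCoeff_spec hd
  have hlt : (d : ℤ_[p]).valuation < e := by
    by_contra! hle
    refine h ((PadicInt.pow_p_dvd_int_iff e d).1 ?_)
    rw [hs]
    exact (pow_dvd_pow _ hle).mul_left _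
  rw [hs, mul_left_comm, ← pow_succ', Units.mul_left_dvd]
  exact pow_dvd_pow _ hlt

open Polynomial in
/-- Lagrange interpolation modulo prime powers: if a polynomial that does not vanish modulo `p` has
degree less than `#s` and is divisible by `p ^ e` on `s`, then `p ^ e` divides one of the products
of differences that occur as denominators in the interpolation formula. -/
theorem Polynomial.exists_pow_dvd_prod_sub {p : ℕ} (hp : p.Prime) {F : ℤ[X]}
    (hF : ¬ C (p : ℤ) ∣ F) {s : Finset ℤ} (hdeg : F.degree < s.card) {e : ℕ}
    (hs : ∀ a ∈ s, (p : ℤ) ^ e ∣ F.eval a) :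
    ∃ a ∈ s, (p : ℤ) ^ e ∣ ∏ b ∈ s.erase a, (a - b) := by
  have : Fact p.Prime := ⟨hp⟩
  by_contra! hcon
  have hdiv : ∀ a ∈ s, ∃ h : ℤ_[p],
      ((F.eval a : ℤ) : ℤ_[p]) = p * ((∏ b ∈ s.erase a, (a - b) : ℤ) : ℤ_[p]) * h := fun a ha =>
    (PadicInt.mul_dvd_pow_of_not_pow_dvd (hcon a ha)).trans
      (by exact_mod_cast Int.cast_dvd_cast (α := ℤ_[p]) _ _ (hs a ha))
  choose! h hh using hdiv
  let G : ℤ_[p][X] := ∑ a ∈ s, C (h a) * ∏ b ∈ s.erase a, (X - C (b : ℤ_[p]))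
  have hGdeg : (C (p : ℤ_[p]) * G).degree < s.card := by
    rw [← mem_degreeLT]
    refine C_mul' (p : ℤ_[p]) G ▸ Submodule.smul_mem _ _ (Submodule.sum_mem _ fun a ha => ?_)
    rw [C_mul']
    refine Submodule.smul_mem _ _ ?_
    rw [mem_degreeLT, degree_prod]
    simp only [degree_X_sub_C, Finset.sum_const, Finset.card_erase_of_mem ha]
    have := Finset.card_pos.2 ⟨a, ha⟩
    simp only [nsmul_eq_mul, mul_one]
    exact_mod_cast (by omega : s.card - 1 < s.card)
  have hinj : Function.Injective (Int.cast : ℤ → ℤ_[p]) := Int.cast_injective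
  have hFG : F.map (Int.castRingHom ℤ_[p]) = C (p : ℤ_[p]) * G := by
    refine eq_of_degrees_lt_of_eval_finset_eq (s.map ⟨_, hinj⟩) ?_ ?_ ?_
    · rw [Finset.card_map]
      exact degree_map_le.trans_lt hdeg
    · rwa [Finset.card_map]
    · simp only [Finset.mem_map, Function.Embedding.coeFn_mk, forall_exists_index, and_imp,
        forall_apply_eq_imp_iff₂]
      intro a ha
      have hGa : G.eval (a : ℤ_[p]) = h a * ((∏ b ∈ s.erase a, (a - b) : ℤ) : ℤ_[p]) := by
        simp only [G, eval_finsetSum, eval_mul, eval_C, eval_prod, eval_sub, eval_X]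
        rw [Finset.sum_eq_single_of_mem a ha]
        · push_cast
          rfl
        · intro c hc hca
          rw [Finset.prod_eq_zero (Finset.mem_erase.2 ⟨hca.symm, ha⟩) (sub_self (a : ℤ_[p])),
            mul_zero]
      rw [eval_intCast_map, eval_mul, eval_C, hGa, eq_intCast, Int.cast_id, hh a ha]
      ring
  refine hF ((C_dvd_iff_dvd_coeff _ _).2 fun i => ?_)
  have hi : (p : ℤ_[p]) ^ 1 ∣ (F.coeff i : ℤ_[p]) := by
    have := congrArg (fun f => f.coeff i) hFG
    simp only [coeff_map, coeff_C_mul, eq_intCast] at this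
    rw [this, pow_one]
    exact dvd_mul_right _ _
  simpa using (PadicInt.pow_p_dvd_int_iff 1 _).1 hi

theorem Polynomial.pow_dvd_diffProd {p : ℕ} (hp : p.Prime) {P : Polynomial ℤ}
    (hP : ¬ C (p : ℤ) ∣ P) (k : ℕ) (s : Finset ℤ)
    (hs : ∀ a ∈ s, (p : ℤ) ^ k ∣ P.eval a) :
    (p : ℤ) ^ (k * (2 * ∑ j ∈ Finset.range s.card, j / P.natDegree)) ∣ s.diffProd := by
  induction hW : s.card generalizing s with
  | zero => simp
  | succ W ih =>
    have hprime : Prime (C (p : ℤ)) := prime_C_iff.2 (Nat.prime_iff_prime_int.1 hp)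
    obtain ⟨a, ha, hdvd⟩ := exists_pow_dvd_prod_sub hp (F := P ^ (W / P.natDegree)) (s := s)
      (e := k * (W / P.natDegree)) (fun h => hP (hprime.dvd_of_dvd_pow h))
      (by
        rw [hW]
        refine degree_le_natDegree.trans_lt ?_
        rw [natDegree_pow]
        exact_mod_cast Nat.lt_succ_of_le (Nat.div_mul_le_self _ _))
      (fun a ha => by
        rw [eval_pow, pow_mul]
        exact pow_dvd_pow_of_dvd (hs a ha) _)
    have hdvd' : (p : ℤ) ^ (k * (W / P.natDegree)) ∣ ∏ b ∈ s.erase a, (b - a) := by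
      rw [← dvd_abs, Finset.abs_prod] at hdvd ⊢
      simpa only [abs_sub_comm] using hdvd
    rw [Finset.diffProd_eq_mul_diffProd_erase ha, Finset.sum_range_succ,
      show k * (2 * (∑ j ∈ Finset.range W, j / P.natDegree + W / P.natDegree)) =
        k * (W / P.natDegree) + k * (W / P.natDegree) +
          k * (2 * ∑ j ∈ Finset.range W, j / P.natDegree) by ring, pow_add, pow_add]
    exact mul_dvd_mul (mul_dvd_mul hdvd hdvd') (ih _ (fun b hb => hs b (Finset.mem_of_mem_erase hb))
      (by rw [Finset.card_erase_of_mem ha, hW]; rfl))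

/-- If `q` is coprime to the content of `P` and divides the values of `P` on `s`, then a large
power of `q` divides the product of the differences of elements of `s`. -/
theorem Polynomial.natCast_pow_dvd_diffProd {P : Polynomial ℤ} {q : ℕ} (hq : q ≠ 0)
    (hcont : Int.gcd P.content q = 1) (s : Finset ℤ) (hs : ∀ a ∈ s, (q : ℤ) ∣ P.eval a) :
    (q : ℤ) ^ (2 * ∑ j ∈ Finset.range s.card, j / P.natDegree) ∣ s.diffProd := by
  rw [← Int.natAbs_dvd_natAbs, Int.natAbs_pow, Int.natAbs_natCast, Nat.dvd_iff_prime_pow_dvd_dvd]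
  intro p k hp hk
  rcases k.eq_zero_or_pos with rfl | hkpos
  · simp
  have hpq : p ∣ q := hp.dvd_of_dvd_pow ((dvd_pow_self p hkpos.ne').trans hk)
  have hP : ¬ C (p : ℤ) ∣ P := fun h => by
    have h1 : (p : ℤ) ∣ Int.gcd P.content q :=
      Int.dvd_coe_gcd ((dvd_content_iff_C_dvd).2 h) (Int.natCast_dvd_natCast.2 hpq)
    rw [hcont] at h1
    exact hp.one_lt.ne' (Nat.dvd_one.1 (by exact_mod_cast h1))
  rw [hp.pow_dvd_iff_le_factorization (pow_ne_zero _ hq), Nat.factorization_pow] at hk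
  have hdvd := pow_dvd_diffProd hp hP (q.factorization p) s fun a ha =>
    (by exact_mod_cast Nat.ordProj_dvd q p : (p : ℤ) ^ q.factorization p ∣ q).trans (hs a ha)
  rw [← Int.natAbs_dvd_natAbs, Int.natAbs_pow, Int.natAbs_natCast] at hdvd
  refine (pow_dvd_pow p ?_).trans hdvd
  simpa [mul_comm] using hk

theorem Nat.two_mul_mul_sum_range_div (n W : ℕ) (hn : 0 < n) :
    2 * (n : ℤ) * ∑ j ∈ Finset.range W, ((j / n : ℕ) : ℤ) =
      W * (W - n) + (W % n : ℕ) * (n - (W % n : ℕ)) := by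
  induction W with
  | zero => simp
  | succ W ih =>
    rw [Finset.sum_range_succ, mul_add, ih]
    have h1 := Nat.div_add_mod W n
    have h2 := Nat.mod_lt W hn
    zify at h1
    rcases Nat.lt_or_ge (W % n + 1) n with h | h
    · have : (W + 1) % n = W % n + 1 := by
        rw [Nat.add_mod, Nat.mod_eq_of_lt (a := 1) (by omega), Nat.mod_eq_of_lt h]
      rw [this]
      push_cast
      linear_combination 2 * h1
    · have h3 : n = W % n + 1 := by omega
      have : (W + 1) % n = 0 := by
        rw [Nat.add_mod, ← Nat.add_mod_mod, Nat.mod_mod, Nat.add_mod_mod, ← h3, Nat.mod_self]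
      rw [this]
      zify at h3
      push_cast
      linear_combination 2 * h1 + ((W : ℤ) % n + 1) * h3

theorem Nat.mul_sub_div_le_two_mul_sum_range_div (n W : ℕ) (hn : 0 < n) :
    (W : ℝ) * (W - n) / n ≤ ((2 * ∑ j ∈ Finset.range W, j / n : ℕ) : ℝ) := by
  have h : ((2 * (n : ℤ) * ∑ j ∈ Finset.range W, ((j / n : ℕ) : ℤ) : ℤ) : ℝ) =
    ((W * (W - n) + (W % n : ℕ) * (n - (W % n : ℕ)) : ℤ) : ℝ) :=
    congrArg _ (Nat.two_mul_mul_sum_range_div n W hn)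
  have hmod : ((W % n : ℕ) : ℝ) ≤ n := by exact_mod_cast (Nat.mod_lt W hn).le
  have hn' : (0 : ℝ) < n := by exact_mod_cast hn
  simp only [Int.cast_mul, Int.cast_add, Int.cast_sub, Int.cast_sum, Int.cast_natCast,
    Int.cast_ofNat] at h
  rw [Nat.cast_mul, Nat.cast_sum, Nat.cast_ofNat]
  rw [div_le_iff₀ hn']
  nlinarith [mul_nonneg (Nat.cast_nonneg (α := ℝ) (W % n)) (sub_nonneg.2 hmod)]

theorem Finset.diffProd_ne_zero {R : Type*} [CommRing R] [IsDomain R] [DecidableEq R]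
    (s : Finset R) : s.diffProd ≠ 0 :=
  Finset.prod_ne_zero_iff.2 fun _ _ => Finset.prod_ne_zero_iff.2 fun _ hb =>
    sub_ne_zero.2 (Finset.ne_of_mem_erase hb).symm

/-- The inequality obtained by comparing the divisibility of the product of differences of the
roots of `P` modulo `q` with its size. -/
theorem Polynomial.card_sub_two_mul_log_four_le {P : Polynomial ℤ} (hn : 0 < P.natDegree) {q : ℕ}
    (hq : 0 < q) (hcont : Int.gcd P.content q = 1) {s : Finset ℤ} (hne : s.Nonempty)
    (hs : ∀ x ∈ s, (q : ℤ) ∣ P.eval x) {a : ℝ}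
    (hsI : ∀ x ∈ s, a ≤ x ∧ (x : ℝ) ≤ a + (q : ℝ) ^ ((1 : ℝ) / P.natDegree)) :
    ((s.card : ℝ) - 2) * Real.log 4 ≤
      (1 - 1 / P.natDegree) * Real.log q + Real.log s.card := by
  set n := P.natDegree
  set W := s.card with hW
  set L := (q : ℝ) ^ ((1 : ℝ) / n) with hL
  have hq0 : (0 : ℝ) < q := by exact_mod_cast hq
  have hL0 : 0 < L := Real.rpow_pos_of_pos hq0 _
  have hWpos : 0 < W := Finset.card_pos.2 hne
  have hW0 : (0 : ℝ) < W := by exact_mod_cast hWpos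
  have hn0 : (0 : ℝ) < n := by exact_mod_cast hn
  have hlow : (q : ℝ) ^ (2 * ∑ j ∈ Finset.range W, j / n) ≤ |(s.diffProd : ℝ)| := by
    have := Int.le_of_dvd (abs_pos.2 s.diffProd_ne_zero)
      ((dvd_abs _ _).2 (natCast_pow_dvd_diffProd hq.ne' hcont s hs))
    exact_mod_cast this
  have hlog := Real.log_le_log (by positivity) (hlow.trans (s.abs_diffProd_le a L hL0 hsI))
  rw [Real.log_mul (by positivity) (by positivity), Real.log_pow, Real.log_pow, Real.log_pow,
    Real.log_div hL0.ne' (by norm_num), Real.log_mul (by norm_num) hW0.ne', hL,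
    Real.log_rpow hq0, ← hW] at hlog
  have hE := mul_le_mul_of_nonneg_right (Nat.mul_sub_div_le_two_mul_sum_range_div n W hn)
    (Real.log_natCast_nonneg q)
  have hmain := hE.trans hlog
  rw [Nat.cast_mul, Nat.cast_pred hWpos] at hmain
  refine le_of_mul_le_mul_left ?_ hW0
  have e : (W : ℝ) * (W - n) / n * Real.log q =
      W * (W - 1) * (1 / n * Real.log q) - W * ((1 - 1 / n) * Real.log q) := by
    field_simp
    ring
  linarith

theorem Int.card_Icc_ceil_floor_le_two {a b : ℝ} (h : b - a < 2) :
    (Finset.Icc ⌈a⌉ ⌊b⌋).card ≤ 2 := by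
  have h1 := Int.le_ceil a
  have h2 := Int.floor_le b
  have : ((⌊b⌋ - ⌈a⌉ : ℤ) : ℝ) < 2 := by
    push_cast
    linarith
  have : ⌊b⌋ - ⌈a⌉ < 2 := by exact_mod_cast this
  rw [Int.card_Icc]
  omega

theorem lt_div_log_four_of_sub_two_mul_log_four_le {W c l : ℝ} (hW : 4 ≤ W) (hl : 0 < l)
    (hc : c ≤ 1) (h : (W - 2) * Real.log 4 ≤ c * l + Real.log W) :
    W < c * l / Real.log 4 + Real.log l / Real.log 4 + 3 := by
  have h4 : Real.log 4 = 2 * Real.log 2 := by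
    rw [show (4 : ℝ) = 2 ^ 2 by norm_num, Real.log_pow]
    norm_num
  have h4' : 1.38 < Real.log 4 := by linarith [Real.log_two_gt_d9]
  have hWl : W < 4 * l := by
    by_contra! hcon
    have h1 : Real.log W = Real.log (W / 4) + Real.log 4 := by
      rw [← Real.log_mul (by positivity) (by norm_num)]
      congr 1
      ring
    have h2 := Real.log_le_sub_one_of_pos (show 0 < W / 4 by positivity)
    nlinarith
  have hlogW : Real.log W < Real.log 4 + Real.log l := by
    rw [← Real.log_mul (by norm_num) hl.ne']
    exact Real.log_lt_log (by linarith) hWl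
  rw [← add_div, ← sub_lt_iff_lt_add, lt_div_iff₀ (by linarith)]
  linarith

theorem roots_in_short_interval_log_bound (P : Polynomial ℤ) (n : ℕ) (hn : 2 ≤ n)
    (hdeg : P.natDegree = n) (q : ℕ) (hq : 2 ≤ q)
    (hcont : Int.gcd P.content q = 1)
    (a b : ℝ) (hI : b - a ≤ (q : ℝ) ^ ((1 : ℝ) / n)) :
    ((((Finset.Icc ⌈a⌉ ⌊b⌋).filter (fun x => (q : ℤ) ∣ P.eval x)).card : ℝ)) <
      (1 - 1 / n) * Real.log q / Real.log 4 + Real.log (Real.log q) / Real.log 4 + 3 := by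
  subst hdeg
  set n := P.natDegree
  set s := (Finset.Icc ⌈a⌉ ⌊b⌋).filter (fun x => (q : ℤ) ∣ P.eval x)
  have hn' : (2 : ℝ) ≤ n := by exact_mod_cast hn
  have hq' : (2 : ℝ) ≤ q := by exact_mod_cast hq
  have hlogq : 0 < Real.log q := Real.log_pos (by linarith)
  have h2 := Real.log_two_gt_d9
  have h4 : Real.log 4 = 2 * Real.log 2 := by
    rw [show (4 : ℝ) = 2 ^ 2 by norm_num, Real.log_pow]
    norm_num
  have hinv : (1 : ℝ) / n ≤ 1 / 2 := one_div_le_one_div_of_le (by norm_num) hn'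
  have hmain : 0 ≤ (1 - 1 / n) * Real.log q / Real.log 4 :=
    div_nonneg (mul_nonneg (by linarith) hlogq.le) (by linarith)
  rcases hq.eq_or_lt with rfl | hq3
  · have hcard : (s.card : ℝ) ≤ 2 := by
      refine Nat.cast_le_ofNat.2 ((Finset.card_filter_le _ _).trans
        (Int.card_Icc_ceil_floor_le_two (hI.trans_lt ?_)))
      calc ((2 : ℕ) : ℝ) ^ ((1 : ℝ) / n) < ((2 : ℕ) : ℝ) ^ (1 : ℝ) :=
            Real.rpow_lt_rpow_of_exponent_lt (by norm_num) (by linarith)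
        _ = 2 := by norm_num
    have hloglog : -1 < Real.log (Real.log (2 : ℕ)) / Real.log 4 := by
      rw [lt_div_iff₀ (by linarith)]
      have h := Real.one_sub_inv_le_log_of_pos hlogq
      have hlog2 : Real.log (2 : ℕ) = Real.log 2 := by norm_num
      have hi : (Real.log (2 : ℕ))⁻¹ < 2 := by
        rw [inv_lt_comm₀ hlogq (by norm_num)]
        linarith
      rw [hlog2] at h hi ⊢
      linarith
    linarith
  rcases Nat.lt_or_ge s.card 4 with hW | hW
  · have hcard : (s.card : ℝ) ≤ 3 := by exact_mod_cast Nat.le_of_lt_succ hW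
    have hq3' : (3 : ℝ) ≤ q := by exact_mod_cast hq3
    have hloglog : 0 < Real.log (Real.log q) / Real.log 4 := by
      refine div_pos (Real.log_pos ?_) (by linarith)
      rw [Real.lt_log_iff_exp_lt (by linarith)]
      linarith [Real.exp_one_lt_d9]
    linarith
  · refine lt_div_log_four_of_sub_two_mul_log_four_le (by exact_mod_cast hW) hlogq
      (by linarith [show (0 : ℝ) ≤ 1 / n by positivity]) ?_
    refine Polynomial.card_sub_two_mul_log_four_le (by omega) (by omega) hcont
      (Finset.card_pos.1 (by omega)) (fun x hx => (Finset.mem_filter.1 hx).2) (a := a)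
      fun x hx => ?_
    have hx := Finset.mem_Icc.1 (Finset.mem_filter.1 hx).1
    exact ⟨Int.ceil_le.1 hx.1, by linarith [Int.le_floor.1 hx.2]⟩
end
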